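/- arXiv:1506.03310 — 4 statements merged into one kernel-verified Lean document; each statement's English description precedes it below -/
import Mathlib

section
/- If G is a connected locally isometric graph with maximum degree Δ(G) = 6 such that G contains no pair of true twins of degree 6, then G is either fully cycle extendable or isomorphic to K_{2,4} + K_1, the join of the complete bipartite graph K_{2,4} with a single vertex. -/
open SimpleGraph

def LocallyIsometric {V : Type*} (G : SimpleGraph V) : Prop :=
  ∀ v : V, (G.induce (G.neighborSet v)).ediam ≤ 2

/-- `G` has a cycle whose vertex set is exactly `s`. -/
def HasCycleOn {V : Type*} (G : SimpleGraph V) (s : Set V) : Prop :=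
  ∃ (a : V) (c : G.Walk a a), c.IsCycle ∧ {x | x ∈ c.support} = s

/-- `G` is fully cycle extendable: every vertex lies on a triangle and every
non-Hamiltonian cycle extends to a cycle on the same vertices plus one more. -/
def FullyCycleExtendable {V : Type*} [DecidableEq V] (G : SimpleGraph V) : Prop :=
  (∀ v : V, ∃ u w : V, G.Adj v u ∧ G.Adj u w ∧ G.Adj w v) ∧
  ∀ (a : V) (c : G.Walk a a), c.IsCycle → ¬c.IsHamiltonianCycle →
    ∃ x ∉ c.support, HasCycleOn G (insert x {y | y ∈ c.support})


section Core
variable {V : Type*} {G : SimpleGraph V}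

def LocDiamTwo (G : SimpleGraph V) : Prop :=
  ∀ ⦃v a b : V⦄, G.Adj v a → G.Adj v b → a ≠ b → ¬G.Adj a b →
    ∃ t, G.Adj v t ∧ G.Adj t a ∧ G.Adj t b

def DegLeSix (G : SimpleGraph V) : Prop :=
  ∀ (v : V) (l : List V), l.Nodup → (∀ a ∈ l, G.Adj v a) → l.length ≤ 6

def TwinAt (G : SimpleGraph V) (u w : V) : Prop :=
  u ≠ w ∧ G.Adj u w ∧ ∀ z, z ≠ u → z ≠ w → (G.Adj u z ↔ G.Adj w z)

/-- No vertex having a true twin has six distinct neighbours. -/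
def TwinsDegLeFive (G : SimpleGraph V) : Prop :=
  ∀ (u w : V), TwinAt G u w → ∀ l : List V, l.Nodup → (∀ a ∈ l, G.Adj u a) → l.length ≤ 5

def LinkPair (G : SimpleGraph V) (u v : V) : Prop :=
  TwinAt G u v ∧ ∃ a b c d, (∀ z, G.Adj u z → z = v ∨ z = a ∨ z = b ∨ z = c ∨ z = d) ∧
    (G.Adj u a → G.Adj u c → ¬G.Adj a c) ∧ (G.Adj u a → G.Adj u d → ¬G.Adj a d) ∧
    (G.Adj u b → G.Adj u c → ¬G.Adj b c) ∧ (G.Adj u b → G.Adj u d → ¬G.Adj b d)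

theorem DegLeSix.saturated (hd : DegLeSix G) {v : V} (a b c d e f z : V)
    (hn : a ≠ b ∧ a ≠ c ∧ a ≠ d ∧ a ≠ e ∧ a ≠ f ∧ b ≠ c ∧ b ≠ d ∧ b ≠ e ∧ b ≠ f ∧ c ≠ d ∧
      c ≠ e ∧ c ≠ f ∧ d ≠ e ∧ d ≠ f ∧ e ≠ f)
    (h : G.Adj v a ∧ G.Adj v b ∧ G.Adj v c ∧ G.Adj v d ∧ G.Adj v e ∧ G.Adj v f)
    (hz : G.Adj v z) : z = a ∨ z = b ∨ z = c ∨ z = d ∨ z = e ∨ z = f := by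
  by_contra hcon
  have := hd v [z, a, b, c, d, e, f] (by simp_all) (by simp_all)
  simp at this

theorem TwinsDegLeFive.saturated (hd : TwinsDegLeFive G) {v w : V} (ht : TwinAt G v w)
    (a b c d e z : V)
    (hn : a ≠ b ∧ a ≠ c ∧ a ≠ d ∧ a ≠ e ∧ b ≠ c ∧ b ≠ d ∧ b ≠ e ∧ c ≠ d ∧ c ≠ e ∧ d ≠ e)
    (h : G.Adj v a ∧ G.Adj v b ∧ G.Adj v c ∧ G.Adj v d ∧ G.Adj v e)
    (hz : G.Adj v z) : z = a ∨ z = b ∨ z = c ∨ z = d ∨ z = e := by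
  by_contra hcon
  have := hd v w ht [z, a, b, c, d, e] (by simp_all) (by simp_all)
  simp at this

/-- `{w}, {b, c}, {x, q, r, t}` induce a complete tripartite graph that is closed under taking
neighbours. -/
structure IsTripartite (G : SimpleGraph V) (w b c x q r t : V) : Prop where
  ne : b ≠ c ∧ x ≠ q ∧ x ≠ r ∧ x ≠ t ∧ q ≠ r ∧ q ≠ t ∧ r ≠ t
  adj : G.Adj w b ∧ G.Adj w c ∧ G.Adj w x ∧ G.Adj w q ∧ G.Adj w r ∧ G.Adj w t ∧
    G.Adj b x ∧ G.Adj b q ∧ G.Adj b r ∧ G.Adj b t ∧ G.Adj c x ∧ G.Adj c q ∧ G.Adj c r ∧ G.Adj c t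
  of_w : ∀ z, G.Adj w z → z = b ∨ z = c ∨ z = x ∨ z = q ∨ z = r ∨ z = t
  of_b : ∀ z, G.Adj b z → z = w ∨ z = x ∨ z = q ∨ z = r ∨ z = t
  of_c : ∀ z, G.Adj c z → z = w ∨ z = x ∨ z = q ∨ z = r ∨ z = t
  of_mem : ∀ y, y = x ∨ y = q ∨ y = r ∨ y = t → ∀ z, G.Adj y z → z = w ∨ z = b ∨ z = c

structure Rot (G : SimpleGraph V) (C : Set V) (s p : V → V) : Prop where
  ps : ∀ b, p (s b) = b
  sp : ∀ b, s (p b) = b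
  s_mem : ∀ b ∈ C, s b ∈ C
  p_mem : ∀ b ∈ C, p b ∈ C
  adj_s : ∀ b ∈ C, G.Adj b (s b)
  s_ne_p : ∀ b ∈ C, s b ≠ p b
  closed : ∀ T : Set V, (∃ b ∈ C, b ∈ T) → (∀ b ∈ T, s b ∈ T ∧ p b ∈ T) → C ⊆ T
  insert : ∀ y ∉ C, ∀ b ∈ C, G.Adj y b → ¬G.Adj y (s b)
  cross_s : ∀ y ∉ C, ∀ b ∈ C, ∀ c ∈ C, b ≠ c → G.Adj y b → G.Adj y c → ¬G.Adj (s b) (s c)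
  cross_p : ∀ y ∉ C, ∀ b ∈ C, ∀ c ∈ C, b ≠ c → G.Adj y b → G.Adj y c → ¬G.Adj (p b) (p c)
  bypass_s : ∀ y ∉ C, ∀ b ∈ C, ∀ c ∈ C, b ≠ c → G.Adj y b → G.Adj y c → G.Adj (s b) (p b) →
    ¬G.Adj b (s c)
  bypass_p : ∀ y ∉ C, ∀ b ∈ C, ∀ c ∈ C, b ≠ c → G.Adj y b → G.Adj y c → G.Adj (s b) (p b) →
    ¬G.Adj b (p c)

namespace Rot
variable {C : Set V} {s p : V → V}

theorem s_inj (h : Rot G C s p) {a b : V} (hab : s a = s b) : a = b := by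
  rw [← h.ps a, ← h.ps b, hab]

theorem adj_p (h : Rot G C s p) {b : V} (hb : b ∈ C) : G.Adj b (p b) := by
  have := h.adj_s _ (h.p_mem b hb)
  rw [h.sp] at this
  exact this.symm

theorem insert_p (h : Rot G C s p) {y b : V} (hy : y ∉ C) (hb : b ∈ C) (hyb : G.Adj y b) :
    ¬G.Adj y (p b) := fun hyp => by
  have := h.insert y hy _ (h.p_mem b hb) hyp
  rw [h.sp] at this
  exact this hyb

theorem symm (h : Rot G C s p) : Rot G C p s where
  ps := h.sp
  sp := h.ps
  s_mem := h.p_mem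
  p_mem := h.s_mem
  adj_s := fun _ hb => h.adj_p hb
  s_ne_p := fun b hb => (h.s_ne_p b hb).symm
  closed := fun T hT hc => h.closed T hT fun b hb => (hc b hb).symm
  insert := fun _ hy _ hb => h.insert_p hy hb
  cross_s := h.cross_p
  cross_p := h.cross_s
  bypass_s := fun y hy b hb c hc hbc h1 h2 h3 => h.bypass_p y hy b hb c hc hbc h1 h2 h3.symm
  bypass_p := fun y hy b hb c hc hbc h1 h2 h3 => h.bypass_s y hy b hb c hc hbc h1 h2 h3.symm

theorem demand (h : Rot G C s p) (hl : LocDiamTwo G) {y b : V} (hy : y ∉ C) (hb : b ∈ C)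
    (hyb : G.Adj y b) : ∃ a ∈ C, a ≠ b ∧ G.Adj y a ∧ G.Adj a b ∧ G.Adj a (s b) := by
  obtain ⟨t, h1, h2, h3⟩ := hl hyb.symm (h.adj_s b hb)
    (fun e => hy (e ▸ h.s_mem b hb)) (h.insert y hy b hb hyb)
  refine ⟨t, ?_, h1.ne', h2.symm, h1.symm, h3⟩
  by_contra ht
  exact h.insert t ht b hb h1.symm h3

/-- The only common neighbour of `x` and `c` on the cycle is `d`. -/
def Sole (G : SimpleGraph V) (C : Set V) (x c d : V) : Prop :=
  ∀ a ∈ C, G.Adj x a → G.Adj a c → a = d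

theorem four (h : Rot G C s p) {b : V} (hb : b ∈ C) (he : s (s b) = p (p b)) {z : V}
    (hz : z ∈ C) : z = b ∨ z = s b ∨ z = p b ∨ z = s (s b) := by
  have := h.closed {b, s b, p b, s (s b)} ⟨b, hb, by simp⟩ (by
    have h1 := h.ps
    have h2 := h.sp
    simp only [Set.mem_insert_iff, Set.mem_singleton_iff]
    grind) hz
  simpa using this

theorem six (h : Rot G C s p) {b : V} (hb : b ∈ C) (he : s (s (s b)) = p (p (p b))) {z : V}
    (hz : z ∈ C) : z = b ∨ z = s b ∨ z = p b ∨ z = s (s b) ∨ z = p (p b) ∨ z = s (s (s b)) := by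
  have := h.closed {b, s b, p b, s (s b), p (p b), s (s (s b))} ⟨b, hb, by simp⟩ (by
    have h1 := h.ps
    have h2 := h.sp
    simp only [Set.mem_insert_iff, Set.mem_singleton_iff]
    grind) hz
  simpa using this

theorem adj_s_of_sole (h : Rot G C s p) (hl : LocDiamTwo G) {x c d : V}
    (hx : x ∉ C) (hcC : c ∈ C) (hxc : G.Adj x c) (h1 : Sole G C x c d) :
    G.Adj d c ∧ G.Adj d (s c) := by
  obtain ⟨a, haC, hac, hxa, hacd, haS⟩ := h.demand hl hx hcC hxc
  obtain rfl := h1 a haC hxa hacd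
  exact ⟨hacd, haS⟩

theorem off_adj_of_sole (h : Rot G C s p) (hl : LocDiamTwo G) (hd : DegLeSix G) {x c d : V}
    (hx : x ∉ C) (hcC : c ∈ C) (hdC : d ∈ C) (hxc : G.Adj x c) (hxd : G.Adj x d)
    (h1 : Sole G C x c d) (h2 : Sole G C x d c) {z : V} (hz : z ∉ C) (hzc : G.Adj z c) :
    G.Adj z d := by
  by_contra hzd
  obtain ⟨hdc, hds⟩ := h.adj_s_of_sole hl hx hcC hxc h1
  obtain ⟨-, hdp⟩ := h.symm.adj_s_of_sole hl hx hcC hxc h1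
  obtain ⟨-, hcs⟩ := h.adj_s_of_sole hl hx hdC hxd h2
  obtain ⟨-, hcp⟩ := h.symm.adj_s_of_sole hl hx hdC hxd h2
  obtain ⟨e, heC, hec, hze, hedc, heS⟩ := h.demand hl hz hcC hzc
  obtain ⟨f, hfC, hfc, hzf, hfdc, hfP⟩ := h.symm.demand hl hz hcC hzc
  have hs := h.adj_s _ hcC
  have hp := h.adj_p hcC
  have hsp := h.s_ne_p _ hcC
  have hcd : c ≠ d := hdc.ne'
  have i1 := h.insert z hz _ hcC hzc
  have i2 := h.insert_p hz hcC hzc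
  have i3 := h.insert x hx _ hcC hxc
  have i4 := h.insert_p hx hcC hxc
  have i5 := h.insert x hx _ hdC hxd
  have i6 := h.insert_p hx hdC hxd
  have j1 := h.cross_s x hx _ hcC _ hdC hcd hxc hxd
  have j2 := h.cross_p x hx _ hcC _ hdC hcd hxc hxd
  have sC := h.s_mem _ hcC
  have pC := h.p_mem _ hcC
  have sdC := h.s_mem _ hdC
  have pdC := h.p_mem _ hdC
  have ps := h.ps
  have sp := h.sp
  have hxz : x ≠ z := by rintro rfl; exact hzd hxd
  have hds' := (h.adj_s _ hdC).ne
  have hdp' := (h.adj_p hdC).ne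
  have sat := hd.saturated (v := c) x z d (s c) (p c) e
  by_cases hef : e = f
  · subst hef
    have k1 := sat (s d) (by and_intros <;> grind) (by and_intros <;> grind [SimpleGraph.Adj.symm]) hcs
    have k2 := sat (p d) (by and_intros <;> grind) (by and_intros <;> grind [SimpleGraph.Adj.symm]) hcp
    have e1 : s d ≠ x := by grind
    have e2 : s d ≠ z := by grind
    have e3 : p d ≠ x := by grind
    have e4 : p d ≠ z := by grind
    have e5 : s d ≠ e := by rintro rfl; exact j1 heS.symm
    have e6 : p d ≠ e := by rintro rfl; exact j2 hfP.symm
    have e7 : s d = p c := by grind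
    have e8 : p d = s c := by grind
    have := h.four hcC (by grind) heC
    grind
  · have k1 := sat f (by and_intros <;> grind) (by and_intros <;> grind [SimpleGraph.Adj.symm]) hfdc.symm
    have := hze.ne
    grind [SimpleGraph.Adj.symm]

theorem adj_of_sole (h : Rot G C s p) (hl : LocDiamTwo G) (hd : DegLeSix G) {x c d : V}
    (hx : x ∉ C) (hcC : c ∈ C) (hdC : d ∈ C) (hxc : G.Adj x c) (hxd : G.Adj x d)
    (h1 : Sole G C x c d) (h2 : Sole G C x d c) {z : V} (hne : z ≠ d) (hzc : G.Adj c z) :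
    G.Adj d z := by
  by_cases hz : z ∈ C
  swap
  · exact (h.off_adj_of_sole hl hd hx hcC hdC hxc hxd h1 h2 hz hzc.symm).symm
  by_contra hzd
  obtain ⟨hdc, hds⟩ := h.adj_s_of_sole hl hx hcC hxc h1
  obtain ⟨-, hdp⟩ := h.symm.adj_s_of_sole hl hx hcC hxc h1
  obtain ⟨-, hcs⟩ := h.adj_s_of_sole hl hx hdC hxd h2
  obtain ⟨-, hcp⟩ := h.symm.adj_s_of_sole hl hx hdC hxd h2
  have hxz : ¬G.Adj x z := fun hxz => hne (h1 z hz hxz hzc.symm)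
  obtain ⟨u, hcu, hux, huz⟩ := hl hxc.symm hzc (by grind) hxz
  have hud : u ≠ d := by rintro rfl; exact hzd huz
  have hu : u ∉ C := fun hu => hud (h1 u hu hux.symm hcu.symm)
  have hud := h.off_adj_of_sole hl hd hx hcC hdC hxc hxd h1 h2 hu hcu.symm
  have hs := h.adj_s _ hcC
  have hp := h.adj_p hcC
  have hsp := h.s_ne_p _ hcC
  have hds' := (h.adj_s _ hdC)
  have hdp' := (h.adj_p hdC)
  have i3 := h.insert x hx _ hcC hxc
  have i4 := h.insert_p hx hcC hxc
  have sC := h.s_mem _ hcC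
  have pC := h.p_mem _ hcC
  have sdC := h.s_mem _ hdC
  have pdC := h.p_mem _ hdC
  have ps := h.ps
  have sp := h.sp
  have sat := hd.saturated (v := c) x u d (s c) (p c) z
  have k1 := sat (s d) (by and_intros <;> grind) (by and_intros <;> grind [SimpleGraph.Adj.symm]) hcs
  have k2 := sat (p d) (by and_intros <;> grind) (by and_intros <;> grind [SimpleGraph.Adj.symm]) hcp
  have n1 : s d ≠ s c := fun e => hdc.ne (h.s_inj e)
  have n2 : p d ≠ p c := fun e => hdc.ne (h.symm.s_inj e)
  have n3 := hds'.ne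
  have n4 := hdp'.ne
  have e7 : s d = p c := by grind
  have e8 : p d = s c := by grind
  have := h.four hcC (by grind) hz
  grind

theorem twinAt_of_sole (h : Rot G C s p) (hl : LocDiamTwo G) (hd : DegLeSix G) {x c d : V}
    (hx : x ∉ C) (hcC : c ∈ C) (hdC : d ∈ C) (hxc : G.Adj x c) (hxd : G.Adj x d)
    (h1 : Sole G C x c d) (h2 : Sole G C x d c) : TwinAt G c d := by
  obtain ⟨hdc, -⟩ := h.adj_s_of_sole hl hx hcC hxc h1
  exact ⟨hdc.ne', hdc.symm, fun z hzc hzd =>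
    ⟨h.adj_of_sole hl hd hx hcC hdC hxc hxd h1 h2 hzd,
      h.adj_of_sole hl hd hx hdC hcC hxd hxc h2 h1 hzc⟩⟩

theorem linkPair_of_sole_aux (h : Rot G C s p) (hl : LocDiamTwo G) (hd : DegLeSix G)
    (ht : TwinsDegLeFive G) {x c d : V}
    (hx : x ∉ C) (hcC : c ∈ C) (hdC : d ∈ C) (hxc : G.Adj x c) (hxd : G.Adj x d)
    (h1 : Sole G C x c d) (h2 : Sole G C x d c) (hr : s c = p d) : LinkPair G c d := by
  have tw := h.twinAt_of_sole hl hd hx hcC hdC hxc hxd h1 h2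
  obtain ⟨hdc, hds⟩ := h.adj_s_of_sole hl hx hcC hxc h1
  obtain ⟨-, hdp⟩ := h.symm.adj_s_of_sole hl hx hcC hxc h1
  obtain ⟨-, hcs⟩ := h.adj_s_of_sole hl hx hdC hxd h2
  have hs := h.adj_s _ hcC
  have hp := h.adj_p hcC
  have hsp := h.s_ne_p _ hcC
  have hsd := h.adj_s _ hdC
  have hspd := h.s_ne_p _ hdC
  have hcd : c ≠ d := hdc.ne'
  have i1 := h.insert x hx _ hcC hxc
  have i2 := h.insert_p hx hcC hxc
  have i3 := h.insert x hx _ hdC hxd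
  have j1 := h.cross_s x hx _ hcC _ hdC hcd hxc hxd
  have j2 := h.cross_p x hx _ hcC _ hdC hcd hxc hxd
  have sC := h.s_mem _ hcC
  have pC := h.p_mem _ hcC
  have sdC := h.s_mem _ hdC
  have full := ht.saturated tw x (s c) (p c) d
  by_cases he : p c = s d
  · by_cases hy : ∃ y, G.Adj c y ∧ y ≠ x ∧ y ≠ s c ∧ y ≠ p c ∧ y ≠ d
    · obtain ⟨y, hcy, hy⟩ := hy
      have hyC : y ∉ C := by
        intro hyC
        have ps := h.ps
        have sp := h.sp
        have := h.four hcC (by grind) hyC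
        grind [hcy.ne]
      have hf := fun z => full y z (by and_intros <;> grind) (by and_intros <;> grind [SimpleGraph.Adj.symm])
      have l1 := h.insert y hyC _ hcC hcy.symm
      have l2 := h.insert_p hyC hcC hcy.symm
      exact ⟨tw, x, y, s c, p c, by grind, by grind⟩
    · push Not at hy
      exact ⟨tw, x, x, s c, p c, by grind, by grind⟩
  · have hf := fun z => full (s d) z (by and_intros <;> grind) (by and_intros <;> grind [SimpleGraph.Adj.symm])
    exact ⟨tw, x, s c, p c, s d, by grind, by grind [SimpleGraph.Adj.symm]⟩

theorem linkPair_of_sole (h : Rot G C s p) (hl : LocDiamTwo G) (hd : DegLeSix G)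
    (ht : TwinsDegLeFive G) {x c d : V}
    (hx : x ∉ C) (hcC : c ∈ C) (hdC : d ∈ C) (hxc : G.Adj x c) (hxd : G.Adj x d)
    (h1 : Sole G C x c d) (h2 : Sole G C x d c) : LinkPair G c d := by
  by_cases hr : s c = p d
  · exact h.linkPair_of_sole_aux hl hd ht hx hcC hdC hxc hxd h1 h2 hr
  by_cases hr' : p c = s d
  · exact h.symm.linkPair_of_sole_aux hl hd ht hx hcC hdC hxc hxd h1 h2 hr'
  exfalso
  have tw := h.twinAt_of_sole hl hd hx hcC hdC hxc hxd h1 h2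
  obtain ⟨hdc, hds⟩ := h.adj_s_of_sole hl hx hcC hxc h1
  obtain ⟨-, hcs⟩ := h.adj_s_of_sole hl hx hdC hxd h2
  obtain ⟨-, hcp⟩ := h.symm.adj_s_of_sole hl hx hdC hxd h2
  have hs := h.adj_s _ hcC
  have hp := h.adj_p hcC
  have hsp := h.s_ne_p _ hcC
  have hsd := h.adj_s _ hdC
  have hpd := h.adj_p hdC
  have hspd := h.s_ne_p _ hdC
  have sC := h.s_mem _ hcC
  have pC := h.p_mem _ hcC
  have sdC := h.s_mem _ hdC
  have pdC := h.p_mem _ hdC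
  have ps := h.ps
  have sp := h.sp
  have n1 : s d ≠ s c := fun e => hdc.ne (h.s_inj e)
  have n2 : p d ≠ p c := fun e => hdc.ne (h.symm.s_inj e)
  have hcd := hdc.ne
  have i1 := h.insert x hx _ hcC hxc
  have i2 := h.insert_p hx hcC hxc
  have := ht.saturated tw x (s c) (p c) d (s d) (p d) (by and_intros <;> grind)
    (by and_intros <;> grind [SimpleGraph.Adj.symm]) hcp
  grind
end Rot

/-- A cycle with rotation `s`, its inverse `p`, an outside vertex `x`, and no pair of cycle
vertices that are each other's only common neighbour with `x` on the cycle. -/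
structure Good (G : SimpleGraph V) (C : Set V) (s p : V → V) (x : V) : Prop where
  rot : Rot G C s p
  loc : LocDiamTwo G
  deg : DegLeSix G
  twin : TwinsDegLeFive G
  nmem : x ∉ C
  not_sole : ∀ c ∈ C, ∀ d ∈ C, G.Adj x c → G.Adj x d →
    Rot.Sole G C x c d → ¬Rot.Sole G C x d c

/-- `v` is a cycle vertex next to a neighbour of `x`, and is joined to `b` by a chord. -/
def Hit (G : SimpleGraph V) (C : Set V) (s p : V → V) (x b v : V) : Prop :=
  v ∈ C ∧ G.Adj b v ∧ v ≠ s b ∧ v ≠ p b ∧ ¬G.Adj x v ∧ (G.Adj x (p v) ∨ G.Adj x (s v))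

/-- `w` is adjacent to `b` and both its cycle neighbours, is at cycle distance two from `b` on one
side, and is joined by a chord to the cycle neighbour of `b` on the other side. -/
def Far (G : SimpleGraph V) (C : Set V) (s p : V → V) (x b w : V) : Prop :=
  w ∈ C ∧ G.Adj x w ∧ G.Adj b w ∧ G.Adj w (s b) ∧ G.Adj w (p b) ∧
    ((w = s (s b) ∧ p b ≠ s w) ∨ (w = p (p b) ∧ s b ≠ p w))

/-- The cycle has six vertices, alternately adjacent and not adjacent to `x`. -/
def Six (G : SimpleGraph V) (C : Set V) (s p : V → V) (x b w c : V) : Prop :=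
  b ∈ C ∧ w ∈ C ∧ c ∈ C ∧ G.Adj x b ∧ G.Adj x w ∧ G.Adj x c ∧
    s (s b) = w ∧ s (s w) = c ∧ s (s c) = b ∧ G.Adj w b ∧ G.Adj w c ∧ G.Adj w (p b)

theorem Hit.symm {C : Set V} {s p : V → V} {x b v : V} (h : Hit G C s p x b v) :
    Hit G C p s x b v :=
  ⟨h.1, h.2.1, h.2.2.2.1, h.2.2.1, h.2.2.2.2.1, h.2.2.2.2.2.symm⟩

theorem Far.symm {C : Set V} {s p : V → V} {x b w : V} (h : Far G C s p x b w) :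
    Far G C p s x b w :=
  ⟨h.1, h.2.1, h.2.2.1, h.2.2.2.2.1, h.2.2.2.1, h.2.2.2.2.2.symm⟩

namespace Good
variable {C : Set V} {s p : V → V} {x : V}

theorem symm (h : Good G C s p x) : Good G C p s x :=
  ⟨h.rot.symm, h.loc, h.deg, h.twin, h.nmem, h.not_sole⟩

theorem six_symm (h : Good G C s p x) {b w c : V} (k : Six G C s p x b w c) :
    Six G C p s x c w b := by
  obtain ⟨k1, k2, k3, k4, k5, k6, k7, k8, k9, k10, k11, k12⟩ := k
  have ps := h.rot.ps
  refine ⟨k3, k2, k1, k6, k5, k4, ?_, ?_, ?_, k11, k10, ?_⟩ <;> grind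

theorem nbhd_of_hit (h : Good G C s p x) {b v e g z : V} (hb : b ∈ C) (hxb : G.Adj x b)
    (hv : Hit G C s p x b v) (he : e ∈ C) (hxe : G.Adj x e) (hbe : G.Adj b e)
    (hg : g ∈ C) (hxg : G.Adj x g) (hbg : G.Adj b g) (heg : e ≠ g) (hz : G.Adj b z) :
    z = x ∨ z = s b ∨ z = p b ∨ z = e ∨ z = g ∨ z = v := by
  obtain ⟨v1, v2, v3, v4, v5, v6⟩ := hv
  have sC := h.rot.s_mem b hb
  have pC := h.rot.p_mem b hb
  have hx := h.nmem
  have as := h.rot.adj_s b hb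
  have ap := h.rot.adj_p hb
  have hsp := h.rot.s_ne_p b hb
  have i1 := h.rot.insert x hx b hb hxb
  have i2 := h.rot.insert_p hx hb hxb
  exact h.deg.saturated x (s b) (p b) e g v z (by and_intros <;> grind)
    (by and_intros <;> grind [SimpleGraph.Adj.symm]) hz

theorem hit_unique (h : Good G C s p x) {b v v' e g : V} (hb : b ∈ C) (hxb : G.Adj x b)
    (hv : Hit G C s p x b v) (hv' : Hit G C s p x b v') (he : e ∈ C) (hxe : G.Adj x e)
    (hbe : G.Adj b e) (hg : g ∈ C) (hxg : G.Adj x g) (hbg : G.Adj b g) (heg : e ≠ g) :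
    v' = v := by
  have := h.nbhd_of_hit hb hxb hv he hxe hbe hg hxg hbg heg hv'.2.1
  obtain ⟨v1, v2, v3, v4, v5, v6⟩ := hv'
  have hx := h.nmem
  grind

theorem ne_four (h : Good G C s p x) {b : V} (hb : b ∈ C) (hxb : G.Adj x b)
    (hw : G.Adj x (s (s b))) : s (s b) ≠ p (p b) := fun he => by
  have i1 := h.rot.insert x h.nmem b hb hxb
  have i2 := h.rot.insert_p h.nmem hb hxb
  have sC := h.rot.s_mem _ (h.rot.s_mem b hb)
  have f := fun z => h.rot.four (z := z) hb he
  refine h.not_sole b hb _ sC hxb hw (fun a ha hxa hab => ?_) (fun a ha hxa hab => ?_)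
  · have := f a ha; grind [hab.ne]
  · have := f a ha; grind [hab.ne]

theorem hit_p_of_far (h : Good G C s p x) {b w : V} (hb : b ∈ C) (hxb : G.Adj x b)
    (k : Far G C s p x b w) (hw : w = s (s b)) : Hit G C s p x w (p b) := by
  obtain ⟨k1, k2, k3, k4, k5, k6⟩ := k
  have hne := h.ne_four hb hxb (hw ▸ k2)
  refine ⟨h.rot.p_mem b hb, k5, ?_, fun e => k3.ne (h.rot.symm.s_inj e),
    h.rot.insert_p h.nmem hb hxb, .inr ?_⟩
  · grind
  · rwa [h.rot.sp]

theorem hit_of_far (h : Good G C s p x) {b w : V} (hb : b ∈ C) (hxb : G.Adj x b)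
    (k : Far G C s p x b w) :
    (w = s (s b) ∧ Hit G C s p x w (p b)) ∨ (w = p (p b) ∧ Hit G C s p x w (s b)) := by
  rcases k.2.2.2.2.2 with ⟨e, -⟩ | ⟨e, -⟩
  · exact .inl ⟨e, h.hit_p_of_far hb hxb k e⟩
  · exact .inr ⟨e, (h.symm.hit_p_of_far hb hxb k.symm e).symm⟩

theorem exists_common (h : Good G C s p x) {b v : V} (hb : b ∈ C) (hxb : G.Adj x b)
    (hv : Hit G C s p x b v) :
    ∃ w ∈ C, G.Adj x w ∧ G.Adj b w ∧ G.Adj w (s b) ∧ G.Adj w (p b) := by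
  have hx := h.nmem
  have hn : ¬G.Adj (s b) (p b) := fun hsp => by
    obtain ⟨v1, v2, v3, v4, v5, v6 | v6⟩ := hv
    · refine h.rot.bypass_s x hx b hb _ (h.rot.p_mem v v1) ?_ hxb v6 hsp (by rwa [h.rot.sp])
      rintro rfl; exact v3 (h.rot.sp v).symm
    · refine h.rot.bypass_p x hx b hb _ (h.rot.s_mem v v1) ?_ hxb v6 hsp (by rwa [h.rot.ps])
      rintro rfl; exact v4 (h.rot.ps v).symm
  obtain ⟨a, aC, a1, a2, a3, a4⟩ := h.rot.demand h.loc hx hb hxb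
  obtain ⟨c, cC, c1, c2, c3, c4⟩ := h.rot.symm.demand h.loc hx hb hxb
  by_cases hac : a = c
  · exact ⟨a, aC, a2, a3.symm, a4, hac ▸ c4⟩
  obtain ⟨t, t1, t2, t3⟩ := h.loc (h.rot.adj_s b hb) (h.rot.adj_p hb) (h.rot.s_ne_p b hb) hn
  have := h.nbhd_of_hit hb hxb hv aC a2 a3.symm cC c2 c3.symm hac t1
  have i1 := h.rot.insert x hx b hb hxb
  have ht : t ≠ v := by
    rintro rfl
    obtain ⟨v1, v2, v3, v4, v5, v6 | v6⟩ := hv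
    · have := h.rot.cross_s x hx b hb _ (h.rot.p_mem t v1)
        (by rintro rfl; exact v3 (h.rot.sp t).symm) hxb v6
      rw [h.rot.sp] at this
      exact this t2.symm
    · have := h.rot.cross_p x hx b hb _ (h.rot.s_mem t v1)
        (by rintro rfl; exact v4 (h.rot.ps t).symm) hxb v6
      rw [h.rot.ps] at this
      exact this t3.symm
  have := t2.ne
  have := t3.ne
  rcases ‹t = x ∨ _› with rfl | rfl | rfl | rfl | rfl | rfl
  · exact absurd t2 i1
  · contradiction
  · contradiction
  · exact ⟨t, aC, a2, t1, t2, t3⟩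
  · exact ⟨t, cC, c2, t1, t2, t3⟩
  · contradiction

theorem exists_far (h : Good G C s p x) {b v : V} (hb : b ∈ C) (hxb : G.Adj x b)
    (hv : Hit G C s p x b v) : ∃ w, Far G C s p x b w := by
  have hx := h.nmem
  obtain ⟨w, wC, w1, w2, w3, w4⟩ := h.exists_common hb hxb hv
  have sp := h.rot.sp
  have ps := h.rot.ps
  have bw := w2.ne
  have sne : s b ≠ s w := fun e => bw (h.rot.s_inj e)
  have pne : p b ≠ p w := fun e => bw (h.rot.symm.s_inj e)
  have i1 := h.rot.insert x hx b hb hxb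
  have i2 := h.rot.insert_p hx hb hxb
  have sC := h.rot.s_mem b hb
  have pC := h.rot.p_mem b hb
  by_cases e1 : w = s (s b)
  · have := h.ne_four hb hxb (e1 ▸ w1)
    exact ⟨w, wC, w1, w2, w3, w4, .inl ⟨e1, by grind⟩⟩
  by_cases e2 : w = p (p b)
  · have := h.symm.ne_four hb hxb (e2 ▸ w1)
    exact ⟨w, wC, w1, w2, w3, w4, .inr ⟨e2, by grind⟩⟩
  exfalso
  have h1 : Hit G C s p x w (s b) :=
    ⟨sC, w3, sne, by grind, i1, by grind⟩
  have h2 : Hit G C s p x w (p b) :=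
    ⟨pC, w4, by grind, pne, i2, by grind⟩
  have hs1 : Rot.Sole G C x w b := fun a ha hxa haw => by
    by_contra hab
    exact h.rot.s_ne_p b hb
      (h.hit_unique wC w1 h2 h1 hb hxb w2.symm ha hxa haw.symm (Ne.symm hab))
  obtain ⟨-, k1⟩ := h.rot.adj_s_of_sole h.loc hx wC w1 hs1
  obtain ⟨-, k2⟩ := h.rot.symm.adj_s_of_sole h.loc hx wC w1 hs1
  have j1 := h.rot.insert x hx w wC w1
  have j2 := h.rot.insert_p hx wC w1
  have swC := h.rot.s_mem w wC
  have pwC := h.rot.p_mem w wC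
  have h3 : Hit G C s p x b (s w) := ⟨swC, k1, sne.symm, by grind, j1, by grind⟩
  have h4 : Hit G C s p x b (p w) := ⟨pwC, k2, by grind, pne.symm, j2, by grind⟩
  refine h.not_sole w wC b hb w1 hxb hs1 fun a ha hxa hab => ?_
  by_contra haw
  exact h.rot.s_ne_p w wC
    (h.hit_unique hb hxb h4 h3 wC w1 w2 ha hxa hab.symm (Ne.symm haw))

theorem next_of_no_hit (h : Good G C s p x)
    (hn : ∀ b ∈ C, G.Adj x b → ∀ v, ¬Hit G C s p x b v) {b : V} (hb : b ∈ C) (hxb : G.Adj x b) :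
    s (s b) ∈ C ∧ G.Adj x (s (s b)) ∧ G.Adj b (s (s b)) ∧ p (p b) ≠ s (s b) := by
  have hx := h.nmem
  obtain ⟨a, aC, a1, a2, a3, a4⟩ := h.rot.demand h.loc hx hb hxb
  have e : a = s (s b) := by
    by_contra hne
    refine hn a aC a2 (s b) ⟨h.rot.s_mem b hb, a4, fun e => a1 (h.rot.s_inj e).symm, ?_,
      h.rot.insert x hx b hb hxb, .inl ?_⟩
    · intro e
      apply hne
      rw [e, h.rot.sp]
    · rwa [h.rot.ps]
  subst e
  exact ⟨aC, a2, a3.symm, (h.ne_four hb hxb a2).symm⟩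

theorem common_of_no_hit (h : Good G C s p x)
    (hn : ∀ b ∈ C, G.Adj x b → ∀ v, ¬Hit G C s p x b v) {b : V} (hb : b ∈ C) (hxb : G.Adj x b) :
    ∃ w ∈ C, ¬G.Adj x w ∧ G.Adj b w ∧ G.Adj w (s b) ∧ G.Adj w (p b) ∧
      (∀ z, G.Adj b z → z = x ∨ z = s b ∨ z = p b ∨ z = s (s b) ∨ z = p (p b) ∨ z = w) := by
  have hx := h.nmem
  have hn' : ∀ b ∈ C, G.Adj x b → ∀ v, ¬Hit G C p s x b v :=
    fun b hb hxb v hv => hn b hb hxb v hv.symm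
  obtain ⟨e1, e2, e3, e4⟩ := h.next_of_no_hit hn hb hxb
  obtain ⟨f1, f2, f3, f4⟩ := h.symm.next_of_no_hit hn' hb hxb
  have sp := h.rot.sp
  have ps := h.rot.ps
  have sb := h.rot.adj_s b hb
  have pb := h.rot.adj_p hb
  have i1 := h.rot.insert x hx b hb hxb
  have i2 := h.rot.insert_p hx hb hxb
  have sC := h.rot.s_mem b hb
  have pC := h.rot.p_mem b hb
  have spb := h.rot.s_ne_p b hb
  have j := h.rot.cross_p x hx b hb _ e1 e3.ne hxb e2
  rw [ps] at j
  obtain ⟨w, w1, w2, w3⟩ := h.loc sb pb spb (fun e => j e.symm)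
  have wC : w ∈ C := by
    by_contra wC
    exact h.rot.insert w wC b hb w1.symm w2
  have hxw : ¬G.Adj x w := by
    intro hxw
    have bw := w1.ne
    have sne : s b ≠ s w := fun e => bw (h.rot.s_inj e)
    have pne : p b ≠ p w := fun e => bw (h.rot.symm.s_inj e)
    have k1 := fun k1 k2 => hn w wC hxw (s b) ⟨sC, w2, sne, k1, i1, k2⟩
    have k2 := fun k1 k2 => hn w wC hxw (p b) ⟨pC, w3, k1, pne, i2, k2⟩
    grind
  have bsb := sb.ne
  have bpb := pb.ne
  have nws := w2.ne
  have nwp := w3.ne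
  refine ⟨w, wC, hxw, w1, w2, w3, fun z =>
    h.deg.saturated x (s b) (p b) (s (s b)) (p (p b)) w z (by and_intros <;> grind)
    (by and_intros <;> grind [SimpleGraph.Adj.symm])⟩

theorem absurd_of_no_hit (h : Good G C s p x)
    (hn : ∀ b ∈ C, G.Adj x b → ∀ v, ¬Hit G C s p x b v) {b w : V} (hb : b ∈ C) (hxb : G.Adj x b)
    (wC : w ∈ C) (hxw : ¬G.Adj x w) (w1 : G.Adj b w) (w2 : G.Adj w (s b)) (w3 : G.Adj w (p b))
    (hw : G.Adj (s (s b)) w) : False := by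
  have hx := h.nmem
  have hn' : ∀ b ∈ C, G.Adj x b → ∀ v, ¬Hit G C p s x b v :=
    fun b hb hxb v hv => hn b hb hxb v hv.symm
  obtain ⟨e1, e2, e3, e4⟩ := h.next_of_no_hit hn hb hxb
  obtain ⟨f1, f2, f3, f4⟩ := h.symm.next_of_no_hit hn' hb hxb
  obtain ⟨g1, g2, g3, g4⟩ := h.next_of_no_hit hn e1 e2
  obtain ⟨u, uC, hxu, u1, u2, u3, hu⟩ := h.common_of_no_hit hn e1 e2
  have sp := h.rot.sp
  have ps := h.rot.ps
  have hb1 := hn b hb hxb w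
  have hne := h.rot.s_ne_p w wC
  have sb := h.rot.adj_s b hb
  have pb := h.rot.adj_p hb
  have spb := h.rot.s_ne_p b hb
  have sw := h.rot.adj_s w wC
  have pw := h.rot.adj_p wC
  have se := h.rot.adj_s _ e1
  have spe := h.rot.s_ne_p _ e1
  have sb' := sb.ne
  have pb' := pb.ne
  have nws := w2.ne
  have nwp := w3.ne
  have nwe := w1.ne
  have nw2 := hw.ne
  have nse := se.ne
  have nb2 := e3.ne
  have b1 : ¬G.Adj x (s w) := fun k => hb1 ⟨wC, w1, nws, nwp, hxw, .inr k⟩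
  have b2 : ¬G.Adj x (p w) := fun k => hb1 ⟨wC, w1, nws, nwp, hxw, .inl k⟩
  have hwu := hu w hw
  have hwu : w = u := by grind
  subst hwu
  have wse : G.Adj w (s (s (s b))) := u2
  have nwse := wse.ne
  have i1 := h.rot.insert x hx b hb hxb
  have i2 := h.rot.insert_p hx hb hxb
  have i3 := h.rot.insert x hx _ e1 e2
  have := h.deg.saturated (v := w) b (s (s b)) (s b) (p b) (s (s (s b))) (s w) (p w)
    (by and_intros <;> grind) (by and_intros <;> grind [SimpleGraph.Adj.symm]) pw
  grind

theorem exists_hit (h : Good G C s p x) {b : V} (hb : b ∈ C) (hxb : G.Adj x b) :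
    ∃ b ∈ C, G.Adj x b ∧ ∃ v, Hit G C s p x b v := by
  by_contra hcon
  have hn : ∀ b ∈ C, G.Adj x b → ∀ v, ¬Hit G C s p x b v :=
    fun b hb hxb v hv => hcon ⟨b, hb, hxb, v, hv⟩
  have hn' : ∀ b ∈ C, G.Adj x b → ∀ v, ¬Hit G C p s x b v :=
    fun b hb hxb v hv => hn b hb hxb v hv.symm
  obtain ⟨w, wC, hxw, w1, w2, w3, hw⟩ := h.common_of_no_hit hn hb hxb
  have hx := h.nmem
  obtain ⟨t, t1, t2, t3⟩ := h.loc hxb.symm w1 (by grind) hxw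
  have i1 := h.rot.insert x hx b hb hxb
  have i2 := h.rot.insert_p hx hb hxb
  rcases hw t t1 with rfl | rfl | rfl | rfl | rfl | rfl
  · exact hxw t3
  · exact i1 t2.symm
  · exact i2 t2.symm
  · exact h.absurd_of_no_hit hn hb hxb wC hxw w1 w2 w3 t3
  · exact h.symm.absurd_of_no_hit hn' hb hxb wC hxw w1 w3 w2 t3
  · exact hxw t2.symm

theorem nbhd_of_six (h : Good G C s p x) {b w c : V} (k : Six G C s p x b w c) {z : V}
    (hz : G.Adj w z) : z = x ∨ z = b ∨ z = c ∨ z = s b ∨ z = s w ∨ z = p b := by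
  obtain ⟨k1, k2, k3, k4, k5, k6, k7, k8, k9, k10, k11, k12⟩ := k
  have hx := h.nmem
  have ps := h.rot.ps
  have i1 := h.rot.insert x hx b k1 k4
  have i2 := h.rot.insert_p hx k1 k4
  have i3 := h.rot.insert x hx w k2 k5
  have sC := h.rot.s_mem b k1
  have pC := h.rot.p_mem b k1
  have swC := h.rot.s_mem w k2
  have sw := h.rot.adj_s w k2
  have pw := h.rot.adj_p k2
  have pww : p w = s b := by grind
  have scb : s c = p b := by grind
  have n1 := h.rot.s_ne_p w k2
  have n2 := h.rot.s_ne_p b k1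
  have n3 : s c ≠ s w := fun e => k11.ne' (h.rot.s_inj e)
  have n4 := h.rot.s_ne_p _ swC
  exact h.deg.saturated x b c (s b) (s w) (p b) z (by and_intros <;> grind)
    (by and_intros <;> grind [SimpleGraph.Adj.symm]) hz

theorem not_adj_of_six (h : Good G C s p x) {b w c : V} (k : Six G C s p x b w c)
    (hbc : G.Adj b c) : ¬G.Adj b (s w) := fun hbs => by
  have hw := fun z => h.nbhd_of_six (z := z) k
  obtain ⟨k1, k2, k3, k4, k5, k6, k7, k8, k9, k10, k11, k12⟩ := k
  have hx := h.nmem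
  have ps := h.rot.ps
  have i1 := h.rot.insert x hx b k1 k4
  have i2 := h.rot.insert_p hx k1 k4
  have i3 := h.rot.insert x hx w k2 k5
  have sC := h.rot.s_mem b k1
  have pC := h.rot.p_mem b k1
  have swC := h.rot.s_mem w k2
  have sw := h.rot.adj_s w k2
  have pw := h.rot.adj_p k2
  have sb := h.rot.adj_s b k1
  have pb := h.rot.adj_p k1
  have pww : p w = s b := by grind
  have scb : s c = p b := by grind
  have n1 := h.rot.s_ne_p w k2
  have n2 := h.rot.s_ne_p b k1
  have n3 : s c ≠ s w := fun e => k11.ne' (h.rot.s_inj e)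
  have nb := hbc.ne
  have nw := k11.ne
  have hb := fun z => h.deg.saturated (v := b) x w c (s b) (s w) (p b) z
    (by and_intros <;> grind) (by and_intros <;> grind [SimpleGraph.Adj.symm])
  have tw : TwinAt G w b := ⟨k10.ne, k10, fun z z1 z2 =>
    ⟨fun hz => by have := hw z hz; grind [SimpleGraph.Adj.symm],
      fun hz => by have := hb z hz; grind [SimpleGraph.Adj.symm]⟩⟩
  have := h.twin.saturated tw x b c (s b) (s w) (p b)
    (by and_intros <;> grind) (by and_intros <;> grind [SimpleGraph.Adj.symm]) k12
  grind

theorem chord_of_six (h : Good G C s p x) {b w c : V} (k : Six G C s p x b w c)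
    (hbc : ¬G.Adj b c) : G.Adj b (s w) := by
  have hw := fun z => h.nbhd_of_six (z := z) k
  obtain ⟨k1, k2, k3, k4, k5, k6, k7, k8, k9, k10, k11, k12⟩ := k
  by_contra hcon
  have hx := h.nmem
  have ps := h.rot.ps
  have scb : s c = p b := by grind
  have i3 := h.rot.insert x hx w k2 k5
  have sw := h.rot.adj_s w k2
  have nb : w ≠ b := k10.ne
  have nc : w ≠ c := k11.ne
  have j1 := h.rot.cross_s x hx b k1 w k2 nb.symm k4 k5
  have j2 := h.rot.cross_s x hx c k3 w k2 nc.symm k6 k5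
  obtain ⟨t, t1, t2, t3⟩ := h.loc k10 sw (by grind) hcon
  have := hw t t1
  have := t2.ne
  have := t3.ne
  grind [SimpleGraph.Adj.symm]

theorem nbhd_fst_of_six (h : Good G C s p x) {b w c : V} (k : Six G C s p x b w c)
    (hbc : ¬G.Adj b c) {z : V} (hz : G.Adj b z) :
    z = w ∨ z = x ∨ z = s b ∨ z = s w ∨ z = p b := by
  have hw := fun z => h.nbhd_of_six (z := z) k
  obtain ⟨k1, k2, k3, k4, k5, k6, k7, k8, k9, k10, k11, k12⟩ := k
  have hx := h.nmem
  have ps := h.rot.ps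
  have nbz := hz.ne
  have hsix := fun z => h.rot.six (z := z) k1 (by grind)
  have scb : s c = p b := by grind
  have ppb : p (p b) = c := by grind
  rw [k7, ppb] at hsix
  by_cases hzC : z ∈ C
  · have := hsix z hzC
    grind
  obtain ⟨e, e1, e2, e3, e4, e5⟩ := h.rot.demand h.loc hzC k1 hz.symm
  have l1 := h.rot.insert z hzC b k1 hz.symm
  have l2 := h.rot.insert_p hzC k1 hz.symm
  have j1 := h.rot.cross_s x hx b k1 w k2 k10.ne' k4 k5
  have := hsix e e1
  have hzw : G.Adj w z := by grind [SimpleGraph.Adj.symm]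
  have := hw z hzw
  have sC := h.rot.s_mem b k1
  have pC := h.rot.p_mem b k1
  have swC := h.rot.s_mem w k2
  grind

theorem isTripartite_of_six (h : Good G C s p x) {b w c : V} (k : Six G C s p x b w c) :
    IsTripartite G w b c x (s b) (s w) (p b) := by
  have hw := fun z => h.nbhd_of_six (z := z) k
  have k' := h.six_symm k
  have sp := h.rot.sp
  have ps := h.rot.ps
  have hpw : p w = s b := by rw [← k.2.2.2.2.2.2.1, ps]
  have hpc : p c = s w := by rw [← k.2.2.2.2.2.2.2.1, ps]
  have hsc : s c = p b := by rw [← k.2.2.2.2.2.2.2.2.1, ps]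
  have hbc : ¬G.Adj b c := fun hbc => by
    have n1 := h.not_adj_of_six k hbc
    have n2 := h.symm.not_adj_of_six k' hbc.symm
    obtain ⟨k1, k2, k3, k4, k5, k6, k7, k8, k9, k10, k11, k12⟩ := k
    have hx := h.nmem
    have j0 := h.rot.cross_s x hx b k1 c k3 hbc.ne k4 k6
    have j1 := h.rot.cross_s x hx b k1 w k2 k10.ne' k4 k5
    have j2 := h.rot.cross_s x hx w k2 c k3 k11.ne k5 k6
    have i1 := h.rot.insert x hx b k1 k4
    obtain ⟨t, t1, t2, t3⟩ := h.loc (h.rot.adj_s w k2) (h.rot.adj_p k2) (h.rot.s_ne_p w k2)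
      (by grind [SimpleGraph.Adj.symm])
    have := hw t t1
    have := t2.ne
    have := t3.ne
    grind [SimpleGraph.Adj.symm]
  have c1 := h.chord_of_six k hbc
  have c2 := h.symm.chord_of_six k' (fun e => hbc e.symm)
  have hb := fun z => h.nbhd_fst_of_six (z := z) k hbc
  have hc := fun z => h.symm.nbhd_fst_of_six (z := z) k' (fun e => hbc e.symm)
  obtain ⟨k1, k2, k3, k4, k5, k6, k7, k8, k9, k10, k11, k12⟩ := k
  have hx := h.nmem
  have nbc : b ≠ c := by
    rintro rfl
    have := h.rot.s_ne_p w k2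
    grind
  have j0 := h.rot.cross_s x hx b k1 c k3 nbc k4 k6
  have j1 := h.rot.cross_s x hx b k1 w k2 k10.ne' k4 k5
  have j2 := h.rot.cross_s x hx w k2 c k3 k11.ne k5 k6
  have i1 := h.rot.insert x hx b k1 k4
  have i2 := h.rot.insert x hx w k2 k5
  have i3 := h.rot.insert x hx c k3 k6
  have sC := h.rot.s_mem b k1
  have pC := h.rot.p_mem b k1
  have swC := h.rot.s_mem w k2
  have sb := h.rot.adj_s b k1
  have pb := h.rot.adj_p k1
  have sw := h.rot.adj_s w k2
  have pw := h.rot.adj_p k2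
  have sc := h.rot.adj_s c k3
  have pc := h.rot.adj_p k3
  have m1 : s b ≠ s w := fun e => k10.ne' (h.rot.s_inj e)
  have m2 : s c ≠ s w := fun e => k11.ne' (h.rot.s_inj e)
  have m3 := h.rot.s_ne_p b k1
  rw [hsc] at *
  rw [hpc] at *
  rw [hpw] at *
  have ne : b ≠ c ∧ x ≠ s b ∧ x ≠ s w ∧ x ≠ p b ∧ s b ≠ s w ∧ s b ≠ p b ∧ s w ≠ p b := by
    and_intros <;> grind
  have adj : G.Adj w b ∧ G.Adj w c ∧ G.Adj w x ∧ G.Adj w (s b) ∧ G.Adj w (s w) ∧ G.Adj w (p b) ∧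
      G.Adj b x ∧ G.Adj b (s b) ∧ G.Adj b (s w) ∧ G.Adj b (p b) ∧ G.Adj c x ∧ G.Adj c (s b) ∧
      G.Adj c (s w) ∧ G.Adj c (p b) := by
    and_intros <;> grind [SimpleGraph.Adj.symm]
  refine ⟨ne, adj, fun z hz => ?_, hb, fun z hz => ?_, fun y hy z hz => ?_⟩
  · have := hw z hz
    grind
  · have := hc z hz
    grind
  · have hind : ∀ z, z = x ∨ z = s b ∨ z = s w ∨ z = p b → ¬G.Adj y z := by
      intro z hz hyz
      have := hyz.ne
      grind [SimpleGraph.Adj.symm]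
    have hyw : G.Adj y w := by grind [SimpleGraph.Adj.symm]
    by_contra hcon
    push Not at hcon
    have hwz : ¬G.Adj w z := fun hwz => by
      have := hw z hwz
      grind
    obtain ⟨t, t1, t2, t3⟩ := h.loc hyw hz hcon.1.symm hwz
    have := hw t t2.symm
    have := hind t
    have := hind z
    have : t = b ∨ t = c := by grind
    have := hb z
    have := hc z
    grind

theorem far_inj (h : Good G C s p x) (h6 : ∀ b w c, ¬Six G C s p x b w c) {b c w : V}
    (hb : b ∈ C) (hxb : G.Adj x b) (hc : c ∈ C) (hxc : G.Adj x c)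
    (kb : Far G C s p x b w) (kc : Far G C s p x c w) : b = c := by
  by_contra hne
  have ps := h.rot.ps
  have sp := h.rot.sp
  have aux : ∀ {b c}, b ∈ C → G.Adj x b → c ∈ C → G.Adj x c → b ≠ c →
      Far G C s p x b w → Far G C s p x c w →
      w = s (s b) → Hit G C s p x w (p b) → w = p (p c) → Hit G C s p x w (s c) → False := by
    intro b c hb hxb hc hxc hne kb kc e1 v1 e2 v2
    have := h.hit_unique kb.1 kb.2.1 v1 v2 hb hxb kb.2.2.1.symm hc hxc kc.2.2.1.symm hne
    exact h6 b w c ⟨hb, kb.1, hc, hxb, kb.2.1, hxc, e1.symm, by grind, by grind,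
      kb.2.2.1.symm, kc.2.2.1.symm, kb.2.2.2.2.1⟩
  rcases h.hit_of_far hb hxb kb with ⟨e1, v1⟩ | ⟨e1, v1⟩ <;>
    rcases h.hit_of_far hc hxc kc with ⟨e2, v2⟩ | ⟨e2, v2⟩
  · grind
  · exact aux hb hxb hc hxc hne kb kc e1 v1 e2 v2
  · exact aux hc hxc hb hxb (Ne.symm hne) kc kb e2 v2 e1 v1
  · grind

/-- A choice of a far vertex `f b` for every `b` that has a hit. -/
structure FarMap (G : SimpleGraph V) (C : Set V) (s p : V → V) (x : V) (f : V → V) : Prop where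
  far : ∀ b ∈ C, G.Adj x b → ∀ v, Hit G C s p x b v → Far G C s p x b (f b)
  inj : ∀ b ∈ C, G.Adj x b → ∀ c ∈ C, G.Adj x c → ∀ w,
    Far G C s p x b w → Far G C s p x c w → b = c
  surj : ∀ g ∈ C, G.Adj x g → ∀ v, Hit G C s p x g v →
    ∃ b ∈ C, G.Adj x b ∧ f b = g ∧ Far G C s p x b g

theorem FarMap.symm {f : V → V} (hf : FarMap G C s p x f) : FarMap G C p s x f where
  far := fun b hb hxb v hv => (hf.far b hb hxb v hv.symm).symm
  inj := fun b hb hxb c hc hxc w h1 h2 => hf.inj b hb hxb c hc hxc w h1.symm h2.symm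
  surj := fun g hg hxg v hv => by
    obtain ⟨b, h1, h2, h3, h4⟩ := hf.surj g hg hxg v hv.symm
    exact ⟨b, h1, h2, h3, h4.symm⟩

theorem preimage_of_hit (h : Good G C s p x) {f : V → V} (hf : FarMap G C s p x f)
    {b d e g : V} (he : e = s (s b)) (hd : d ∈ C) (hxd : G.Adj x d)
    (hgd : G.Adj g d) (hg : g ∈ C) (hxg : G.Adj x g) (hv : Hit G C s p x g (s b)) :
    ∃ c ∈ C, G.Adj x c ∧ f c = g ∧ Far G C s p x c g ∧ (c = b ∨ c = e ∨ c = d) := by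
  obtain ⟨c, cC, hxc, hc, kc⟩ := hf.surj g hg hxg _ hv
  refine ⟨c, cC, hxc, hc, kc, ?_⟩
  by_cases hcd : c = d
  · exact .inr (.inr hcd)
  have ps := h.rot.ps
  have sp := h.rot.sp
  rcases h.hit_of_far cC hxc kc with ⟨-, v⟩ | ⟨-, v⟩
  · have := h.hit_unique hg hxg hv v cC hxc kc.2.2.1.symm hd hxd hgd hcd
    grind
  · have := h.hit_unique hg hxg hv v cC hxc kc.2.2.1.symm hd hxd hgd hcd
    have := h.rot.s_inj this
    grind

theorem absurd_of_sole (h : Good G C s p x) {f : V → V} (hf : FarMap G C s p x f) {b e : V}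
    (hb : b ∈ C) (hxb : G.Adj x b) (hfb : f b = e) (k : Far G C s p x b e) (he : e = s (s b))
    (hs : Rot.Sole G C x e b) : False := by
  have hv := h.hit_p_of_far hb hxb k he
  obtain ⟨eC, hxe, hbe, -, hep, -⟩ := k
  have k' := hf.far e eC hxe _ hv
  have hfe : f e = b := hs _ k'.1 k'.2.1 k'.2.2.1.symm
  rw [hfe] at k'
  obtain ⟨-, -, -, hbs, hbp, -⟩ := k'
  have ps := h.rot.ps
  have sp := h.rot.sp
  have hx := h.nmem
  have hpe : p e = s b := by rw [he, ps]
  have : ∃ g ∈ C, G.Adj x g ∧ G.Adj b g ∧ g ≠ e := by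
    by_contra hcon
    refine h.not_sole e eC b hb hxe hxb hs fun a ha hxa hab => ?_
    by_contra hae
    exact hcon ⟨a, ha, hxa, hab.symm, hae⟩
  obtain ⟨g, gC, hxg, hbg, hge⟩ := this
  have i1 := h.rot.insert x hx b hb hxb
  have i3 := h.rot.insert x hx e eC hxe
  have sb := h.rot.adj_s b hb
  have seC := h.rot.s_mem e eC
  have hvb : Hit G C s p x b (s e) :=
    ⟨seC, hbs, fun e' => hbe.ne (h.rot.s_inj e').symm, fun e' => hv.2.2.1 e'.symm, i3,
      .inl (by rwa [ps])⟩
  have hN := fun z => h.nbhd_of_hit (z := z) hb hxb hvb eC hxe hbe gC hxg hbg (Ne.symm hge)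
  have heg : ¬G.Adj e g := fun hh => hbg.ne (hs g gC hxg hh.symm).symm
  have hrg : G.Adj (s b) g := by
    by_contra hcon
    obtain ⟨t, t1, t2, t3⟩ := h.loc sb hbg (by grind) hcon
    have := hN t t1
    have c1 := h.rot.cross_p x hx b hb e eC hbe.ne hxb hxe
    have c2 := h.rot.cross_s x hx b hb e eC hbe.ne hxb hxe
    have := t2.ne
    have := t3.ne
    grind [SimpleGraph.Adj.symm]
  have hvg : Hit G C s p x g (s b) :=
    ⟨h.rot.s_mem b hb, hrg.symm, fun e' => hbg.ne (h.rot.s_inj e'),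
      by intro e'; rw [← hpe] at e'; exact hge (h.rot.symm.s_inj e').symm, i1, .inl (by rwa [ps])⟩
  obtain ⟨c, cC, hxc, hc, kc, hcc⟩ :=
    h.preimage_of_hit hf he hb hxb hbg.symm gC hxg hvg
  have := hbg.ne
  grind

theorem absurd_of_adj (h : Good G C s p x) (h6 : ∀ b w c, ¬Six G C s p x b w c) {f : V → V}
    (hf : FarMap G C s p x f) {b e g : V}
    (hb : b ∈ C) (hxb : G.Adj x b) (k : Far G C s p x b e) (he : e = s (s b))
    (gC : g ∈ C) (hxg : G.Adj x g) (hgb : g ≠ b) (heg : G.Adj e g) (hbg : G.Adj b g) : False := by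
  have hv := h.hit_p_of_far hb hxb k he
  have kb := k
  obtain ⟨eC, hxe, hbe, hes, hep, -⟩ := k
  have k' := hf.far e eC hxe _ hv
  have ps := h.rot.ps
  have sp := h.rot.sp
  have hx := h.nmem
  have hpe : p e = s b := by rw [he, ps]
  have i1 := h.rot.insert x hx b hb hxb
  have i2 := h.rot.insert_p hx hb hxb
  have i3 := h.rot.insert x hx e eC hxe
  have sb := h.rot.adj_s b hb
  have pb := h.rot.adj_p hb
  have se := h.rot.adj_s e eC
  have pC := h.rot.p_mem b hb
  have sC := h.rot.s_mem b hb
  have seC := h.rot.s_mem e eC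
  have hN := fun z => h.nbhd_of_hit (z := z) eC hxe hv hb hxb hbe.symm gC hxg heg hgb.symm
  have n1 := h.rot.s_ne_p b hb
  have n2 := h.rot.s_ne_p e eC
  have hfe : f e = b ∨ f e = g := by
    have := hN _ k'.2.2.1
    have := k'.2.1
    have := k'.1
    grind
  have hne := heg.ne
  rcases hfe with hfe | hfe <;> rw [hfe] at k'
  · obtain ⟨-, -, -, hbs, hbp, -⟩ := k'
    have hvb : Hit G C s p x b (s e) :=
      ⟨seC, hbs, fun e' => hbe.ne (h.rot.s_inj e').symm, fun e' => hv.2.2.1 e'.symm, i3,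
        .inl (by rwa [ps])⟩
    have hM := fun z => h.nbhd_of_hit (z := z) hb hxb hvb eC hxe hbe gC hxg hbg hne
    have tw : TwinAt G e b := ⟨hbe.ne', hbe.symm, fun z z1 z2 =>
      ⟨fun hz => by have := hN z hz; grind [SimpleGraph.Adj.symm],
        fun hz => by have := hM z hz; grind [SimpleGraph.Adj.symm]⟩⟩
    have n3 := hv.2.2.1
    have n4 := hvb.2.2.1
    have := h.twin.saturated tw x b g (s b) (s e) (p b)
      (by and_intros <;> grind) (by and_intros <;> grind [SimpleGraph.Adj.symm]) hep
    grind
  · have hge : g = s (s e) := by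
      rcases k'.2.2.2.2.2 with ⟨e', -⟩ | ⟨e', -⟩
      · exact e'
      · rw [hpe, ps] at e'
        exact absurd e' hgb
    have hvg := h.hit_p_of_far eC hxe k' hge
    have kg := hf.far g gC hxg _ hvg
    have hM := fun z => h.nbhd_of_hit (z := z) gC hxg hvg hb hxb hbg.symm eC hxe heg.symm hbe.ne
    have j1 := h.rot.insert x hx g gC hxg
    have j2 := h.rot.insert_p hx gC hxg
    have j3 := h.rot.insert_p hx eC hxe
    have hfg : f g = b ∨ f g = e := by
      have := hM _ kg.2.2.1
      have := kg.2.1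
      have := kg.1
      grind
    rcases hfg with hfg | hfg <;> rw [hfg] at kg
    · refine h6 b e g ⟨hb, eC, gC, hxb, hxe, hxg, he.symm, hge.symm, ?_, hbe.symm, heg, hep⟩
      rcases kg.2.2.2.2.2 with ⟨e', -⟩ | ⟨e', -⟩
      · exact e'.symm
      · rw [hge, ps, ps] at e'
        exact absurd e' hbe.ne
    · exact hgb (hf.inj g gC hxg b hb hxb e kg kb)

theorem absurd_of_not_adj (h : Good G C s p x) (h6 : ∀ b w c, ¬Six G C s p x b w c) {f : V → V}
    (hf : FarMap G C s p x f) {b e g : V}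
    (hb : b ∈ C) (hxb : G.Adj x b) (hfb : f b = e) (k : Far G C s p x b e) (he : e = s (s b))
    (gC : g ∈ C) (hxg : G.Adj x g) (hgb : g ≠ b) (heg : G.Adj e g) (hbg : ¬G.Adj b g) :
    False := by
  have hv := h.hit_p_of_far hb hxb k he
  have kb := k
  obtain ⟨eC, hxe, hbe, hes, hep, -⟩ := k
  have ps := h.rot.ps
  have sp := h.rot.sp
  have hx := h.nmem
  have hpe : p e = s b := by rw [he, ps]
  have i1 := h.rot.insert x hx b hb hxb
  have i2 := h.rot.insert_p hx hb hxb
  have i3 := h.rot.insert x hx e eC hxe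
  have sC := h.rot.s_mem b hb
  have hN := fun z => h.nbhd_of_hit (z := z) eC hxe hv hb hxb hbe.symm gC hxg heg hgb.symm
  have c1 := h.rot.cross_p x hx b hb e eC hbe.ne hxb hxe
  have c2 := h.rot.cross_s x hx b hb e eC hbe.ne hxb hxe
  have hrg : G.Adj (s b) g := by
    by_contra hcon
    obtain ⟨t, t1, t2, t3⟩ := h.loc hes heg (by grind) hcon
    have := hN t t1
    have := t2.ne
    have := t3.ne
    grind [SimpleGraph.Adj.symm]
  have hvg : Hit G C s p x g (s b) :=
    ⟨sC, hrg.symm, fun e' => hgb (h.rot.s_inj e').symm,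
      by intro e'; rw [← hpe] at e'; exact heg.ne (h.rot.symm.s_inj e'), i1, .inl (by rwa [ps])⟩
  obtain ⟨c, cC, hxc, hc, kc, hcc⟩ :=
    h.preimage_of_hit hf he eC hxe heg.symm gC hxg hvg
  have hne := heg.ne
  have hce : c = e := by grind
  subst hce
  have hge : g = s (s c) := by
    rcases kc.2.2.2.2.2 with ⟨e', -⟩ | ⟨e', -⟩
    · exact e'
    · rw [hpe, ps] at e'
      exact absurd e' hgb
  have kg := hf.far g gC hxg _ hvg
  have hgc : f g ≠ c := fun e' => hgb (hf.inj g gC hxg b hb hxb c (e' ▸ kg) kb)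
  have hM := fun z => h.nbhd_of_hit (z := z) gC hxg hvg cC hxe heg.symm kg.1 kg.2.1 kg.2.2.1
    hgc.symm
  have hsix : p b ≠ s g := fun e' => by
    refine h6 b c g ⟨hb, cC, gC, hxb, hxe, hxg, he.symm, hge.symm, ?_, hbe.symm, heg, hep⟩
    rw [← e', sp]
  have c3 := h.rot.cross_p x hx b hb g gC hgb.symm hxb hxg
  have hfx := kg.2.1
  have n1 := h.rot.s_ne_p b hb
  have n2 : p b ≠ p g := fun e' => hgb (h.rot.symm.s_inj e').symm
  by_cases hpg : G.Adj g (p b)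
  · have := hM _ hpg
    have pC := h.rot.p_mem b hb
    grind
  · obtain ⟨t, t1, t2, t3⟩ := h.loc hep heg (by grind) (fun e' => hpg e'.symm)
    have := hN t t1
    have := t2.ne
    have := t3.ne
    have hse : s c = p g := by rw [hge, ps]
    grind [SimpleGraph.Adj.symm]

theorem absurd_of_far (h : Good G C s p x) (h6 : ∀ b w c, ¬Six G C s p x b w c) {f : V → V}
    (hf : FarMap G C s p x f) {b e : V} (hb : b ∈ C) (hxb : G.Adj x b) (hfb : f b = e)
    (k : Far G C s p x b e) (he : e = s (s b)) : False := by
  by_cases hs : Rot.Sole G C x e b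
  · exact h.absurd_of_sole hf hb hxb hfb k he hs
  simp only [Rot.Sole, not_forall] at hs
  obtain ⟨g, gC, hxg, hge, hgb⟩ := hs
  by_cases hbg : G.Adj b g
  · exact h.absurd_of_adj h6 hf hb hxb k he gC hxg hgb hge.symm hbg
  · exact h.absurd_of_not_adj h6 hf hb hxb hfb k he gC hxg hgb hge.symm hbg

theorem exists_farMap [Finite V] (h : Good G C s p x) (h6 : ∀ b w c, ¬Six G C s p x b w c) :
    ∃ f, FarMap G C s p x f := by
  let A := {b // b ∈ C ∧ G.Adj x b ∧ ∃ v, Hit G C s p x b v}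
  have hA : ∀ b : A, ∃ c : A, Far G C s p x b c := by
    rintro ⟨b, hb, hxb, v, hv⟩
    obtain ⟨w, hw⟩ := h.exists_far hb hxb hv
    refine ⟨⟨w, hw.1, hw.2.1, ?_⟩, hw⟩
    rcases h.hit_of_far hb hxb hw with ⟨-, k⟩ | ⟨-, k⟩ <;> exact ⟨_, k⟩
  choose F hF using hA
  have hinj := fun b c w (hb : b ∈ C) (hxb : G.Adj x b) (hc : c ∈ C) (hxc : G.Adj x c) =>
    h.far_inj (w := w) h6 hb hxb hc hxc
  have hFi : F.Injective := fun b c hbc => Subtype.ext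
    (hinj b c (F b) b.2.1 b.2.2.1 c.2.1 c.2.2.1 (hF b) (hbc ▸ hF c))
  have hFs := Finite.surjective_of_injective hFi
  classical
  refine ⟨fun b => if hb : b ∈ C ∧ G.Adj x b ∧ ∃ v, Hit G C s p x b v then F ⟨b, hb⟩ else b,
    fun b hb hxb v hv => ?_, fun b hb hxb c hc hxc w => hinj b c w hb hxb hc hxc,
    fun g hg hxg v hv => ?_⟩
  · rw [dif_pos ⟨hb, hxb, v, hv⟩]
    exact hF _
  · obtain ⟨b, hb⟩ := hFs ⟨g, hg, hxg, v, hv⟩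
    refine ⟨b, b.2.1, b.2.2.1, ?_, ?_⟩
    · rw [dif_pos b.2, hb]
    · have := hF b
      rwa [hb] at this

theorem exists_isTripartite [Finite V] (h : Good G C s p x) {b : V} (hb : b ∈ C)
    (hxb : G.Adj x b) : ∃ w b c x q r t, IsTripartite G w b c x q r t := by
  by_contra hcon
  have h6 : ∀ b w c, ¬Six G C s p x b w c := fun b w c k =>
    hcon ⟨_, _, _, _, _, _, _, h.isTripartite_of_six k⟩
  have h6' : ∀ b w c, ¬Six G C p s x b w c := fun b w c k => h6 _ _ _ (h.symm.six_symm k)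
  obtain ⟨f, hf⟩ := h.exists_farMap h6
  obtain ⟨b, hb, hxb, v, hv⟩ := h.exists_hit hb hxb
  have k := hf.far b hb hxb v hv
  rcases k.2.2.2.2.2 with ⟨e, -⟩ | ⟨e, -⟩
  · exact h.absurd_of_far h6 hf hb hxb rfl k e
  · exact h.symm.absurd_of_far h6' hf.symm hb hxb rfl k.symm e
end Good

theorem TwinAt.symm {u v : V} (h : TwinAt G u v) : TwinAt G v u :=
  ⟨h.1.symm, h.2.1.symm, fun z h1 h2 => (h.2.2 z h2 h1).symm⟩

theorem LinkPair.symm {u v : V} (h : LinkPair G u v) : LinkPair G v u := by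
  obtain ⟨tw, a, b, c, d, h1, h2, h3, h4, h5⟩ := h
  obtain ⟨t1, t2, t3⟩ := tw
  have hv : ∀ z, z ≠ u → G.Adj v z → G.Adj u z := fun z hz hvz => (t3 z hz hvz.ne').2 hvz
  classical
  have key : ∀ y w, (G.Adj u y → G.Adj u w → ¬G.Adj y w) →
      G.Adj v (if y = u then v else y) → G.Adj v (if w = u then v else w) →
      ¬G.Adj (if y = u then v else y) (if w = u then v else w) := by
    intro y w hyw h1 h2
    split_ifs at h1 h2 ⊢ with k1 k2
    · exact absurd h1 G.irrefl
    · exact absurd h1 G.irrefl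
    · exact absurd h2 G.irrefl
    · exact hyw (hv y k1 h1) (hv w ‹_› h2)
  refine ⟨TwinAt.symm ⟨t1, t2, t3⟩, if a = u then v else a, if b = u then v else b,
    if c = u then v else c, if d = u then v else d, fun z hz => ?_, key a c h2, key a d h3,
    key b c h4, key b d h5⟩
  by_cases hzu : z = u
  · exact .inl hzu
  · have := h1 z (hv z hzu hz)
    have := hz.ne
    grind

theorem adj_of_linked (hl : LocDiamTwo G) {u v p q c d z : V} (tw : TwinAt G u v)
    (hN : ∀ z, G.Adj u z → z = v ∨ z = p ∨ z = q ∨ z = c ∨ z = d) (hup : G.Adj u p)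
    (hc : G.Adj u c → ¬G.Adj p c) (hd : G.Adj u d → ¬G.Adj p d)
    (hpz : G.Adj p z) (hzu : z ≠ u) (hzv : z ≠ v) :
    z = q ∨ (¬G.Adj u z ∧ G.Adj p q ∧ G.Adj u q ∧ q ≠ v ∧ G.Adj q z) := by
  by_contra hcon
  have hz : ¬G.Adj u z := by
    intro hz
    have := hN z hz
    have := hpz.ne
    grind
  obtain ⟨t, t1, t2, t3⟩ := hl hup.symm hpz hzu.symm hz
  have hvz : ¬G.Adj v z := fun e => hz ((tw.2.2 z hzu hzv).2 e)
  have := hN t t2.symm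
  have := t1.ne
  grind [SimpleGraph.Adj.symm]

theorem linked_aux (hl : LocDiamTwo G) (ht : TwinsDegLeFive G) {u v p q c d : V}
    (tw : TwinAt G u v)
    (hN : ∀ z, G.Adj u z → z = v ∨ z = p ∨ z = q ∨ z = c ∨ z = d) (hup : G.Adj u p) (hpv : p ≠ v)
    (hpc : G.Adj u p → G.Adj u c → ¬G.Adj p c) (hpd : G.Adj u p → G.Adj u d → ¬G.Adj p d)
    (hqc : G.Adj u q → G.Adj u c → ¬G.Adj q c) (hqd : G.Adj u q → G.Adj u d → ¬G.Adj q d) :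
    (∃ q, LinkPair G p q) ∨ ∀ z, G.Adj p z → z = u ∨ z = v := by
  have hp := fun z => adj_of_linked (z := z) hl tw hN hup (hpc hup) (hpd hup)
  by_cases hq : G.Adj p q ∧ G.Adj u q ∧ q ≠ v
  swap
  · refine .inr fun z hpz => ?_
    by_contra hcon
    have h1 := hp z hpz (by grind) (by grind)
    have : z = q := by grind
    subst this
    have : ¬G.Adj u z := by grind
    obtain ⟨t, t1, t2, t3⟩ := hl hup.symm hpz (by grind) this
    have hvz : ¬G.Adj v z := fun e => this ((tw.2.2 z (by grind) (by grind)).2 e)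
    have := hN t t2.symm
    have := t1.ne
    have := t3.ne
    grind [SimpleGraph.Adj.symm]
  obtain ⟨hpq, huq, hqv⟩ := hq
  have hq := fun z => adj_of_linked (p := q) (q := p) (z := z) hl tw (fun z hz => by grind) huq
    (hqc huq) (hqd huq)
  have hvp : G.Adj v p := (tw.2.2 p hup.ne' hpv).1 hup
  have hvq : G.Adj v q := (tw.2.2 q huq.ne' hqv).1 huq
  have nqu := huq.ne
  have nup := hup.ne
  have spu := hup.symm
  have squ := huq.symm
  have spv := hvp.symm
  have sqv := hvq.symm
  have tw' : TwinAt G p q := ⟨hpq.ne, hpq, fun z z1 z2 =>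
    ⟨fun hz => by
      by_cases hzu : z = u
      · exact hzu ▸ squ
      by_cases hzv : z = v
      · exact hzv ▸ sqv
      grind,
    fun hz => by
      by_cases hzu : z = u
      · exact hzu ▸ spu
      by_cases hzv : z = v
      · exact hzv ▸ spv
      grind⟩⟩
  have huv := tw.1
  have hnu : ∀ z, G.Adj p z → z ≠ q → z ≠ u → z ≠ v → ¬G.Adj u z ∧ ¬G.Adj v z := by
    intro z hz hzq hzu hzv
    have := hp z hz hzu hzv
    have := tw.2.2 z hzu hzv
    grind
  refine .inl ⟨q, tw', ?_⟩
  by_cases h1 : ∃ z, G.Adj p z ∧ z ≠ q ∧ z ≠ u ∧ z ≠ v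
  · obtain ⟨z, hz, hzq, hzu, hzv⟩ := h1
    have nz := hnu z hz hzq hzu hzv
    by_cases h2 : ∃ y, G.Adj p y ∧ y ≠ q ∧ y ≠ u ∧ y ≠ v ∧ y ≠ z
    · obtain ⟨y, hy, hyq, hyu, hyv, hyz⟩ := h2
      have ny := hnu y hy hyq hyu hyv
      have hvq' := hqv.symm
      have := fun x => ht.saturated tw' q u v z y x (by and_intros <;> grind)
        (by and_intros <;> grind [SimpleGraph.Adj.symm])
      exact ⟨u, v, z, y, this, by grind⟩
    · exact ⟨u, v, z, z, by grind, by grind⟩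
  · exact ⟨u, v, p, p, by grind, by simp⟩

theorem LinkPair.linked (hl : LocDiamTwo G) (ht : TwinsDegLeFive G) {u v z : V}
    (h : LinkPair G u v) (hz : G.Adj u z) (hzv : z ≠ v) :
    (∃ q, LinkPair G z q) ∨ ∀ y, G.Adj z y → y = u ∨ y = v := by
  obtain ⟨tw, a, b, c, d, h1, h2, h3, h4, h5⟩ := h
  have h2' : G.Adj u c → G.Adj u a → ¬G.Adj c a := fun h h' h'' => h2 h' h h''.symm
  have h3' : G.Adj u d → G.Adj u a → ¬G.Adj d a := fun h h' h'' => h3 h' h h''.symm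
  have h4' : G.Adj u c → G.Adj u b → ¬G.Adj c b := fun h h' h'' => h4 h' h h''.symm
  have h5' : G.Adj u d → G.Adj u b → ¬G.Adj d b := fun h h' h'' => h5 h' h h''.symm
  rcases h1 z hz with rfl | rfl | rfl | rfl | rfl
  · contradiction
  · exact linked_aux (q := b) (c := c) (d := d) hl ht tw (by grind) hz hzv h2 h3 h4 h5
  · exact linked_aux (q := a) (c := c) (d := d) hl ht tw (by grind) hz hzv h4 h5 h2 h3
  · exact linked_aux (q := d) (c := a) (d := b) hl ht tw (by grind) hz hzv h2' h4' h3' h5'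
  · exact linked_aux (q := c) (c := a) (d := b) hl ht tw (by grind) hz hzv h3' h5' h2' h4'

theorem LinkPair.exists_cover (hl : LocDiamTwo G) (ht : TwinsDegLeFive G) (hc : G.Connected)
    {u v : V} (h : LinkPair G u v) (w : V) :
    ∃ a b c d e, ∀ z, G.Adj w z → z = a ∨ z = b ∨ z = c ∨ z = d ∨ z = e := by
  have key : ∀ w, (∃ q, LinkPair G w q) ∨
      ∃ u v, LinkPair G u v ∧ ∀ y, G.Adj w y → y = u ∨ y = v := by
    intro w
    obtain ⟨r⟩ := hc.preconnected w u
    induction r with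
    | nil => exact .inl ⟨v, h⟩
    | cons hadj r ih =>
      rcases ih h with ⟨q, hq⟩ | ⟨a, b, hab, hy⟩
      · rename_i x y _
        by_cases hxq : x = q
        · exact .inl ⟨y, hxq ▸ hq.symm⟩
        · exact (hq.linked hl ht hadj.symm hxq).imp_right fun k => ⟨_, q, hq, k⟩
      · rcases hy _ hadj.symm with e | e
        · exact .inl ⟨b, e ▸ hab⟩
        · exact .inl ⟨a, e ▸ hab.symm⟩
  rcases key w with ⟨q, -, a, b, c, d, hN, -⟩ | ⟨a, b, -, hN⟩
  · exact ⟨q, a, b, c, d, hN⟩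
  · exact ⟨a, b, a, b, a, fun z hz => by have := hN z hz; tauto⟩

theorem exists_triangle (hl : LocDiamTwo G) (hc : G.Connected) {a b c : V} (hab : a ≠ b)
    (hac : a ≠ c) (hbc : b ≠ c) (v : V) : ∃ u w, G.Adj v u ∧ G.Adj u w ∧ G.Adj w v := by
  have hnb : ∃ u, G.Adj v u := by
    obtain ⟨z, hz⟩ : ∃ z, z ≠ v := by
      by_cases h : a = v
      · exact ⟨b, h ▸ hab.symm⟩
      · exact ⟨a, h⟩
    obtain ⟨r⟩ := hc.preconnected v z
    cases r with
    | nil => contradiction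
    | cons h r => exact ⟨_, h⟩
  obtain ⟨u, hvu⟩ := hnb
  by_contra hcon
  have aux : ∀ {v u}, G.Adj v u → (¬∃ w, G.Adj u w ∧ G.Adj w v) → ∀ w, G.Adj u w → w = v := by
    intro v u hvu hn w huw
    by_contra hwv
    by_cases h : G.Adj w v
    · exact hn ⟨w, huw, h⟩
    · obtain ⟨t, t1, t2, t3⟩ := hl huw hvu.symm hwv h
      exact hn ⟨t, t1, t3⟩
  have h1 := aux hvu fun ⟨w, h1, h2⟩ => hcon ⟨u, w, hvu, h1, h2⟩
  have h2 := aux hvu.symm fun ⟨w, h1, h2⟩ => hcon ⟨u, w, hvu, h2.symm, h1.symm⟩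
  have key : ∀ z, z = v ∨ z = u := by
    intro z
    obtain ⟨r⟩ := hc.preconnected z v
    induction r with
    | nil => exact .inl rfl
    | cons hadj r ih => grind [SimpleGraph.Adj.symm]
  have := key a
  have := key b
  have := key c
  grind

theorem IsTripartite.mem (hc : G.Connected) {w b c x q r t : V}
    (h : IsTripartite G w b c x q r t) (z : V) :
    z = w ∨ z = b ∨ z = c ∨ z = x ∨ z = q ∨ z = r ∨ z = t := by
  obtain ⟨ne, adj, h1, h2, h3, h4⟩ := h
  obtain ⟨k⟩ := hc.preconnected z w
  induction k with
  | nil => exact .inl rfl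
  | @cons y z _ hadj k ih =>
    rcases ih adj h1 h2 h3 h4 with rfl | rfl | rfl | e
    · grind [h1 y hadj.symm]
    · grind [h2 y hadj.symm]
    · grind [h3 y hadj.symm]
    · grind [h4 _ e y hadj.symm]

theorem forall_sigma_one_two_four {P : (Σ i, (![Fin 1, Fin 2, Fin 4] : Fin 3 → Type) i) → Prop}
    (h₀ : ∀ j : Fin 1, P ⟨0, j⟩) (h₁ : ∀ j : Fin 2, P ⟨1, j⟩) (h₂ : ∀ j : Fin 4, P ⟨2, j⟩) :
    ∀ y, P y
  | ⟨0, j⟩ => h₀ j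
  | ⟨1, j⟩ => h₁ j
  | ⟨2, j⟩ => h₂ j

theorem IsTripartite.nonempty_iso (hc : G.Connected) {w b c x q r t : V}
    (h : IsTripartite G w b c x q r t) :
    Nonempty (G ≃g completeMultipartiteGraph ![Fin 1, Fin 2, Fin 4]) := by
  have hm := h.mem hc
  obtain ⟨ne, adj, h1, h2, h3, h4⟩ := h
  let φ : (Σ i, (![Fin 1, Fin 2, Fin 4] : Fin 3 → Type) i) → V := fun y => match y with
    | ⟨0, _⟩ => w
    | ⟨1, j⟩ => (![b, c] : Fin 2 → V) j
    | ⟨2, j⟩ => (![x, q, r, t] : Fin 4 → V) j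
  have i1 := h4 x (by simp)
  have i2 := h4 q (by simp)
  have i3 := h4 r (by simp)
  have i4 := h4 t (by simp)
  have hadj : ∀ y z, G.Adj (φ y) (φ z) ↔ y.1 ≠ z.1 := by
    refine forall_sigma_one_two_four (fun i => ?_) (fun i => ?_) (fun i => ?_) <;>
      refine forall_sigma_one_two_four (fun j => ?_) (fun j => ?_) (fun j => ?_) <;>
      simp only [φ] <;> fin_cases i <;> fin_cases j <;> simp <;> grind [SimpleGraph.Adj.symm]
  have hinj : φ.Injective := by
    intro y z
    revert y z
    refine forall_sigma_one_two_four (fun i => ?_) (fun i => ?_) (fun i => ?_) <;>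
      refine forall_sigma_one_two_four (fun j => ?_) (fun j => ?_) (fun j => ?_) <;>
      simp only [φ] <;> fin_cases i <;> fin_cases j <;> simp <;> grind [SimpleGraph.Adj.ne]
  have hsurj : φ.Surjective := by
    intro z
    rcases hm z with rfl | rfl | rfl | rfl | rfl | rfl | rfl
    · exact ⟨⟨0, (0 : Fin 1)⟩, rfl⟩
    · exact ⟨⟨1, (0 : Fin 2)⟩, rfl⟩
    · exact ⟨⟨1, (1 : Fin 2)⟩, rfl⟩
    · exact ⟨⟨2, (0 : Fin 4)⟩, rfl⟩
    · exact ⟨⟨2, (1 : Fin 4)⟩, rfl⟩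
    · exact ⟨⟨2, (2 : Fin 4)⟩, rfl⟩
    · exact ⟨⟨2, (3 : Fin 4)⟩, rfl⟩
  exact ⟨RelIso.symm ⟨Equiv.ofBijective φ ⟨hinj, hsurj⟩, fun {y z} => hadj y z⟩⟩

/-- The entries of `l` form, in cyclic order, a cycle of `G`. -/
structure IsRing (G : SimpleGraph V) (l : List V) : Prop where
  nodup : l.Nodup
  length : 3 ≤ l.length
  chain : Cycle.Chain G.Adj (l : Cycle V)

namespace IsRing
variable {l : List V}

theorem of_isRotated (h : IsRing G l) {k : List V} (hk : l ~r k) : IsRing G k where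
  nodup := hk.nodup_iff.1 h.nodup
  length := hk.perm.length_eq ▸ h.length
  chain := (Cycle.coe_eq_coe.2 hk) ▸ h.chain

theorem reverse (h : IsRing G l) : IsRing G l.reverse where
  nodup := List.nodup_reverse.2 h.nodup
  length := by simpa using h.length
  chain := by
    have hc := h.chain
    cases l with
    | nil => simp
    | cons b m =>
      have hr : (b :: m).reverse ~r (b :: m.reverse) := by
        rw [List.reverse_cons]
        exact ⟨m.reverse.length, by rw [List.rotate_append_length_eq]; rfl⟩
      rw [Cycle.coe_eq_coe.2 hr, Cycle.chain_coe_cons]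
      rw [Cycle.chain_coe_cons, ← List.reverse_reverse (b :: (m ++ [b])), List.isChain_reverse] at hc
      simpa [SimpleGraph.adj_comm] using hc

theorem exists_isRotated_cons {b : V} (hb : b ∈ l) : ∃ m, l ~r (b :: m) := by
  obtain ⟨m₁, m₂, rfl⟩ := List.append_of_mem hb
  exact ⟨m₂ ++ m₁, m₁.length, by simp⟩

theorem hasCycleOn (h : IsRing G l) : HasCycleOn G {z | z ∈ l} := by
  obtain ⟨hn, hl, hc⟩ := h
  cases l with
  | nil => simp at hl
  | cons b m =>
    rw [Cycle.chain_coe_cons] at hc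
    obtain ⟨k, hk⟩ : ∃ k : G.Walk b b, k.support = b :: (m ++ [b]) := by
      have hne : b :: (m ++ [b]) ≠ [] := List.cons_ne_nil _ _
      have hlast : (b :: (m ++ [b])).getLast hne = b := by
        rw [List.getLast_cons (by simp), List.getLast_append_singleton]
      exact ⟨(Walk.ofSupport _ hne hc).copy rfl hlast,
        (Walk.support_copy _ _ _).trans (Walk.support_ofSupport hne hc)⟩
    refine ⟨b, k, ?_, ?_⟩
    · rw [Walk.isCycle_iff_isPath_tail_and_le_length]
      have hlen := congrArg List.length hk
      simp only [Walk.length_support, List.length_cons, List.length_append, List.length_nil] at hlen hl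
      refine ⟨?_, by omega⟩
      rw [Walk.isPath_def, Walk.support_tail_of_not_nil]
      · simp only [hk, List.tail_cons]
        exact (List.perm_append_singleton b m).nodup_iff.2 hn
      · rw [Walk.not_nil_iff_lt_length]
        omega
    · ext z
      simp [hk]
      tauto

theorem exists_of_isCycle {a : V} {k : G.Walk a a} (hk : k.IsCycle) :
    ∃ l, IsRing G l ∧ ∀ z, z ∈ l ↔ z ∈ k.support := by
  obtain ⟨m, hm⟩ : ∃ m, k.support = a :: (m ++ [a]) := by
    cases k with
    | nil => simp at hk
    | cons hadj k =>
      refine ⟨k.support.dropLast, ?_⟩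
      rw [Walk.support_cons]
      congr 1
      conv_lhs => rw [← List.dropLast_append_getLast k.support_ne_nil]
      simp
  refine ⟨a :: m, ⟨?_, ?_, ?_⟩, fun z => by simp [hm]; tauto⟩
  · have := hk.support_nodup
    rw [hm, List.tail_cons] at this
    exact (List.perm_append_singleton a m).nodup_iff.1 this
  · have h3 := hk.three_le_length
    have := congrArg List.length hm
    simp only [Walk.length_support, List.length_cons, List.length_append, List.length_nil] at this ⊢
    omega
  · rw [Cycle.chain_coe_cons, ← hm]
    exact k.isChain_adj_support

/-- No cycle has the vertices of `l` and one further vertex. -/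
def Maximal (G : SimpleGraph V) (l : List V) : Prop :=
  ∀ y ∉ l, ∀ k, IsRing G k → ¬∀ z, z ∈ k ↔ z = y ∨ z ∈ l

theorem Maximal.of_mem_iff {k : List V} (h : Maximal G l) (hk : ∀ z, z ∈ k ↔ z ∈ l) :
    Maximal G k := fun y hy j hj hz =>
  h y (by rwa [← hk]) j hj fun z => by rw [hz, hk]

/-- A spanning path of the cycle `l` whose ends are adjacent to an outside vertex `y` closes up
to a cycle through `y`. -/
theorem Maximal.not_isChain (hm : Maximal G l) (hr : IsRing G l) {y : V} (hy : y ∉ l) {k : List V}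
    (hk : k.Perm l) : ¬(y :: (k ++ [y])).IsChain G.Adj := fun hc =>
  hm y hy (y :: k)
    ⟨List.nodup_cons.2 ⟨by rwa [hk.mem_iff], hk.nodup_iff.2 hr.nodup⟩,
      by have := hr.length; have := hk.length_eq; simp only [List.length_cons]; omega,
      by rwa [Cycle.chain_coe_cons]⟩
    fun z => by simp [hk.mem_iff]

variable [DecidableEq V]

theorem formPerm_eq (h : IsRing G l) {b e : V} {t : List V} (hl : l ~r (b :: e :: t)) :
    l.formPerm b = e := by
  rw [List.formPerm_eq_of_isRotated h.nodup hl, List.formPerm_apply_head]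
  exact (h.of_isRotated hl).nodup

theorem adj_formPerm (h : IsRing G l) {b : V} (hb : b ∈ l) : G.Adj b (l.formPerm b) := by
  obtain ⟨m, hm⟩ := exists_isRotated_cons hb
  have hr := h.of_isRotated hm
  have hc := hr.chain
  have h3 := hr.length
  rcases m with _ | ⟨e, m⟩
  · simp at h3
  · rw [h.formPerm_eq hm]
    rw [Cycle.chain_coe_cons, List.cons_append, List.isChain_cons_cons] at hc
    exact hc.1

theorem formPerm_formPerm_ne (h : IsRing G l) {b : V} (hb : b ∈ l) :
    l.formPerm (l.formPerm b) ≠ b := by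
  obtain ⟨m, hm⟩ := exists_isRotated_cons hb
  have hr := h.of_isRotated hm
  have h3 := hr.length
  rcases m with _ | ⟨e, _ | ⟨f, m⟩⟩
  · simp at h3
  · simp at h3
  · rw [h.formPerm_eq hm, h.formPerm_eq (b := e) (e := f) (t := m ++ [b]) (hm.trans ⟨1, by simp⟩)]
    have := hr.nodup
    grind

theorem mem_of_closed (h : IsRing G l) {T : Set V} {b : V} (hb : b ∈ l) (hbT : b ∈ T)
    (hT : ∀ z ∈ T, l.formPerm z ∈ T) {z : V} (hz : z ∈ l) : z ∈ T := by
  obtain ⟨m, hm⟩ := exists_isRotated_cons hb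
  have hpow : ∀ n : ℕ, (l.formPerm ^ n) b ∈ T := by
    intro n
    induction n with
    | zero => exact hbT
    | succ n ih => rw [pow_succ']; exact hT _ ih
  obtain ⟨n, hn, rfl⟩ := List.mem_iff_getElem.1 (hm.mem_iff.1 hz)
  have := hpow n
  rw [List.formPerm_eq_of_isRotated h.nodup hm,
    List.formPerm_pow_apply_head _ _ (h.of_isRotated hm).nodup] at this
  simpa only [Nat.mod_eq_of_lt hn] using this

theorem not_adj_formPerm (h : IsRing G l) (hm : Maximal G l) {y b : V} (hy : y ∉ l) (hb : b ∈ l)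
    (hyb : G.Adj y b) : ¬G.Adj y (l.formPerm b) := fun hs => by
  obtain ⟨m, hl⟩ := exists_isRotated_cons hb
  have hr := h.of_isRotated hl
  have hc := hr.chain
  have h3 := hr.length
  rcases m with _ | ⟨e, m⟩
  · simp at h3
  rw [h.formPerm_eq hl] at hs
  rw [Cycle.chain_coe_cons, List.cons_append, List.isChain_cons_cons] at hc
  refine hm.not_isChain h hy (k := e :: (m ++ [b])) ?_ ?_
  · exact (List.perm_append_singleton b (e :: m)).trans hl.perm.symm
  · have h2 : ((e :: m) ++ [b, y]).IsChain G.Adj := by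
      rw [List.isChain_append_cons_cons]
      exact ⟨hc.2, hyb.symm, by simp⟩
    simpa [hs] using h2

/-- Two vertices split the cycle into two arcs. -/
theorem exists_arcs (h : IsRing G l) {b c : V} (hb : b ∈ l) (hc : c ∈ l) (hbc : b ≠ c) :
    ∃ m n, l ~r (b :: (m ++ c :: n)) ∧ (b :: (m ++ [c])).IsChain G.Adj ∧
      (c :: (n ++ [b])).IsChain G.Adj ∧
      (∀ e, l.formPerm b = e ↔ (m ++ [c]).head? = some e) ∧
      ∀ e, l.formPerm c = e ↔ (n ++ [b]).head? = some e := by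
  obtain ⟨k, hk⟩ := exists_isRotated_cons hb
  have hck : c ∈ k := by
    rcases List.mem_cons.1 (hk.mem_iff.1 hc) with e | e
    · exact absurd e.symm hbc
    · exact e
  obtain ⟨m, n, rfl⟩ := List.append_of_mem hck
  have hch := (h.of_isRotated hk).chain
  rw [Cycle.chain_coe_cons, List.append_assoc, List.cons_append,
    List.isChain_cons_split] at hch
  refine ⟨m, n, hk, hch.1, hch.2, fun e => ?_, fun e => ?_⟩
  · rcases m with _ | ⟨f, m⟩
    · rw [h.formPerm_eq hk]; simp
    · rw [h.formPerm_eq hk]; simp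
  · have hk' : l ~r (c :: (n ++ b :: m)) := hk.trans ⟨(b :: m).length, by
      rw [← List.cons_append, List.rotate_append_length_eq]; simp⟩
    rcases n with _ | ⟨f, n⟩
    · rw [h.formPerm_eq hk']; simp
    · rw [h.formPerm_eq hk']; simp

theorem not_adj_formPerm_formPerm (h : IsRing G l) (hm : Maximal G l) {y b c : V} (hy : y ∉ l)
    (hb : b ∈ l) (hc : c ∈ l) (hbc : b ≠ c) (hyb : G.Adj y b) (hyc : G.Adj y c) :
    ¬G.Adj (l.formPerm b) (l.formPerm c) := fun hadj => by
  obtain ⟨m, n, hl, h1, h2, h3, h4⟩ := h.exists_arcs hb hc hbc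
  have h3 := (h3 _).1 rfl
  have h4 := (h4 _).1 rfl
  refine hm.not_isChain h hy (k := (n ++ [b]).reverse ++ (m ++ [c])) ?_ ?_
  · refine List.Perm.trans ?_ hl.perm.symm
    grind
  · have e1 : ((n ++ [b]).reverse).IsChain G.Adj := by
      rw [List.isChain_reverse]
      simpa [SimpleGraph.adj_comm] using h2.tail
    have e2 := h1.tail
    rw [List.isChain_cons, List.append_assoc, List.isChain_append, List.isChain_append]
    simp only [List.tail_cons] at e2
    refine ⟨by simpa using hyb, e1, ⟨e2, by simp, by simpa using hyc.symm⟩, ?_⟩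
    intro u hu v hv
    rw [List.getLast?_reverse, h4] at hu
    rw [List.head?_append, h3] at hv
    simp only [Option.mem_def, Option.some.injEq, Option.some_or] at hu hv
    rw [← hu, ← hv]
    exact hadj.symm

theorem not_adj_bypass (h : IsRing G l) (hm : Maximal G l) {y b c : V} (hy : y ∉ l)
    (hb : b ∈ l) (hc : c ∈ l) (hbc : b ≠ c) (hyb : G.Adj y b) (hyc : G.Adj y c)
    (hsp : G.Adj (l.formPerm b) (l.formPerm⁻¹ b)) : ¬G.Adj b (l.formPerm c) := fun hadj => by
  obtain ⟨m, n, hl, h1, h2, h3, h4⟩ := h.exists_arcs hb hc hbc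
  have h3 := (h3 _).1 rfl
  have h4 := (h4 _).1 rfl
  rcases List.eq_nil_or_concat n with rfl | ⟨n, f, rfl⟩
  · simp only [List.nil_append, List.head?_cons, Option.some.injEq] at h4
    exact hadj.ne h4
  have hf : l.formPerm⁻¹ b = f := by
    rw [Equiv.Perm.inv_eq_iff_eq, h.formPerm_eq (b := f) (e := b) (t := m ++ c :: n)]
    refine hl.trans ⟨(b :: (m ++ c :: n)).length, ?_⟩
    have : b :: (m ++ c :: n.concat f) = (b :: (m ++ c :: n)) ++ [f] := by simp
    rw [this, List.rotate_append_length_eq]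
    simp
  rw [hf] at hsp
  refine hm.not_isChain h hy (k := b :: (n ++ [f] ++ (m ++ [c]))) ?_ ?_
  · refine List.Perm.trans ?_ hl.perm.symm
    grind
  · have e2 := h1.tail
    have e1 := h2.tail
    simp only [List.tail_cons, List.concat_eq_append] at e1 e2 h4
    rw [List.isChain_append] at e1
    rw [List.isChain_cons, List.cons_append, List.isChain_cons, List.append_assoc,
      List.isChain_append]
    refine ⟨by simpa using hyb, ?_, e1.1, List.isChain_append.2
      ⟨e2, by simp, by simpa using hyc.symm⟩, ?_⟩
    · intro u hu
      rw [List.head?_append] at h4 hu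
      grind
    · intro u hu v hv
      rw [List.head?_append, h3] at hv
      simp only [Option.mem_def, Option.some.injEq, Option.some_or, List.getLast?_append,
        List.getLast?_singleton] at hu hv
      rw [← hu, ← hv]
      exact hsp.symm

theorem rot (h : IsRing G l) (hm : Maximal G l) :
    Rot G {z | z ∈ l} l.formPerm (l.formPerm⁻¹ : Equiv.Perm V) := by
  have hr := h.reverse
  have hmr : Maximal G l.reverse := hm.of_mem_iff (by simp)
  have e : l.reverse.formPerm = l.formPerm⁻¹ := List.formPerm_reverse l
  have hinv : ∀ b ∈ l, l.formPerm⁻¹ b ∈ l := fun b hb => by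
    have := List.formPerm_apply_mem_of_mem (List.mem_reverse.2 hb)
    rwa [e, List.mem_reverse] at this
  refine ⟨by simp, by simp, fun b hb => List.formPerm_apply_mem_of_mem hb, hinv,
    fun b hb => h.adj_formPerm hb, ?_, ?_, ?_, ?_, ?_, ?_, ?_⟩
  · intro b hb hs
    exact h.formPerm_formPerm_ne hb (by rw [hs]; simp)
  · rintro T ⟨b, hb, hbT⟩ hT z hz
    exact h.mem_of_closed hb hbT (fun z hz => (hT z hz).1) hz
  · exact fun y hy b hb => h.not_adj_formPerm hm hy hb
  · exact fun y hy b hb c hc => h.not_adj_formPerm_formPerm hm hy hb hc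
  · intro y hy b hb c hc
    have := hr.not_adj_formPerm_formPerm hmr (y := y) (b := b) (c := c)
    rw [e] at this
    simp only [List.mem_reverse] at this
    exact this hy hb hc
  · exact fun y hy b hb c hc => h.not_adj_bypass hm hy hb hc
  · intro y hy b hb c hc hbc h1 h2 h3
    have := hr.not_adj_bypass hmr (y := y) (b := b) (c := c)
    rw [e, inv_inv] at this
    simp only [List.mem_reverse] at this
    exact this hy hb hc hbc h1 h2 h3.symm

end IsRing

theorem LocallyIsometric.locDiamTwo (h : LocallyIsometric G) : LocDiamTwo G := by
  intro v a b ha hb hab hnab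
  have h2 := ediam_le_iff.1 (h v) ⟨a, ha⟩ ⟨b, hb⟩
  obtain ⟨k, hk⟩ := exists_walk_of_edist_ne_top (ne_top_of_le_ne_top (by simp) h2)
  rw [← hk] at h2
  have h2 : k.length ≤ 2 := by exact_mod_cast h2
  match k, h2 with
  | .nil, _ => exact absurd rfl hab
  | .cons h1 .nil, _ => exact absurd h1 hnab
  | .cons (v := t) h1 (.cons h3 .nil), _ => exact ⟨t, t.2, (SimpleGraph.Adj.symm h1), h3⟩
  | .cons _ (.cons _ (.cons _ _)), h2 => simp only [Walk.length_cons] at h2; omega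

theorem length_le_degree [Fintype V] [DecidableEq V] [DecidableRel G.Adj] (v : V) {l : List V}
    (hl : l.Nodup) (h : ∀ a ∈ l, G.Adj v a) : l.length ≤ G.degree v := by
  rw [← List.toFinset_card_of_nodup hl, ← card_neighborFinset_eq_degree]
  exact Finset.card_le_card fun a ha => by simpa using h a (by simpa using ha)

theorem degree_le_five_of_cover [Fintype V] [DecidableEq V] [DecidableRel G.Adj] {v : V}
    (h : ∃ a b c d e, ∀ z, G.Adj v z → z = a ∨ z = b ∨ z = c ∨ z = d ∨ z = e) :
    G.degree v ≤ 5 := by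
  obtain ⟨a, b, c, d, e, h⟩ := h
  rw [← card_neighborFinset_eq_degree]
  refine (Finset.card_le_card fun z hz => ?_).trans (Finset.card_le_five (a := a) (b := b) (c := c)
    (d := d) (e := e))
  simpa using h z (by simpa using hz)

/-- A cycle that misses a vertex of a connected graph has a neighbour outside. -/
theorem exists_adj_of_notMem (hc : G.Connected) {C : Set V} {b y : V} (hb : b ∈ C) (hy : y ∉ C) :
    ∃ x ∉ C, ∃ c ∈ C, G.Adj x c := by
  obtain ⟨k⟩ := hc.preconnected b y
  obtain ⟨d, -, h1, h2⟩ := k.exists_boundary_dart C hb hy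
  exact ⟨d.snd, h2, d.fst, h1, d.adj.symm⟩

theorem exists_notMem_support [Fintype V] [DecidableEq V] {a : V} {k : G.Walk a a}
    (hk : k.IsCycle) (h : ¬k.IsHamiltonianCycle) : ∃ y, y ∉ k.support := by
  by_contra! hall
  refine h (Walk.isHamiltonianCycle_iff_isCycle_and_support_count_tail_eq_one.2 ⟨hk, fun z => ?_⟩)
  refine List.count_eq_one_of_mem hk.support_nodup ?_
  have := hall z
  rw [Walk.mem_support_iff] at this
  rcases this with rfl | h
  · exact Walk.end_mem_tail_support hk.not_nil
  · exact h

/-- A cycle that cannot be extended yields a complete tripartite graph. -/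
theorem exists_isTripartite_of_maximal [Finite V] [DecidableEq V] (hc : G.Connected)
    (hl : LocDiamTwo G) (hd : DegLeSix G) (ht : TwinsDegLeFive G)
    (hlp : ∀ u v, ¬LinkPair G u v) {l : List V} (hr : IsRing G l) (hm : IsRing.Maximal G l)
    {y : V} (hy : y ∉ l) : ∃ w b c x q r t, IsTripartite G w b c x q r t := by
  have hrot := hr.rot hm
  obtain ⟨b, hb⟩ := List.exists_mem_of_length_pos (l := l) (by have := hr.length; omega)
  obtain ⟨x, hx, c, hc, hxc⟩ := exists_adj_of_notMem hc (C := {z | z ∈ l}) hb hy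
  refine Good.exists_isTripartite (x := x)
    ⟨hrot, hl, hd, ht, hx, fun c hc d hd' h1 h2 h3 h4 => ?_⟩ hc hxc
  exact hlp c d (hrot.linkPair_of_sole hl hd ht hx hc hd' h1 h2 h3 h4)

end Core

/-- Theorem 2: a connected locally isometric graph with maximum degree `6` that has
no pair of true twins of degree `6` is either fully cycle extendable or isomorphic
to `K_{2,4} + K₁ = K_{1,2,4}` (the join of `K_{2,4}` with a single vertex). -/
theorem locallyIsometric_maxDegree_six_no_true_twins
    {V : Type*} [Fintype V] [DecidableEq V] (G : SimpleGraph V) [DecidableRel G.Adj]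
    (hconn : G.Connected) (hli : LocallyIsometric G) (hmax : G.maxDegree = 6)
    (hnt : ¬∃ u w : V, u ≠ w ∧
      insert u (G.neighborSet u) = insert w (G.neighborSet w) ∧
      G.degree u = 6) :
    FullyCycleExtendable G ∨
      Nonempty (G ≃g completeMultipartiteGraph ![Fin 1, Fin 2, Fin 4]) := by
  have hle : ∀ v, G.degree v ≤ 6 := fun v => hmax ▸ G.degree_le_maxDegree v
  have hl := hli.locDiamTwo
  have hd : DegLeSix G := fun v l hn ha => (length_le_degree v hn ha).trans (hle v)
  have ht : TwinsDegLeFive G := by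
    rintro u w ⟨hne, hadj, hz⟩ l hn ha
    refine (length_le_degree u hn ha).trans ?_
    by_contra hcon
    refine hnt ⟨u, w, hne, ?_, by have := hle u; omega⟩
    ext z
    simp only [Set.mem_insert_iff, mem_neighborSet]
    by_cases h1 : z = u
    · simp [h1, hadj.symm]
    · by_cases h2 : z = w
      · simp [h2, hadj]
      · simp [h1, h2, hz z h1 h2]
  have := hconn.nonempty
  obtain ⟨v, hv⟩ := G.exists_maximal_degree_vertex
  rw [hmax] at hv
  have hlp : ∀ u v, ¬LinkPair G u v := fun u w h => by
    have := degree_le_five_of_cover (h.exists_cover hl ht hconn v)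
    omega
  by_cases hex : ∃ l y, IsRing G l ∧ IsRing.Maximal G l ∧ y ∉ l
  · obtain ⟨l, y, hr, hm, hy⟩ := hex
    obtain ⟨w, b, c, x, q, r, t, h⟩ :=
      exists_isTripartite_of_maximal hconn hl hd ht hlp hr hm hy
    exact .inr (h.nonempty_iso hconn)
  · refine .inl ⟨?_, fun a k hk hkn => ?_⟩
    · obtain ⟨a, -, b, -, c, -, hab, hac, hbc⟩ := Finset.two_lt_card.1
        (show 2 < (G.neighborFinset v).card by rw [card_neighborFinset_eq_degree]; omega)
      exact exists_triangle hl hconn hab hac hbc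
    · obtain ⟨y, hy⟩ := exists_notMem_support hk hkn
      obtain ⟨l, hr, hmem⟩ := IsRing.exists_of_isCycle hk
      by_contra hcon
      refine hex ⟨l, y, hr, fun x hx j hj hz => hcon ⟨x, by rwa [← hmem], ?_⟩, by rwa [hmem]⟩
      convert hj.hasCycleOn using 1
      ext z
      simp [hz, hmem]
end

section
/- Let G be a connected locally isometric graph of order at least 8 with maximum degree Δ(G) = 6 that is not fully cycle extendable. Then G has a vertex of degree 2. -/
open SimpleGraph

/-- A cycle with vertex set `C`, successor `s` and predecessor `t` in a graph of maximum degree at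
most `6` in which neighbourhoods have diameter at most `2`, together with a vertex `x` off the
cycle. The fields `insert_s` to `swap_t` exclude the simplest ways of extending the cycle by one
vertex. -/
structure NonExtSystem {V : Type*} (G : SimpleGraph V) (C : Set V) (x : V) (s t : V → V) :
    Prop where
  not_mem : x ∉ C
  s_mem : ∀ u ∈ C, s u ∈ C
  t_mem : ∀ u ∈ C, t u ∈ C
  s_t : ∀ u ∈ C, s (t u) = u
  t_s : ∀ u ∈ C, t (s u) = u
  adj_s : ∀ u ∈ C, G.Adj u (s u)
  adj_t : ∀ u ∈ C, G.Adj u (t u)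
  s_ne_t : ∀ u ∈ C, s u ≠ t u
  orbit : ∀ P : V → Prop, (∃ u ∈ C, P u) → (∀ u ∈ C, P u → P (s u)) → ∀ u ∈ C, P u
  insert_s : ∀ y ∉ C, ∀ u ∈ C, G.Adj y u → ¬G.Adj y (s u)
  insert_t : ∀ y ∉ C, ∀ u ∈ C, G.Adj y u → ¬G.Adj y (t u)
  cross_s : ∀ p ∈ C, ∀ q ∈ C, p ≠ q → G.Adj x p → G.Adj x q → ¬G.Adj (s p) (s q)
  cross_t : ∀ p ∈ C, ∀ q ∈ C, p ≠ q → G.Adj x p → G.Adj x q → ¬G.Adj (t p) (t q)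
  skip_s : ∀ p ∈ C, ∀ q ∈ C, p ≠ q → G.Adj x p → G.Adj x q → G.Adj (s p) (t p) →
    ¬G.Adj p (s q)
  skip_t : ∀ p ∈ C, ∀ q ∈ C, p ≠ q → G.Adj x p → G.Adj x q → G.Adj (s p) (t p) →
    ¬G.Adj p (t q)
  swap_s : ∀ m ∈ C, ∀ c ∈ C, c ≠ m → c ≠ t m → G.Adj x (s m) → G.Adj x (t m) →
    G.Adj m c → ¬G.Adj m (s c)
  swap_t : ∀ m ∈ C, ∀ c ∈ C, c ≠ m → c ≠ s m → G.Adj x (s m) → G.Adj x (t m) →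
    G.Adj m c → ¬G.Adj m (t c)
  deg_le : ∀ v (l : List V), (∀ u ∈ l, G.Adj v u) → l.Nodup → l.length ≤ 6
  diam_le : ∀ v u w, G.Adj v u → G.Adj v w → u ≠ w → ¬G.Adj u w →
    ∃ z, G.Adj v z ∧ G.Adj u z ∧ G.Adj z w
  exists_third : ∀ v p a, ∃ w, G.Adj v w ∧ w ≠ p ∧ w ≠ a
  exists_far : ∀ p, ∃ u t, u ≠ p ∧ ¬G.Adj p u ∧ G.Adj p t ∧ G.Adj t u

namespace NonExtSystem
variable {V : Type*} {G : SimpleGraph V} {C : Set V} {x : V} {s t : V → V}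

theorem symm (h : NonExtSystem G C x s t) : NonExtSystem G C x t s where
  not_mem := h.not_mem
  s_mem := h.t_mem
  t_mem := h.s_mem
  s_t := h.t_s
  t_s := h.s_t
  adj_s := h.adj_t
  adj_t := h.adj_s
  s_ne_t u hu := (h.s_ne_t u hu).symm
  orbit P hP hs u hu := by
    by_contra hc
    obtain ⟨v, hv, hPv⟩ := hP
    refine h.orbit (fun w ↦ ¬ P w) ⟨u, hu, hc⟩ (fun w hw hn hsw ↦ hn ?_) v hv hPv
    have := hs (s w) (h.s_mem w hw) hsw
    rwa [h.t_s w hw] at this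
  insert_s := h.insert_t
  insert_t := h.insert_s
  cross_s := h.cross_t
  cross_t := h.cross_s
  skip_s p hp q hq hn h1 h2 h3 := h.skip_t p hp q hq hn h1 h2 h3.symm
  skip_t p hp q hq hn h1 h2 h3 := h.skip_s p hp q hq hn h1 h2 h3.symm
  swap_s m hm c hc h1 h2 h3 h4 := h.swap_t m hm c hc h1 h2 h4 h3
  swap_t m hm c hc h1 h2 h3 h4 := h.swap_s m hm c hc h1 h2 h4 h3
  deg_le := h.deg_le
  diam_le := h.diam_le
  exists_third := h.exists_third
  exists_far := h.exists_far

theorem eq_of_adj (h : NonExtSystem G C x s t) {v a b c d e f : V}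
    (ha : G.Adj v a) (hb : G.Adj v b) (hc : G.Adj v c) (hd : G.Adj v d) (he : G.Adj v e)
    (hf : G.Adj v f) (hn : [a, b, c, d, e, f].Nodup) (w : V) (hw : G.Adj v w) :
    w = a ∨ w = b ∨ w = c ∨ w = d ∨ w = e ∨ w = f := by
  by_contra hc'
  have := h.deg_le v [w, a, b, c, d, e, f] (by simp [*]) (by
    rw [List.nodup_cons]; exact ⟨by simpa using hc', hn⟩)
  simp at this

theorem exists_third_adj (h : NonExtSystem G C x s t) {v p a : V} (hp : G.Adj v p) :
    ∃ w, G.Adj v w ∧ w ≠ p ∧ w ≠ a ∧ (G.Adj w p ∨ G.Adj w a) := by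
  obtain ⟨w, hw, h1, h2⟩ := h.exists_third v p a
  by_cases hwp : G.Adj w p
  · exact ⟨w, hw, h1, h2, .inl hwp⟩
  obtain ⟨z, hz, hz1, hz2⟩ := h.diam_le v w p hw hp h1 hwp
  by_cases hza : z = a
  · exact ⟨w, hw, h1, h2, .inr (hza ▸ hz1)⟩
  · exact ⟨z, hz, hz2.ne, hza, .inl hz2⟩

/-- The vertices of `C` adjacent to `x`. -/
def attached (G : SimpleGraph V) (C : Set V) (x : V) : Set V := {u | u ∈ C ∧ G.Adj x u}

theorem attached_facts (h : NonExtSystem G C x s t) {u : V} (hu : u ∈ attached G C x) :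
    G.Adj u (s u) ∧ G.Adj u (t u) ∧ G.Adj x u ∧ ¬G.Adj x (s u) ∧ ¬G.Adj x (t u) ∧
      s u ≠ t u ∧ x ≠ s u ∧ x ≠ t u :=
  ⟨h.adj_s u hu.1, h.adj_t u hu.1, hu.2, h.insert_s x h.not_mem u hu.1 hu.2,
    h.insert_t x h.not_mem u hu.1 hu.2, h.s_ne_t u hu.1,
    fun e ↦ h.not_mem (e ▸ h.s_mem u hu.1), fun e ↦ h.not_mem (e ▸ h.t_mem u hu.1)⟩

theorem s_ne_s (h : NonExtSystem G C x s t) {p q : V} (hp : p ∈ C) (hq : q ∈ C) (hn : p ≠ q) :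
    s p ≠ s q := fun e ↦ hn (by rw [← h.t_s p hp, e, h.t_s q hq])

theorem pair_facts (h : NonExtSystem G C x s t) {p q : V} (hp : p ∈ attached G C x)
    (hq : q ∈ attached G C x) (hn : p ≠ q) :
    s p ≠ s q ∧ t p ≠ t q ∧ ¬G.Adj (s p) (s q) ∧ ¬G.Adj (t p) (t q) :=
  ⟨h.s_ne_s hp.1 hq.1 hn, h.symm.s_ne_s hp.1 hq.1 hn, h.cross_s p hp.1 q hq.1 hn hp.2 hq.2,
    h.cross_t p hp.1 q hq.1 hn hp.2 hq.2⟩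

theorem exists_common_s (h : NonExtSystem G C x s t) {p : V} (hp : p ∈ attached G C x) :
    ∃ a ∈ attached G C x, G.Adj a p ∧ G.Adj a (s p) := by
  have h1 := h.attached_facts hp
  obtain ⟨z, hz, hz1, hz2⟩ := h.diam_le p x (s p) hp.2.symm h1.1 h1.2.2.2.2.2.2.1 h1.2.2.2.1
  refine ⟨z, ⟨?_, hz1⟩, hz.symm, hz2⟩
  by_contra hzC
  exact h.insert_s z hzC p hp.1 hz.symm hz2

theorem exists_common_t (h : NonExtSystem G C x s t) {p : V} (hp : p ∈ attached G C x) :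
    ∃ a ∈ attached G C x, G.Adj a p ∧ G.Adj a (t p) := h.symm.exists_common_s hp

theorem eq_of_four_cycle (h : NonExtSystem G C x s t) {p a : V} (hp : p ∈ C) (ha : a ∈ C)
    (h1 : s p = t a) (h2 : t p = s a) : ∀ u ∈ C, u = p ∨ u = s p ∨ u = a ∨ u = t p := by
  refine h.orbit _ ⟨p, hp, .inl rfl⟩ fun u _ hP ↦ ?_
  have e1 : s (s p) = a := by rw [h1, h.s_t a ha]
  have e2 : s (t p) = p := h.s_t p hp
  rcases hP with rfl | rfl | rfl | rfl
  · exact .inr (.inl rfl)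
  · exact .inr (.inr (.inl e1))
  · exact .inr (.inr (.inr h2.symm))
  · exact .inl e2

theorem not_adj_s_t (h : NonExtSystem G C x s t) {p : V} (hp : p ∈ attached G C x) :
    ¬G.Adj (s p) (t p) := by
  intro hst
  obtain ⟨a, ha, hap, hasp⟩ := h.exists_common_s hp
  obtain ⟨c, hc, hca, hcsa⟩ := h.exists_common_s ha
  obtain ⟨c', hc', hca', hcta'⟩ := h.exists_common_t ha
  obtain ⟨b, hb, hbp, hbtp⟩ := h.exists_common_t hp
  have skip : ∀ q ∈ attached G C x, q ≠ p → ¬G.Adj p (s q) ∧ ¬G.Adj p (t q) := fun q hq hne ↦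
    ⟨h.skip_s p hp.1 q hq.1 hne.symm hp.2 hq.2 hst, h.skip_t p hp.1 q hq.1 hne.symm hp.2 hq.2 hst⟩
  have hsta : ¬G.Adj (s a) (t a) := fun hh ↦
    h.skip_s a ha.1 p hp.1 hap.ne ha.2 hp.2 hh hasp
  have Fp := h.attached_facts hp
  have Fa := h.attached_facts ha
  have Fb := h.attached_facts hb
  have Fc := h.attached_facts hc
  have Fpa := h.pair_facts hp ha hap.ne'
  have Fac := h.pair_facts ha hc hca.ne'
  have Ka := skip a ha hap.ne
  have irr : ∀ u, ¬G.Adj u u := fun u ↦ G.irrefl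
  have hcp : c ≠ p := by grind [SimpleGraph.adj_comm]
  have Fpc := h.pair_facts hp hc hcp.symm
  have Kc := skip c hc hcp
  have hc'p : c' ≠ p := by grind [SimpleGraph.adj_comm]
  have Fc' := h.attached_facts hc'
  have hNa := h.eq_of_adj (v := a) ha.2.symm Fa.1 Fa.2.1 hap hasp hca.symm
    (by simp; and_intros <;> grind [SimpleGraph.adj_comm])
  have hcc : c' = c := by
    have := hNa c' hca'.symm
    grind [SimpleGraph.adj_comm]
  subst hcc
  have hcsp : G.Adj c' (s p) := by
    obtain ⟨z, hz, hz1, hz2⟩ := h.diam_le a (s p) (s a) hasp Fa.1 Fpa.1 Fpa.2.2.1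
    have := hNa z hz
    grind [SimpleGraph.adj_comm]
  have hNc : ∀ z, G.Adj c' z → G.Adj x z → z = a := by
    intro z hz hxz
    have : s p ≠ s c' ∧ s p ≠ t c' ∧ s a ≠ s c' ∧ s a ≠ t a ∧ s p ≠ s a ∧ s p ≠ t a := by
      and_intros <;> grind [SimpleGraph.adj_comm]
    have four : ¬(s a = t c' ∧ t a = s c') := fun e ↦ by
      have := h.eq_of_four_cycle ha.1 hc.1 e.1 e.2 p hp.1
      grind [SimpleGraph.adj_comm]
    by_cases e : s a = t c'
    · have := h.eq_of_adj (v := c') hc'.2.symm Fc.1 Fc.2.1 hca hcsp hcta'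
        (by simp; and_intros <;> grind [SimpleGraph.adj_comm]) z hz
      grind [SimpleGraph.adj_comm]
    · have := h.eq_of_adj (v := c') hc'.2.symm Fc.1 Fc.2.1 hca hcsp hcsa
        (by simp; and_intros <;> grind [SimpleGraph.adj_comm]) z hz
      grind [SimpleGraph.adj_comm]
  have hbc : b ≠ c' := by
    rintro rfl
    exact hap.ne (hNc p hbp hp.2).symm
  have hba : b = a := by
    by_cases hadj : G.Adj c' b
    · exact hNc b hadj hb.2
    obtain ⟨z, hz, hz1, hz2⟩ := h.diam_le x c' b hc'.2 hb.2 hbc.symm hadj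
    have := hNc z hz1 hz
    subst this
    have := hNa b hz2
    grind [SimpleGraph.adj_comm]
  subst hba
  have := hNa (t p) hbtp
  grind [SimpleGraph.adj_comm]

theorem not_four_cycle (h : NonExtSystem G C x s t) {p a : V} (hp : p ∈ attached G C x)
    (ha : a ∈ attached G C x) (hpa : p ≠ a) (h1 : s p = t a) : t p ≠ s a := by
  intro h2
  have four := h.eq_of_four_cycle hp.1 ha.1 h1 h2
  have Fp := h.attached_facts hp
  have hms : G.Adj (s p) a := h1 ▸ (h.adj_t a ha.1).symm
  obtain ⟨w, hw, hwp, hwa, hor⟩ := h.exists_third_adj (a := a) Fp.1.symm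
  by_cases hwC : w ∈ C
  · have := h.not_adj_s_t hp
    rcases four w hwC with rfl | rfl | rfl | rfl <;> simp_all
  · rcases hor with hor | hor
    · exact h.insert_s w hwC p hp.1 hor hw.symm
    · exact h.insert_t w hwC a ha.1 hor (h1 ▸ hw.symm)

/-- A common neighbour of `s p` and `t p` that is not adjacent to `x` but is adjacent to the
neighbour `a` of `s p` forces `p` and `a` to be at distance two on the cycle. -/
theorem s_eq_t_of_chord (h : NonExtSystem G C x s t) {p a b c : V} (hp : p ∈ attached G C x)
    (ha : a ∈ attached G C x) (hb : b ∈ attached G C x) (hap : G.Adj a p) (hasp : G.Adj a (s p))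
    (hatp : ¬G.Adj a (t p)) (hbp : G.Adj b p) (hbsp : ¬G.Adj b (s p))
    (hcx : ¬G.Adj x c) (hcp : G.Adj p c) (hcsp : G.Adj (s p) c)
    (hctp : G.Adj c (t p)) (hca : G.Adj c a)
    (hNp : ∀ w, G.Adj p w → w = x ∨ w = s p ∨ w = t p ∨ w = a ∨ w = b ∨ w = c) :
    s p = t a ∧ ∃ d ∈ attached G C x, G.Adj d (s a) ∧
      ∀ w, G.Adj a w → w = x ∨ w = s a ∨ w = t a ∨ w = p ∨ w = c ∨ w = d := by
  have Fp := h.attached_facts hp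
  have Fa := h.attached_facts ha
  have Fpa := h.pair_facts hp ha hap.ne'
  obtain ⟨d, hd, hda, hdsa⟩ := h.exists_common_s ha
  have irr : ∀ u, ¬G.Adj u u := fun u ↦ G.irrefl
  have hdp : d ≠ p := by
    rintro rfl
    have := hNp _ hdsa
    have := h.attached_facts hb
    grind [SimpleGraph.adj_comm]
  have Fd := h.attached_facts hd
  have hcs : ∀ q ∈ attached G C x, c ≠ s q ∧ c ≠ t q := by
    intro q hq
    by_cases e : p = q
    · grind [SimpleGraph.adj_comm]
    · have := h.pair_facts hp hq e
      grind [SimpleGraph.adj_comm]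
  have Ca := hcs a ha
  have key : s p = t a := by
    by_contra hne
    have h7 := h.eq_of_adj (v := a) ha.2.symm Fa.1 Fa.2.1 hap hasp hca.symm
      (by simp; and_intros <;> grind [SimpleGraph.adj_comm]) d hda.symm
    grind [SimpleGraph.adj_comm]
  refine ⟨key, d, hd, hdsa, h.eq_of_adj ha.2.symm Fa.1 Fa.2.1 hap hca.symm hda.symm
      (by simp; and_intros <;> grind [SimpleGraph.adj_comm])⟩

theorem no_consecutive_chord (h : NonExtSystem G C x s t) {p a b c : V}
    (hp : p ∈ attached G C x) (ha : a ∈ attached G C x) (hb : b ∈ attached G C x)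
    (hap : G.Adj a p) (hba : G.Adj b a) (hbp : G.Adj b p)
    (hc : c ∈ C) (hcx : c ∉ attached G C x) (hcp : G.Adj p c)
    (hcsp : G.Adj (s p) c) (hctp : G.Adj c (t p)) (hca : G.Adj c a) (hcsa : G.Adj c (s a))
    (hsp : s p = t a) (htp : t p = s b) (hsa : s a = t c)
    (hNp : ∀ w, G.Adj p w → w = x ∨ w = s p ∨ w = t p ∨ w = a ∨ w = b ∨ w = c)
    (hNa : ∀ w, G.Adj a w → w = x ∨ w = s a ∨ w = t a ∨ w = p ∨ w = c ∨ w = b) : False := by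
  have irr : ∀ u, ¬G.Adj u u := fun u ↦ G.irrefl
  have Fp := h.attached_facts hp
  have Fa := h.attached_facts ha
  have Fb := h.attached_facts hb
  have hxc : ¬G.Adj x c := fun e ↦ hcx ⟨hc, e⟩
  have Fpa := h.pair_facts hp ha hap.ne'
  have Fab := h.pair_facts ha hb hba.ne'
  have np := h.not_adj_s_t hp
  have na := h.not_adj_s_t ha
  have ssp : s (s p) = a := by rw [hsp, h.s_t a ha.1]
  have tsp : t (s p) = p := h.t_s p hp.1
  have stp : s (t p) = p := h.s_t p hp.1
  have ttp : t (t p) = b := by rw [htp, h.t_s b hb.1]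
  have hcb : c ≠ b := fun e ↦ hcx (e ▸ hb)
  have scp : s c ≠ s p := h.s_ne_s hc hp.1 hcp.ne'
  have scb : s c ≠ s b := h.s_ne_s hc hb.1 hcb
  have tsc : t (s c) = c := h.t_s c hc
  have hsc := h.adj_s c hc
  have hsc' := h.s_mem c hc
  have sca : s c ≠ a := by grind [SimpleGraph.adj_comm]
  have scx : s c ≠ x := fun e ↦ h.not_mem (e ▸ hsc')
  have scp' : s c ≠ p := by grind [SimpleGraph.adj_comm]
  have Fpb := h.pair_facts hp hb hbp.ne'
  have scb' : s c ≠ b := by grind [SimpleGraph.adj_comm]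
  have scsa : s c ≠ s a := h.s_ne_s hc ha.1 hca.ne
  have hpsc : ¬G.Adj p (s c) := fun e ↦ by
    have := hNp _ e
    grind [SimpleGraph.adj_comm]
  have hasc : ¬G.Adj a (s c) := fun e ↦ by
    have := hNa _ e
    grind [SimpleGraph.adj_comm]
  have hmsc : ¬G.Adj (s p) (s c) :=
    h.swap_s (s p) (h.s_mem p hp.1) c hc hcsp.ne' (by rw [tsp]; exact hcp.ne')
      (by rw [ssp]; exact ha.2) (by rw [tsp]; exact hp.2) hcsp
  have htsc : ¬G.Adj (t p) (s c) :=
    h.swap_s (t p) (h.t_mem p hp.1) c hc hctp.ne (by rw [ttp]; exact hcb)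
      (by rw [stp]; exact hp.2) (by rw [ttp]; exact hb.2) hctp.symm
  have hNc := h.eq_of_adj (v := c) hcp.symm hcsp.symm hctp hca hcsa hsc
    (by simp; and_intros <;> grind [SimpleGraph.adj_comm])
  obtain ⟨z, hz, hz1, hz2⟩ := h.diam_le c p (s c) hcp.symm hsc scp'.symm hpsc
  have hpsa : ¬G.Adj p (s a) := fun e ↦ by
    have := hNp _ e
    grind [SimpleGraph.adj_comm]
  rcases hNc z hz with e | e | e | e | e | e <;> rw [e] at hz1 hz2
  exacts [hpsc hz2, hmsc hz2, htsc hz2, hasc hz2, hpsa hz1, hpsc hz1]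

theorem not_adj_of_chord_of_adj (h : NonExtSystem G C x s t) {p a b c : V}
    (hp : p ∈ attached G C x)
    (ha : a ∈ attached G C x) (hb : b ∈ attached G C x) (hpa : p ≠ a) (hpb : p ≠ b) (hab : a ≠ b)
    (hc : c ∈ C) (hcx : c ∉ attached G C x) (hcp : G.Adj p c) (hcsp : G.Adj (s p) c)
    (hctp : G.Adj c (t p)) (hsp : s p = t a) (htp : t p = s b) (hca : G.Adj c a) : ¬G.Adj c b := by
  intro hcb'
  have Fp := h.attached_facts hp
  have Fa := h.attached_facts ha
  have Fb := h.attached_facts hb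
  have Fpa := h.pair_facts hp ha hpa
  have Fpb := h.pair_facts hp hb hpb
  have hcb : c ≠ b := fun e ↦ hcx (e ▸ hb)
  have hca' : c ≠ a := fun e ↦ hcx (e ▸ ha)
  have hcp' : c ≠ p := fun e ↦ hcx (e ▸ hp)
  have h1 := h.adj_s c hc
  have h2 := h.adj_t c hc
  have h3 := h.s_ne_t c hc
  have h4 := h.s_ne_s hc hp.1 hcp'
  have h5 := h.symm.s_ne_s hc hp.1 hcp'
  have h6 := h.s_ne_s hc hb.1 hcb
  have h7 := h.symm.s_ne_s hc ha.1 hca'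
  have h8 := h.t_s c hc
  have h9 := h.s_t c hc
  have irr : ∀ u, ¬G.Adj u u := fun u ↦ G.irrefl
  have n1 : s p ≠ a ∧ s p ≠ b ∧ t p ≠ a ∧ t p ≠ b := by
    and_intros <;> intro e <;> grind
  have n2 : s c ≠ p ∧ s c ≠ t p ∧ s c ≠ a ∧ s c ≠ b := by
    and_intros <;> intro e <;> grind [SimpleGraph.adj_comm]
  have n3 : t c ≠ p ∧ t c ≠ s p ∧ t c ≠ a ∧ t c ≠ b := by
    and_intros <;> intro e <;> grind [SimpleGraph.adj_comm]
  have := h.deg_le c [p, s p, t p, a, b, s c, t c] (by simp [hcp.symm, hcsp.symm, h1, h2, hca, hcb', hctp])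
    (by simp [*, Ne.symm]; grind)
  simp at this

theorem t_eq_s_or_s_eq_t_of_adj (h : NonExtSystem G C x s t) {p a b : V}
    (hp : p ∈ attached G C x) (ha : a ∈ attached G C x) (hb : b ∈ attached G C x)
    (hpa : p ≠ a) (hpb : p ≠ b) (hab : a ≠ b) (htp : t p ≠ s a) (hbp : G.Adj b p)
    (hba : G.Adj b a) (hbtp : G.Adj b (t p)) (hbsa : G.Adj b (s a)) :
    t p = s b ∨ s a = t b := by
  by_contra! hne
  have Fp := h.attached_facts hp
  have Fa := h.attached_facts ha
  have Fb := h.attached_facts hb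
  have Fpb := h.pair_facts hp hb hpb
  have Fab := h.pair_facts ha hb hab
  have n1 : p ≠ s a ∧ p ≠ s b ∧ p ≠ t b ∧ a ≠ t p ∧ a ≠ s b ∧ a ≠ t b := by
    and_intros <;> intro e <;> grind
  have := h.deg_le b [x, s b, t b, p, t p, a, s a] (by simp [Fb.2.2.1.symm, *])
    (by
      have := Fp.2.2.1.ne
      have := Fa.2.2.1.ne
      have := Fa.1.ne
      have := Fp.2.1.ne
      simp only [List.nodup_cons, List.mem_cons, List.not_mem_nil]
      clear hp ha hb
      grind)
  simp at this

theorem s_eq_t_or_t_eq_s_of_adj (h : NonExtSystem G C x s t) {p a c : V}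
    (hp : p ∈ attached G C x) (ha : a ∈ attached G C x) (hpa : p ≠ a) (hc : c ∈ C)
    (hsp : s p = t a) (hcp : G.Adj c p) (hca : G.Adj c a) (hcsp : G.Adj c (s p))
    (hctp : G.Adj c (t p)) (hcsa : G.Adj c (s a)) :
    s c = t p ∨ t c = s a := by
  by_contra! hne
  have htp := h.not_four_cycle hp ha hpa hsp
  have Fp := h.attached_facts hp
  have Fa := h.attached_facts ha
  have Fpa := h.pair_facts hp ha hpa
  have h1 := h.adj_s c hc
  have h2 := h.adj_t c hc
  have h3 := h.s_ne_t c hc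
  have h4 := h.s_ne_s hc hp.1 hcp.ne
  have h5 := h.symm.s_ne_s hc hp.1 hcp.ne
  have h6 := h.s_ne_s hc ha.1 hca.ne
  have h7 := h.symm.s_ne_s hc ha.1 hca.ne
  have h8 := h.t_s c hc
  have h9 := h.s_t c hc
  have n1 : p ≠ s a ∧ a ≠ t p ∧ s p ≠ a := by
    and_intros <;> intro e <;> grind
  have n2 : s c ≠ p ∧ s c ≠ a := by
    have := hctp.ne
    have := hcsp.ne
    and_intros <;> intro e <;> grind
  have n3 : t c ≠ p ∧ t c ≠ a := by
    have := hcsp.ne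
    have := hcsa.ne
    and_intros <;> intro e <;> grind
  have := h.deg_le c [p, s p, t p, a, s a, s c, t c]
    (by simp [hcp, hcsp, hctp, hca, hcsa, h1, h2])
    (by
      have := Fa.1.ne
      have := Fp.1.ne
      have := Fp.2.1.ne
      simp only [List.nodup_cons, List.mem_cons, List.not_mem_nil]
      clear hp ha hc
      grind)
  simp at this

theorem not_adj_of_chord (h : NonExtSystem G C x s t) {p a b c : V} (hp : p ∈ attached G C x)
    (ha : a ∈ attached G C x) (hb : b ∈ attached G C x) (hap : G.Adj a p) (hasp : G.Adj a (s p))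
    (hatp : ¬G.Adj a (t p)) (hbp : G.Adj b p) (hbsp : ¬G.Adj b (s p)) (hbtp : G.Adj b (t p))
    (hc : c ∈ C) (hcx : c ∉ attached G C x) (hcp : G.Adj p c) (hcsp : G.Adj (s p) c)
    (hctp : G.Adj c (t p))
    (hNp : ∀ w, G.Adj p w → w = x ∨ w = s p ∨ w = t p ∨ w = a ∨ w = b ∨ w = c) :
    ¬G.Adj c a := by
  intro hca
  have hxc : ¬G.Adj x c := fun e ↦ hcx ⟨hc, e⟩
  have hxc' : x ≠ c := fun e ↦ h.not_mem (e ▸ hc)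
  obtain ⟨hsp, d, hd, hdsa, hNa⟩ :=
    h.s_eq_t_of_chord hp ha hb hap hasp hatp hbp hbsp hxc hcp hcsp hctp hca hNp
  have irr : ∀ u, ¬G.Adj u u := fun u ↦ G.irrefl
  have Fp := h.attached_facts hp
  have Fa := h.attached_facts ha
  have Fb := h.attached_facts hb
  have np := h.not_adj_s_t hp
  have na := h.not_adj_s_t ha
  have hab : a ≠ b := by rintro rfl; exact hatp hbtp
  have Fpa := h.pair_facts hp ha hap.ne'
  have Fpb := h.pair_facts hp hb hbp.ne'
  have Fab := h.pair_facts ha hb hab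
  have hcb : c ≠ b := fun e ↦ hcx (e ▸ hb)
  have hca' : c ≠ a := fun e ↦ hcx (e ▸ ha)
  have hcp' : c ≠ p := fun e ↦ hcx (e ▸ hp)
  have hNp' : ∀ w, G.Adj p w → w = x ∨ w = t p ∨ w = s p ∨ w = b ∨ w = a ∨ w = c := by
    intro w hw
    have := hNp w hw
    clear * - this
    tauto
  have hcb' : ¬G.Adj c b := fun e ↦ h.not_adj_of_chord_of_adj hp ha hb hap.ne' hbp.ne' hab hc hcx hcp
    hcsp hctp hsp (h.symm.s_eq_t_of_chord hp hb ha hbp hbtp hbsp hap hatp hxc hcp hctp.symm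
        hcsp.symm e hNp').1 hca e
  have hba : G.Adj b a := by
    obtain ⟨z, hz, hz1, hz2⟩ := h.diam_le p b (s p) hbp.symm Fp.1
      (fun e ↦ Fp.2.2.2.1 (e ▸ hb.2)) hbsp
    rcases hNp z hz with e | e | e | e | e | e <;> rw [e] at hz1 hz2
    exacts [(Fp.2.2.2.1 hz2).elim, (hbsp hz1).elim, (np hz2.symm).elim, hz1, (irr _ hz1).elim,
      (hcb' hz1.symm).elim]
  have hdb : d = b := by
    have := hNa b hba.symm
    grind [SimpleGraph.adj_comm]
  subst hdb
  have hpa := hap.ne'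
  have htp := h.not_four_cycle hp ha hpa hsp
  have hpsa : ¬G.Adj p (s a) := fun e ↦ by
    rcases hNp _ e with e | e | e | e | e | e
    exacts [Fa.2.2.2.2.2.2.1 e.symm, Fpa.1 e.symm, htp e.symm, Fa.1.ne e.symm,
      Fa.2.2.2.1 (e ▸ hb.2), Fpa.2.2.1 (e ▸ hcsp)]
  have hcsa : G.Adj c (s a) := by
    obtain ⟨z, hz, hz1, hz2⟩ := h.diam_le a (s a) (t a) Fa.1 Fa.2.1 Fa.2.2.2.2.2.1 na
    rcases hNa z hz with e | e | e | e | e | e <;> rw [e] at hz1 hz2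
    exacts [(Fa.2.2.2.1 hz1.symm).elim, (irr _ hz1).elim, (na hz1).elim,
      (hpsa hz1.symm).elim, hz1.symm, (hbsp (hsp ▸ hz2)).elim]
  have h1 := h.t_eq_s_or_s_eq_t_of_adj hp ha hb hpa hbp.ne' hab htp hbp hba hbtp hdsa
  have h2 := h.s_eq_t_or_t_eq_s_of_adj hp ha hpa hc hsp hcp.symm hca hcsp.symm hctp hcsa
  rcases h1 with h1 | h1 <;> rcases h2 with h2 | h2
  · exact h.s_ne_s hc hb.1 hcb (h2.trans h1)
  · exact h.no_consecutive_chord hp ha hb hap hba hbp hc hcx hcp hcsp hctp hca hcsa hsp h1 h2.symm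
      hNp hNa
  · refine h.symm.no_consecutive_chord ha hp hb hap.symm hbp hba hc hcx hca.symm (hsp ▸ hcsp) hcsa
      hcp.symm hctp hsp.symm h1 h2.symm ?_ ?_
    · intro w hw
      have := hNa w hw
      clear * - this
      tauto
    · intro w hw
      have := hNp w hw
      clear * - this
      tauto
  · exact h.symm.s_ne_s hc hb.1 hcb (h2.trans h1)

theorem exists_common_s_t (h : NonExtSystem G C x s t) {p : V} (hp : p ∈ attached G C x) :
    ∃ a ∈ attached G C x, G.Adj a p ∧ G.Adj a (s p) ∧ G.Adj a (t p) := by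
  by_contra! hno
  obtain ⟨a, ha, hap, hasp⟩ := h.exists_common_s hp
  obtain ⟨b, hb, hbp, hbtp⟩ := h.exists_common_t hp
  have hatp := hno a ha hap hasp
  have hbsp : ¬G.Adj b (s p) := fun e ↦ hno b hb hbp e hbtp
  have irr : ∀ u, ¬G.Adj u u := fun u ↦ G.irrefl
  have Fp := h.attached_facts hp
  have Fa := h.attached_facts ha
  have Fb := h.attached_facts hb
  have np := h.not_adj_s_t hp
  have na := h.not_adj_s_t ha
  have hab : a ≠ b := by rintro rfl; exact hatp hbtp
  have Fpa := h.pair_facts hp ha hap.ne'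
  have Fpb := h.pair_facts hp hb hbp.ne'
  have Fab := h.pair_facts ha hb hab
  obtain ⟨c, hcp, hc1, hctp⟩ := h.diam_le p (s p) (t p) Fp.1 Fp.2.1 Fp.2.2.2.2.2.1 np
  have hcx : c ∉ attached G C x := fun e ↦ hno c e hcp.symm hc1.symm hctp
  have hc : c ∈ C := by
    by_contra hcC
    exact h.insert_s c hcC p hp.1 hcp.symm hc1.symm
  have hxc : ¬G.Adj x c := fun e ↦ hcx ⟨hc, e⟩
  have hxc' : x ≠ c := fun e ↦ h.not_mem (e ▸ hc)
  have hNp := h.eq_of_adj (v := p) hp.2.symm Fp.1 Fp.2.1 hap.symm hbp.symm hcp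
    (by simp; and_intros <;> grind [SimpleGraph.adj_comm])
  obtain ⟨z, hz, hz1, hz2⟩ := h.diam_le p x c hp.2.symm hcp hxc' hxc
  have := hNp z hz
  have : z = a ∨ z = b := by grind
  rcases this with rfl | rfl
  · exact h.not_adj_of_chord hp ha hb hap hasp hatp hbp hbsp hbtp hc hcx hcp hc1 hctp hNp hz2.symm
  · refine h.symm.not_adj_of_chord hp hb ha hbp hbtp hbsp hap hatp hasp hc hcx hcp hctp.symm
      hc1.symm ?_ hz2.symm
    intro w hw
    have := hNp w hw
    clear * - this
    tauto

theorem s_eq_t_or_t_eq_s (h : NonExtSystem G C x s t) {p a : V} (hp : p ∈ attached G C x)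
    (ha : a ∈ attached G C x) (hap : G.Adj a p) (hasp : G.Adj a (s p)) (hatp : G.Adj a (t p)) :
    s p = t a ∨ t p = s a := by
  by_contra! hne
  have irr : ∀ u, ¬G.Adj u u := fun u ↦ G.irrefl
  have Fp := h.attached_facts hp
  have Fa := h.attached_facts ha
  have Fpa := h.pair_facts hp ha hap.ne'
  have hNa := h.eq_of_adj (v := a) ha.2.symm Fa.1 Fa.2.1 hap hasp hatp
    (by simp; and_intros <;> grind [SimpleGraph.adj_comm])
  obtain ⟨q, hq, hqa, hqsa, hqta⟩ := h.exists_common_s_t ha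
  have Fq := h.attached_facts hq
  have hqp : q = p := by
    have := hNa q hqa.symm
    grind [SimpleGraph.adj_comm]
  subst hqp
  have hNp := h.eq_of_adj (v := q) hp.2.symm Fp.1 Fp.2.1 hqa hqsa hqta
    (by simp; and_intros <;> grind [SimpleGraph.adj_comm])
  obtain ⟨w, hw, hwp, hwa, hor⟩ := h.exists_third_adj (a := a) hp.2
  have := hNp w
  have := hNa w
  grind [SimpleGraph.adj_comm]

/-- The configuration of three attached vertices spaced at distance two around a six-cycle. -/
theorem not_six_cycle (h : NonExtSystem G C x s t) {p a y : V} (hp : p ∈ attached G C x)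
    (ha : a ∈ attached G C x) (hy : y ∈ attached G C x) (hpa : p ≠ a) (hpy : p ≠ y) (hay : a ≠ y)
    (h1 : s p = t a) (h2 : s a = t y) (h3 : s y = t p) (hap : G.Adj a p) (hyp : G.Adj y p)
    (hysp : G.Adj y (s p)) (hatp : G.Adj a (t p)) (hpsa : G.Adj p (s a))
    (hNp : ∀ w, G.Adj p w → w = x ∨ w = s p ∨ w = t p ∨ w = a ∨ w = s a ∨ w = y) : False := by
  have irr : ∀ u, ¬G.Adj u u := fun u ↦ G.irrefl
  have Fp := h.attached_facts hp
  have Fa := h.attached_facts ha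
  have Fy := h.attached_facts hy
  have Fpa := h.pair_facts hp ha hpa
  have Fpy := h.pair_facts hp hy hpy
  have Fay := h.pair_facts ha hy hay
  have six : ∀ u ∈ C, u = p ∨ u = s p ∨ u = a ∨ u = s a ∨ u = y ∨ u = s y := by
    refine h.orbit _ ⟨p, hp.1, .inl rfl⟩ fun u _ hP ↦ ?_
    have e1 : s (s p) = a := by rw [h1, h.s_t a ha.1]
    have e2 : s (s a) = y := by rw [h2, h.s_t y hy.1]
    have e3 : s (s y) = p := by rw [h3, h.s_t p hp.1]
    rcases hP with rfl | rfl | rfl | rfl | rfl | rfl <;> simp [e1, e2, e3]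
  obtain ⟨u, v, hup, hpu, hpv, hvu⟩ := h.exists_far p
  have huC : u ∉ C := fun e ↦ by
    have := six u e
    grind [SimpleGraph.adj_comm]
  obtain ⟨z, hz, hz1, hz2⟩ := h.diam_le v p u hpv.symm hvu hup.symm hpu
  have hor : G.Adj a u ∨ G.Adj y u := by
    have := hNp v hpv
    have := hNp z hz1
    have := h.not_adj_s_t hp
    clear six hNp
    grind [SimpleGraph.adj_comm]
  have nC : ∀ w ∈ C, u ≠ w := fun w hw e ↦ huC (e ▸ hw)
  have hux : u ≠ x := fun e ↦ hpu (e ▸ hp.2.symm)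
  have := nC p hp.1
  have := nC _ (h.s_mem p hp.1)
  have := nC _ (h.t_mem p hp.1)
  have := nC _ (h.s_mem a ha.1)
  have np := h.not_adj_s_t hp
  rcases hor with e | e
  · have i1 := h.insert_s u huC a ha.1 e.symm
    have i2 := h.insert_t u huC a ha.1 e.symm
    have na := h.not_adj_s_t ha
    have hNa := h.eq_of_adj (v := a) ha.2.symm Fa.1 Fa.2.1 hap hatp e
      (by clear six hNp; simp; and_intros <;> grind [SimpleGraph.adj_comm])
    obtain ⟨z, hz, hz1, hz2⟩ := h.diam_le a u (t a) e Fa.2.1 (by grind) i2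
    have := hNa z hz
    clear six hNp hNa
    grind [SimpleGraph.adj_comm]
  · have i1 := h.insert_s u huC y hy.1 e.symm
    have i2 := h.insert_t u huC y hy.1 e.symm
    have hNy := h.eq_of_adj (v := y) hy.2.symm Fy.1 Fy.2.1 hyp hysp e
      (by clear six hNp; simp; and_intros <;> grind [SimpleGraph.adj_comm])
    obtain ⟨z, hz, hz1, hz2⟩ := h.diam_le y u (s y) e Fy.1 (by grind) i1
    have := hNy z hz
    clear six hNp hNy
    grind [SimpleGraph.adj_comm]

theorem not_mutual_of_adj (h : NonExtSystem G C x s t) {p a y : V} (hp : p ∈ attached G C x)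
    (ha : a ∈ attached G C x) (h1 : s p = t a) (hap : G.Adj a p) (hatp : G.Adj a (t p))
    (hpsa : G.Adj p (s a)) (hyp : y ≠ p) (hya : y ≠ a) (hmy : G.Adj (s p) y) :
    ¬G.Adj y p := by
  intro hypa
  have irr : ∀ u, ¬G.Adj u u := fun u ↦ G.irrefl
  have Fp := h.attached_facts hp
  have Fa := h.attached_facts ha
  have Fpa := h.pair_facts hp ha hap.ne'
  have np := h.not_adj_s_t hp
  have na := h.not_adj_s_t ha
  have htp := h.not_four_cycle hp ha hap.ne' h1
  have hNp := h.eq_of_adj (v := p) hp.2.symm Fp.1 Fp.2.1 hap.symm hpsa hypa.symm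
    (by simp; and_intros <;> grind [SimpleGraph.adj_comm])
  have hNa : G.Adj a y → _ := fun e ↦ h.eq_of_adj (v := a) ha.2.symm Fa.1 Fa.2.1 hap hatp e
    (by simp; and_intros <;> grind [SimpleGraph.adj_comm])
  have hy : y ∈ attached G C x := by
    refine ⟨?_, ?_⟩
    · by_contra hyC
      exact h.insert_s y hyC p hp.1 hypa hmy.symm
    by_contra hxy
    obtain ⟨z, hz, hz1, hz2⟩ := h.diam_le p x y hp.2.symm hypa.symm
      (fun e ↦ Fp.2.2.2.1 (e ▸ hmy.symm)) hxy
    obtain ⟨w, hw, hwp, hwa, hor⟩ := h.exists_third_adj (a := a) hp.2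
    have := hNp z
    have hya : G.Adj a y := by
      clear hNa
      grind [SimpleGraph.adj_comm]
    have := hNp w
    have := hNa hya w
    clear hNa hNp
    grind [SimpleGraph.adj_comm]
  have Fy := h.attached_facts hy
  have Fpy := h.pair_facts hp hy hyp.symm
  have Fay := h.pair_facts ha hy hya.symm
  have hpst : ¬(G.Adj p (s y) ∧ G.Adj p (t y)) := by
    rintro ⟨e1, e2⟩
    refine h.not_six_cycle hp ha hy hap.ne' hyp.symm hya.symm h1 ?_ ?_ hap hypa hmy.symm hatp hpsa
      hNp
    · have := hNp _ e2
      clear hNa hNp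
      grind [SimpleGraph.adj_comm]
    · have := hNp _ e1
      clear hNa hNp
      grind [SimpleGraph.adj_comm]
  obtain ⟨q, hq, hqy, hqsy, hqty⟩ := h.exists_common_s_t hy
  have hqp : q ≠ p := by
    rintro rfl
    exact hpst ⟨hqsy, hqty⟩
  have hqa : q ≠ a := by
    rintro rfl
    have hNq := hNa hqy
    refine h.not_six_cycle hp ha hy hap.ne' hyp.symm hya.symm h1 ?_ ?_ hap hypa hmy.symm hatp hpsa
      hNp
    · have := hNq _ hqty
      clear hNa hNp hNq
      grind [SimpleGraph.adj_comm]
    · have := hNq _ hqsy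
      clear hNa hNp hNq
      grind [SimpleGraph.adj_comm]
  clear hNa hNp
  have Fq := h.attached_facts hq
  have Fpq := h.pair_facts hp hq hqp.symm
  have Faq := h.pair_facts ha hq hqa.symm
  have Fyq := h.pair_facts hy hq hqy.ne'
  have hNy := h.eq_of_adj (v := y) hy.2.symm Fy.1 Fy.2.1 hypa hmy.symm hqy.symm
    (by simp; and_intros <;> grind [SimpleGraph.adj_comm])
  have ny := h.not_adj_s_t hy
  have hqm : G.Adj q (s p) := by
    by_contra hqm
    refine hpst ⟨?_, ?_⟩
    · obtain ⟨z, hz, hz1, hz2⟩ := h.diam_le y (s p) (s y) hmy.symm Fy.1 Fpy.1 Fpy.2.2.1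
      have := hNy z hz
      clear hNy
      grind [SimpleGraph.adj_comm]
    · obtain ⟨z, hz, hz1, hz2⟩ := h.diam_le y (s p) (t y) hmy.symm Fy.2.1 (h1 ▸ Fay.2.1)
        (h1 ▸ Fay.2.2.2)
      have := hNy z hz
      clear hNy
      grind [SimpleGraph.adj_comm]
  have hyna : ¬G.Adj y a := fun e ↦ by
    have := hNy a e
    grind [SimpleGraph.adj_comm]
  have hNq : ∀ w, G.Adj q w → w = x ∨ w = s q ∨ w = t q ∨ w = y ∨ w = s p ∨ w = s y ∨ w = t y := by
    intro w hw
    rcases h.s_eq_t_or_t_eq_s hy hq hqy hqsy hqty with e | e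
    · have := h.not_four_cycle hy hq hqy.ne' e
      have := h.eq_of_adj (v := q) hq.2.symm Fq.1 Fq.2.1 hqy hqm hqty
        (by clear hNy; simp; and_intros <;> grind [SimpleGraph.adj_comm]) w hw
      clear * - this
      tauto
    · have := h.symm.not_four_cycle hy hq hqy.ne' e
      have := h.eq_of_adj (v := q) hq.2.symm Fq.1 Fq.2.1 hqy hqm hqsy
        (by clear hNy; simp; and_intros <;> grind [SimpleGraph.adj_comm]) w hw
      clear * - this
      tauto
  obtain ⟨z, hz, hz1, hz2⟩ := h.diam_le x q a hq.2 ha.2 hqa (fun e ↦ by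
    have := hNq a e
    clear hNq hNy
    grind [SimpleGraph.adj_comm])
  have := hNq z hz1
  clear hNq hNy
  grind [SimpleGraph.adj_comm]

theorem not_mutual (h : NonExtSystem G C x s t) {p a : V} (hp : p ∈ attached G C x)
    (ha : a ∈ attached G C x) (h1 : s p = t a) (hap : G.Adj a p) (hatp : G.Adj a (t p)) :
    ¬G.Adj p (s a) := by
  intro hpsa
  obtain ⟨w, hw, hwp, hwa, hor | hor⟩ :=
    h.exists_third_adj (a := a) (h.attached_facts hp).1.symm
  · exact h.not_mutual_of_adj hp ha h1 hap hatp hpsa hwp hwa hw hor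
  · exact h.symm.not_mutual_of_adj ha hp h1.symm hap.symm hpsa hatp hwa hwp (h1 ▸ hw) hor

theorem not_exists_s_eq_t (h : NonExtSystem G C x s t) {p a : V} (hp : p ∈ attached G C x)
    (ha : a ∈ attached G C x) (hap : G.Adj a p) (hatp : G.Adj a (t p)) : s p ≠ t a := by
  intro h1
  have irr : ∀ u, ¬G.Adj u u := fun u ↦ G.irrefl
  have hpsa := h.not_mutual hp ha h1 hap hatp
  obtain ⟨z, hz, hza, hzsa, hzta⟩ := h.exists_common_s_t ha
  have hzp : z ≠ p := by
    rintro rfl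
    exact hpsa hzsa
  have Fp := h.attached_facts hp
  have Fa := h.attached_facts ha
  have Fz := h.attached_facts hz
  have Fpa := h.pair_facts hp ha hap.ne'
  have Fpz := h.pair_facts hp hz hzp.symm
  have Faz := h.pair_facts ha hz hza.ne'
  have htp := h.not_four_cycle hp ha hap.ne' h1
  have np := h.not_adj_s_t hp
  have na := h.not_adj_s_t ha
  have nz := h.not_adj_s_t hz
  have h2 : s a = t z := by
    rcases h.s_eq_t_or_t_eq_s ha hz hza hzsa hzta with e | e
    · exact e
    · exact absurd (h1.trans e) Fpz.1
  have hNa := h.eq_of_adj (v := a) ha.2.symm Fa.1 Fa.2.1 hap hatp hza.symm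
    (by simp; and_intros <;> grind [SimpleGraph.adj_comm])
  obtain ⟨w, hw, hwz, hwsz, hwtz⟩ := h.exists_common_s_t hz
  have hwa : w ≠ a := by
    rintro rfl
    exact h.not_mutual ha hz h2 hza hzta hwsz
  have Fw := h.attached_facts hw
  have hNz := h.eq_of_adj (v := z) hz.2.symm Fz.1 Fz.2.1 hza hzta hwz.symm
    (by clear hNa; simp; and_intros <;> grind [SimpleGraph.adj_comm])
  have h3 : t p = s z := by
    obtain ⟨y, hy, hy1, hy2⟩ := h.diam_le a (t p) (s a) hatp Fa.1 htp (h2 ▸ Fpz.2.2.2)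
    have := hNa y hy
    have := hNz (t p)
    clear hNa hNz
    grind [SimpleGraph.adj_comm]
  rcases h.s_eq_t_or_t_eq_s hz hw hwz hwsz hwtz with e | e
  · have hpw : p = w := by
      by_contra hne
      exact (h.pair_facts hp hw hne).2.1 (h3.trans e)
    exact hpsa (hpw ▸ h2 ▸ hwtz)
  · exact (h.pair_facts ha hw hwa.symm).1 (h2.trans e)

/-- There is no attached vertex. -/
theorem attached_eq_empty (h : NonExtSystem G C x s t) : attached G C x = ∅ := by
  refine Set.eq_empty_of_forall_notMem fun p hp ↦ ?_
  obtain ⟨a, ha, hap, hasp, hatp⟩ := h.exists_common_s_t hp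
  rcases h.s_eq_t_or_t_eq_s hp ha hap hasp hatp with e | e
  · exact h.not_exists_s_eq_t hp ha hap hatp e
  · exact h.symm.not_exists_s_eq_t hp ha hap hasp e

end NonExtSystem

/-- There is a path from `u` to `v` whose vertex set is exactly `S`. -/
def HasPathOn {V : Type*} (G : SimpleGraph V) (u v : V) (S : Set V) : Prop :=
  ∃ w : G.Walk u v, w.IsPath ∧ {z | z ∈ w.support} = S

namespace HasPathOn
variable {V : Type*} {G : SimpleGraph V} {u v u' v' : V} {S T : Set V}

theorem singleton (u : V) : HasPathOn G u u {u} := ⟨.nil, by simp, by simp⟩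

theorem symm (h : HasPathOn G u v S) : HasPathOn G v u S := by
  obtain ⟨w, hw, rfl⟩ := h
  exact ⟨w.reverse, hw.reverse, by simp⟩

theorem append (h : HasPathOn G u v S) (h' : HasPathOn G u' v' T) (hadj : G.Adj v u')
    (hd : Disjoint S T) : HasPathOn G u v' (S ∪ T) := by
  obtain ⟨w, hw, rfl⟩ := h
  obtain ⟨w', hw', rfl⟩ := h'
  refine ⟨w.append (.cons hadj w'), ?_, ?_⟩
  · rw [Walk.isPath_def, Walk.support_append, Walk.support_cons, List.tail_cons]
    exact hw.support_nodup.append hw'.support_nodup (Set.disjoint_left.1 hd)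
  · ext z
    simp [Walk.support_append]

theorem hasCycleOn (h : HasPathOn G u v S) (hadj : G.Adj v u) (hS : ∃ z ∈ S, z ≠ u ∧ z ≠ v) :
    HasCycleOn G S := by
  obtain ⟨w, hw, rfl⟩ := h
  obtain ⟨z, hz, hzu, hzv⟩ := hS
  refine ⟨v, .cons hadj w, ?_, ?_⟩
  · rw [Walk.cons_isCycle_iff]
    refine ⟨hw, fun he ↦ ?_⟩
    cases w with
    | nil => simp at he
    | cons hb q =>
      rw [Walk.cons_isPath_iff] at hw
      rw [Walk.edges_cons, List.mem_cons] at he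
      rcases he with he | he
      · rw [Sym2.eq_swap, Sym2.congr_right] at he
        subst he
        obtain rfl := Walk.eq_nil_iff_nil.2 (Walk.isPath_iff_nil.1 hw.1)
        simp_all
      · exact hw.2 (q.snd_mem_support_of_mem_edges he)
  · ext z
    simp only [Walk.support_cons, List.mem_cons, Set.mem_ofPred_eq, or_iff_right_iff_imp]
    rintro rfl
    exact w.end_mem_support

end HasPathOn

/-- A closed enumeration of the vertices of a cycle of length `n`, indexed by the integers. -/
structure IsRing_s14 {V : Type*} (G : SimpleGraph V) (n : ℤ) (g : ℤ → V) : Prop where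
  three_le : 3 ≤ n
  eq_iff : ∀ i j, g i = g j ↔ n ∣ i - j
  adj : ∀ i, G.Adj (g i) (g (i + 1))

namespace IsRing_s14
variable {V : Type*} {G : SimpleGraph V} {n : ℤ} {g : ℤ → V} {x : V} {s t : V → V}

theorem neg (r : IsRing_s14 G n g) : IsRing_s14 G n (fun i ↦ g (-i)) where
  three_le := r.three_le
  eq_iff i j := by
    rw [r.eq_iff, ← dvd_neg]
    ring_nf
  adj i := by
    have := r.adj (-(i + 1))
    simpa using this.symm

theorem add_period (r : IsRing_s14 G n g) (i : ℤ) : g (i + n) = g i := by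
  rw [r.eq_iff]
  simp

theorem disjoint_image_Icc (r : IsRing_s14 G n g) {a b c d : ℤ} (hbc : b < c) (hd : d < a + n) :
    Disjoint (g '' Set.Icc a b) (g '' Set.Icc c d) := by
  rw [Set.disjoint_left]
  rintro _ ⟨i, ⟨h1, h2⟩, rfl⟩ ⟨j, ⟨h3, h4⟩, h5⟩
  have := Int.le_of_dvd (by omega) ((r.eq_iff _ _).1 h5)
  omega

theorem hasPathOn_Icc (r : IsRing_s14 G n g) {i j : ℤ} (hij : i ≤ j) (hj : j < i + n) :
    HasPathOn G (g i) (g j) (g '' Set.Icc i j) := by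
  induction j, hij using Int.leInduction with
  | base => simpa using .singleton (g i)
  | succ j hij ih =>
    have := (ih (by omega)).append (.singleton _) (r.adj j) ?_
    · convert this using 1
      rw [← Set.image_singleton, ← Set.image_union]
      congr 1
      ext k
      simp
      omega
    · simpa using r.disjoint_image_Icc (a := i) (b := j) (c := j + 1) (d := j + 1) (by omega)
        (by omega)

theorem image_Icc_union {a b c d : ℤ} (hc : c = b + 1) (hab : a ≤ c) (hbd : b ≤ d) :
    g '' Set.Icc a b ∪ g '' Set.Icc c d = g '' Set.Icc a d := by
  rw [← Set.image_union]
  congr 1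
  ext k
  simp only [Set.mem_union, Set.mem_Icc]
  omega

theorem exists_eq_mem_Ico (r : IsRing_s14 G n g) (i j : ℤ) :
    ∃ k, i ≤ k ∧ k < i + n ∧ ∀ d, g (k + d) = g (j + d) := by
  have h3 := r.three_le
  refine ⟨i + (j - i) % n, ?_, ?_, fun d ↦ ?_⟩
  · have := Int.emod_nonneg (j - i) (by omega : n ≠ 0)
    omega
  · have := Int.emod_lt_of_pos (j - i) (by omega : 0 < n)
    omega
  · rw [r.eq_iff]
    refine ⟨-((j - i) / n), ?_⟩
    have := Int.emod_add_mul_ediv (j - i) n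
    linarith

theorem image_Icc_eq_range (r : IsRing_s14 G n g) {i k : ℤ} (hk : k = i + n - 1) :
    g '' Set.Icc i k = Set.range g := by
  refine Set.Subset.antisymm (Set.image_subset_range _ _) ?_
  rintro _ ⟨j, rfl⟩
  obtain ⟨l, h1, h2, h3⟩ := r.exists_eq_mem_Ico i j
  exact ⟨l, ⟨h1, by omega⟩, by simpa using h3 0⟩

theorem exists_mem_range_ne (r : IsRing_s14 G n g) (u v : V) : ∃ z ∈ Set.range g, z ≠ u ∧ z ≠ v := by
  have h3 := r.three_le
  have h (a b : ℤ) (h0 : a < b) (h1 : b < a + n) : g b ≠ g a := fun e ↦ by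
    have := Int.le_of_dvd (by omega) ((r.eq_iff _ _).1 e)
    omega
  have h01 := h 0 1 (by omega) (by omega)
  have h02 := h 0 2 (by omega) (by omega)
  have h12 := h 1 2 (by omega) (by omega)
  by_contra! hc
  have c0 := hc (g 0) ⟨_, rfl⟩
  have c1 := hc (g 1) ⟨_, rfl⟩
  have c2 := hc (g 2) ⟨_, rfl⟩
  by_cases e0 : g 0 = u <;> by_cases e1 : g 1 = u <;> simp_all

theorem not_adj_insert (r : IsRing_s14 G n g) (hx : x ∉ Set.range g)
    (hne : ¬HasCycleOn G (insert x (Set.range g))) {i : ℤ} (h1 : G.Adj x (g i)) :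
    ¬G.Adj x (g (i + 1)) := by
  intro h2
  have h3 := r.three_le
  have p := (HasPathOn.singleton x).append (r.hasPathOn_Icc (i := i + 1) (j := i + n) (by omega)
    (by omega)) h2 (by
      rw [Set.disjoint_singleton_left]
      exact fun e ↦ hx (Set.image_subset_range _ _ e))
  rw [r.image_Icc_eq_range (by ring), Set.singleton_union, r.add_period] at p
  obtain ⟨z, hz, hzi, -⟩ := r.exists_mem_range_ne (g i) x
  exact hne (p.hasCycleOn h1.symm ⟨z, .inr hz, fun e ↦ hx (e ▸ hz), hzi⟩)

theorem not_adj_cross (r : IsRing_s14 G n g) (hx : x ∉ Set.range g)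
    (hne : ¬HasCycleOn G (insert x (Set.range g))) {i j : ℤ} (hij : g i ≠ g j)
    (h1 : G.Adj x (g i)) (h2 : G.Adj x (g j)) : ¬G.Adj (g (i + 1)) (g (j + 1)) := by
  intro h3
  obtain ⟨k, hk1, hk2, hk⟩ := r.exists_eq_mem_Ico i j
  have hk0 : g k = g j := by simpa using hk 0
  have hik : i ≠ k := by rintro rfl; exact hij hk0
  have h4 := r.three_le
  have p := ((r.hasPathOn_Icc (i := i + 1) (j := k) (by omega) (by omega)).append
    (.singleton x) (hk0 ▸ h2.symm) (by
      rw [Set.disjoint_singleton_right]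
      exact fun e ↦ hx (Set.image_subset_range _ _ e))).append
    (r.hasPathOn_Icc (i := k + 1) (j := i + n) (by omega) (by omega)).symm
    (by rwa [r.add_period]) (by
      rw [Set.disjoint_union_left, Set.disjoint_singleton_left]
      exact ⟨r.disjoint_image_Icc (by omega) (by omega),
        fun e ↦ hx (Set.image_subset_range _ _ e)⟩)
  rw [Set.union_right_comm, image_Icc_union rfl (by omega) (by omega),
    r.image_Icc_eq_range (by ring), Set.union_singleton, hk] at p
  exact hne (p.hasCycleOn h3.symm ⟨x, .inl rfl, fun e ↦ hx ⟨_, e.symm⟩, fun e ↦ hx ⟨_, e.symm⟩⟩)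

theorem not_adj_skip (r : IsRing_s14 G n g) (hx : x ∉ Set.range g)
    (hne : ¬HasCycleOn G (insert x (Set.range g))) {i j : ℤ} (hij : g i ≠ g j)
    (h1 : G.Adj x (g i)) (h2 : G.Adj x (g j)) (h3 : G.Adj (g (i + 1)) (g (i - 1))) :
    ¬G.Adj (g i) (g (j + 1)) := by
  intro h5
  obtain ⟨k, hk1, hk2, hk⟩ := r.exists_eq_mem_Ico i j
  have hk0 : g k = g j := by simpa using hk 0
  have hik : i ≠ k := by rintro rfl; exact hij hk0
  have hn : g (i + n - 1) = g (i - 1) := by rw [← r.add_period (i - 1)]; ring_nf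
  have hkn : k ≠ i + n - 1 := by
    rintro rfl
    rw [← hk, sub_add_cancel, r.add_period] at h5
    exact G.irrefl h5
  have h4 := r.three_le
  have hu : g '' Set.Icc (i + n) (i + n) ∪ g '' Set.Icc (k + 1) (i + n - 1) =
      g '' Set.Icc (k + 1) (i + n) := by
    rw [Set.union_comm, image_Icc_union (by ring) (by omega) (by omega)]
  have p := ((r.hasPathOn_Icc (i := i + 1) (j := k) (by omega) (by omega)).append
    (.singleton x) (hk0 ▸ h2.symm) (by
      rw [Set.disjoint_singleton_right]
      exact fun e ↦ hx (Set.image_subset_range _ _ e))).append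
    ((r.hasPathOn_Icc (i := i + n) (j := i + n) le_rfl (by omega)).append
    (r.hasPathOn_Icc (i := k + 1) (j := i + n - 1) (by omega) (by omega))
    (by rwa [r.add_period, hk]) (r.disjoint_image_Icc (by omega) (by omega)).symm)
    (by rwa [r.add_period]) (by
      rw [hu, Set.disjoint_union_left, Set.disjoint_singleton_left]
      exact ⟨r.disjoint_image_Icc (by omega) (by omega),
        fun e ↦ hx (Set.image_subset_range _ _ e)⟩)
  rw [hu, Set.union_right_comm, image_Icc_union rfl (by omega) (by omega),
    r.image_Icc_eq_range (by ring), Set.union_singleton, hn] at p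
  exact hne (p.hasCycleOn h3.symm ⟨x, .inl rfl, fun e ↦ hx ⟨_, e.symm⟩, fun e ↦ hx ⟨_, e.symm⟩⟩)

theorem not_adj_swap (r : IsRing_s14 G n g) (hx : x ∉ Set.range g)
    (hne : ¬HasCycleOn G (insert x (Set.range g))) {i j : ℤ} (hij : g j ≠ g i)
    (hij' : g j ≠ g (i - 1)) (h1 : G.Adj x (g (i + 1))) (h2 : G.Adj x (g (i - 1)))
    (h3 : G.Adj (g i) (g j)) : ¬G.Adj (g i) (g (j + 1)) := by
  intro h5
  obtain ⟨k, hk1, hk2, hk⟩ := r.exists_eq_mem_Ico i j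
  have hk0 : g k = g j := by simpa using hk 0
  have hik : i ≠ k := by rintro rfl; exact hij hk0.symm
  have hn : g (i + n - 1) = g (i - 1) := by rw [← r.add_period (i - 1)]; ring_nf
  have hkn : k ≠ i + n - 1 := by
    rintro rfl
    exact hij' (hk0.symm.trans hn)
  have h4 := r.three_le
  have hxi (a b : ℤ) : Disjoint {x} (g '' Set.Icc a b) := by
    rw [Set.disjoint_singleton_left]
    exact fun e ↦ hx (Set.image_subset_range _ _ e)
  have p := (((r.hasPathOn_Icc (i := i) (j := i) le_rfl (by omega)).append
    (r.hasPathOn_Icc (i := i + 1) (j := k) (by omega) (by omega)).symm (hk0 ▸ h3)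
    (r.disjoint_image_Icc (by omega) (by omega))).append (.singleton x) h1.symm (by
      rw [image_Icc_union rfl (by omega) (by omega)]
      exact (hxi _ _).symm)).append
    (r.hasPathOn_Icc (i := k + 1) (j := i + n - 1) (by omega) (by omega)).symm (hn ▸ h2) (by
      rw [image_Icc_union rfl (by omega) (by omega), Set.disjoint_union_left]
      exact ⟨r.disjoint_image_Icc (by omega) (by omega), hxi _ _⟩)
  rw [Set.union_right_comm, image_Icc_union rfl (by omega) (by omega),
    image_Icc_union rfl (by omega) (by omega), r.image_Icc_eq_range (by ring), Set.union_singleton,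
    hk] at p
  exact hne (p.hasCycleOn h5.symm ⟨x, .inl rfl, fun e ↦ hx ⟨_, e.symm⟩, fun e ↦ hx ⟨_, e.symm⟩⟩)

theorem range_neg (g : ℤ → V) : Set.range (fun i ↦ g (-i)) = Set.range g :=
  (Equiv.neg ℤ).surjective.range_comp g

theorem nonExtSystem (r : IsRing_s14 G n g) (hs : ∀ i, s (g i) = g (i + 1))
    (ht : ∀ i, t (g i) = g (i - 1)) (hx : x ∉ Set.range g)
    (hne : ∀ y ∉ Set.range g, ¬HasCycleOn G (insert y (Set.range g)))
    (deg_le : ∀ v (l : List V), (∀ u ∈ l, G.Adj v u) → l.Nodup → l.length ≤ 6)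
    (diam_le : ∀ v u w, G.Adj v u → G.Adj v w → u ≠ w → ¬G.Adj u w →
      ∃ z, G.Adj v z ∧ G.Adj u z ∧ G.Adj z w)
    (exists_third : ∀ v p a, ∃ w, G.Adj v w ∧ w ≠ p ∧ w ≠ a)
    (exists_far : ∀ p, ∃ u t, u ≠ p ∧ ¬G.Adj p u ∧ G.Adj p t ∧ G.Adj t u) :
    NonExtSystem G (Set.range g) x s t := by
  have hx' := range_neg g ▸ hx
  have hne' := fun y hy ↦ range_neg g ▸ hne y hy
  have hg (i : ℤ) : g i = g (-(-i)) := by rw [neg_neg]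
  have hgt (i : ℤ) : t (g i) = g (-(-i + 1)) := by rw [ht]; ring_nf
  refine ⟨hx, ?_, ?_, ?_, ?_, ?_, ?_, ?_, ?_, ?_, ?_, ?_, ?_, ?_, ?_, ?_, ?_, deg_le, diam_le,
    exists_third, exists_far⟩
  · rintro _ ⟨i, rfl⟩
    exact ⟨_, (hs i).symm⟩
  · rintro _ ⟨i, rfl⟩
    exact ⟨_, (ht i).symm⟩
  · rintro _ ⟨i, rfl⟩
    rw [ht, hs, sub_add_cancel]
  · rintro _ ⟨i, rfl⟩
    rw [hs, ht, add_sub_cancel_right]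
  · rintro _ ⟨i, rfl⟩
    exact hs i ▸ r.adj i
  · rintro _ ⟨i, rfl⟩
    have := r.adj (i - 1)
    rw [sub_add_cancel] at this
    exact ht i ▸ this.symm
  · rintro _ ⟨i, rfl⟩ e
    rw [hs, ht, r.eq_iff] at e
    have := Int.le_of_dvd (by omega) e
    have := r.three_le
    omega
  · rintro P ⟨_, ⟨i, rfl⟩, hi⟩ hP _ ⟨j, rfl⟩
    obtain ⟨k, hk, -, hk'⟩ := r.exists_eq_mem_Ico i j
    rw [← add_zero j, ← hk', add_zero]
    clear hk'
    induction k, hk using Int.leInduction with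
    | base => exact hi
    | succ k _ ih => exact hs k ▸ hP _ ⟨k, rfl⟩ ih
  · rintro y hy _ ⟨i, rfl⟩ h1
    rw [hs]
    exact r.not_adj_insert hy (hne y hy) h1
  · rintro y hy _ ⟨i, rfl⟩ h1
    rw [hgt]
    rw [hg] at h1
    exact r.neg.not_adj_insert (range_neg g ▸ hy) (hne' y hy) h1
  · rintro _ ⟨i, rfl⟩ _ ⟨j, rfl⟩ hn h1 h2
    rw [hs, hs]
    exact r.not_adj_cross hx (hne x hx) hn h1 h2
  · rintro _ ⟨i, rfl⟩ _ ⟨j, rfl⟩ hn h1 h2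
    rw [hgt, hgt]
    rw [hg] at h1 h2
    rw [hg i, hg j] at hn
    exact r.neg.not_adj_cross hx' (hne' x hx) hn h1 h2
  · rintro _ ⟨i, rfl⟩ _ ⟨j, rfl⟩ hn h1 h2 h3
    rw [hs]
    rw [hs, ht] at h3
    exact r.not_adj_skip hx (hne x hx) hn h1 h2 h3
  · rintro _ ⟨i, rfl⟩ _ ⟨j, rfl⟩ hn h1 h2 h3
    rw [hgt, hg i]
    rw [hg] at h1 h2
    rw [hg i, hg j] at hn
    refine r.neg.not_adj_skip hx' (hne' x hx) hn h1 h2 ?_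
    rw [hs, hgt] at h3
    convert h3.symm using 2
    ring
  · rintro _ ⟨i, rfl⟩ _ ⟨j, rfl⟩ hn hn' h1 h2 h3
    rw [hs]
    rw [hs] at h1
    rw [ht] at h2 hn'
    exact r.not_adj_swap hx (hne x hx) hn hn' h1 h2 h3
  · rintro _ ⟨i, rfl⟩ _ ⟨j, rfl⟩ hn hn' h1 h2 h3
    have e : s (g i) = g (-(-i - 1)) := by rw [hs]; ring_nf
    rw [hgt, hg i]
    rw [e] at h1 hn'
    rw [hgt] at h2
    rw [hg i, hg j] at h3 hn
    rw [hg j] at hn'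
    exact r.neg.not_adj_swap hx' (hne' x hx) hn hn' h2 h1 h3

theorem exists_isRing {a : V} {c : G.Walk a a} (hc : c.IsCycle) :
    ∃ (n : ℤ) (g : ℤ → V), IsRing_s14 G n g ∧ Set.range g = {v | v ∈ c.support} := by
  have h3 := hc.three_le_length
  have hmod (i : ℤ) : ∃ m : ℕ, m < c.length ∧ i % c.length = m := by
    have h1 := Int.emod_nonneg i (by omega : (c.length : ℤ) ≠ 0)
    have h2 := Int.emod_lt_of_pos i (by omega : (0 : ℤ) < c.length)
    exact ⟨(i % c.length).toNat, by omega, by omega⟩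
  refine ⟨c.length, fun i ↦ c.getVert (i % c.length).toNat, ⟨by omega, fun i j ↦ ?_, fun i ↦ ?_⟩,
    ?_⟩
  · rw [Int.dvd_iff_emod_eq_zero, ← Int.emod_eq_emod_iff_emod_sub_eq_zero]
    obtain ⟨m, hm, hi⟩ := hmod i
    obtain ⟨k, hk, hj⟩ := hmod j
    simp only [hi, hj, Int.toNat_natCast, Nat.cast_inj]
    refine ⟨fun e ↦ hc.getVert_injOn' ?_ ?_ e, fun e ↦ e ▸ rfl⟩ <;>
      rw [Set.mem_ofPred_eq] <;> omega
  · obtain ⟨m, hm, hi⟩ := hmod i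
    have h1 : (i + 1) % c.length = if m + 1 = c.length then 0 else ((m + 1 : ℕ) : ℤ) := by
      rw [← Int.emod_add_emod, hi]
      split_ifs with h
      · norm_cast
        simp [h]
      · norm_cast
        exact Nat.mod_eq_of_lt (by omega)
    have h2 := c.adj_getVert_succ hm
    simp only [h1, hi]
    split_ifs with h
    · simpa [h] using h2
    · simpa using h2
  · ext v
    rw [Set.mem_ofPred_eq, Walk.mem_support_iff_exists_getVert]
    constructor
    · rintro ⟨i, rfl⟩
      obtain ⟨m, hm, hi⟩ := hmod i
      exact ⟨m, by simp [hi], hm.le⟩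
    · rintro ⟨m, rfl, hm⟩
      rcases hm.lt_or_eq with hm | rfl
      · refine ⟨m, ?_⟩
        simp only
        rw [Int.emod_eq_of_lt (by omega) (by omega), Int.toNat_natCast]
      · exact ⟨0, by simp⟩

end IsRing_s14

section
variable {V : Type*} {G : SimpleGraph V}

theorem LocallyIsometric.exists_common_adj (hli : LocallyIsometric G) {v u w : V}
    (hu : G.Adj v u) (hw : G.Adj v w) (hne : u ≠ w) (huw : ¬G.Adj u w) :
    ∃ z, G.Adj v z ∧ G.Adj u z ∧ G.Adj z w := by
  set H := G.induce (G.neighborSet v)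
  have hd : H.edist ⟨u, hu⟩ ⟨w, hw⟩ ≤ 2 := edist_le_ediam.trans (hli v)
  obtain ⟨p, hp⟩ := exists_walk_of_edist_ne_top (ne_top_of_le_ne_top (by simp) hd)
  rw [← hp] at hd
  have hl : p.length ≤ 2 := by exact_mod_cast hd
  cases p with
  | nil => exact absurd rfl hne
  | cons h1 p =>
    cases p with
    | nil => exact absurd h1 huw
    | @cons _ z _ h2 p =>
      cases p with
      | nil => exact ⟨_, Subtype.property _, h1, h2⟩
      | cons h3 p => simp at hl

theorem SimpleGraph.Connected.exists_adj_of_mem_notMem (hconn : G.Connected) {S : Set V} {u v : V}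
    (hu : u ∈ S) (hv : v ∉ S) : ∃ a ∈ S, ∃ b ∉ S, G.Adj a b := by
  obtain ⟨w⟩ := hconn u v
  obtain ⟨d, -, h1, h2⟩ := w.exists_boundary_dart S hu hv
  exact ⟨_, h1, _, h2, d.adj⟩

variable [Fintype V] [DecidableEq V] [DecidableRel G.Adj]

theorem LocallyIsometric.two_le_degree (hli : LocallyIsometric G) (hconn : G.Connected)
    (hn : 3 ≤ Fintype.card V) (v : V) : 2 ≤ G.degree v := by
  by_contra! hlt
  have : Nontrivial V := Fintype.one_lt_card_iff_nontrivial.1 (by omega)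
  have h1 : G.degree v = 1 := by
    have := hconn.preconnected.degree_pos_of_nontrivial v
    omega
  obtain ⟨u, hu, huniq⟩ := G.degree_eq_one_iff_existsUnique_adj.1 h1
  obtain ⟨y, hy⟩ : ∃ y, y ∉ ({v, u} : Finset V) := by
    by_contra! hall
    have := Finset.card_le_card (fun y _ ↦ hall y : (Finset.univ : Finset V) ⊆ {v, u})
    have := Finset.card_le_two (a := v) (b := u)
    rw [Finset.card_univ] at *
    omega
  obtain ⟨a, ha, b, hb, hab⟩ := hconn.exists_adj_of_mem_notMem
    (S := (({v, u} : Finset V) : Set V)) (u := v) (v := y) (by simp) (by simpa using hy)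
  simp only [Finset.coe_insert, Finset.coe_singleton, Set.mem_insert_iff, Set.mem_singleton_iff,
    not_or] at ha hb
  rcases ha with rfl | rfl
  · exact hb.2 (huniq b hab)
  · have hvb : ¬G.Adj v b := fun e ↦ hb.2 (huniq b e)
    obtain ⟨z, hz, hz1, -⟩ := hli.exists_common_adj hu.symm hab (Ne.symm hb.1) hvb
    exact hz.ne (huniq z hz1).symm

theorem exists_adj_ne_ne_of_three_le_degree {v : V} (h : 3 ≤ G.degree v) (p a : V) :
    ∃ w, G.Adj v w ∧ w ≠ p ∧ w ≠ a := by
  have hlt : ({p, a} : Finset V).card < (G.neighborFinset v).card :=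
    Finset.card_le_two.trans_lt (by rwa [card_neighborFinset_eq_degree])
  obtain ⟨w, hw, hw'⟩ := Finset.exists_mem_notMem_of_card_lt_card hlt
  exact ⟨w, by simpa using hw, by simpa [not_or] using hw'⟩

theorem SimpleGraph.Connected.exists_adj_adj_not_adj (hconn : G.Connected) (p : V)
    (h : G.degree p + 1 < Fintype.card V) :
    ∃ u t, u ≠ p ∧ ¬G.Adj p u ∧ G.Adj p t ∧ G.Adj t u := by
  obtain ⟨y, -, hy⟩ := Finset.exists_mem_notMem_of_card_lt_card
    (s := insert p (G.neighborFinset p)) (t := Finset.univ)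
    ((Finset.card_insert_le _ _).trans_lt (by simpa using h))
  obtain ⟨a, ha, b, hb, hab⟩ := hconn.exists_adj_of_mem_notMem
    (S := ((insert p (G.neighborFinset p) : Finset V) : Set V)) (u := p) (v := y) (by simp)
    (by simpa using hy)
  simp only [Finset.coe_insert, Set.mem_insert_iff, Finset.mem_coe, mem_neighborFinset,
    not_or] at ha hb
  rcases ha with rfl | ha
  · exact absurd hab hb.2
  · exact ⟨b, a, hb.1, hb.2, ha, hab⟩

theorem SimpleGraph.length_le_maxDegree {v : V} {l : List V} (h : ∀ u ∈ l, G.Adj v u)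
    (hl : l.Nodup) : l.length ≤ G.maxDegree := by
  rw [← List.toFinset_card_of_nodup hl]
  refine (Finset.card_le_card fun u hu ↦ ?_).trans (G.degree_le_maxDegree v)
  simpa using h u (by simpa using hu)

end

/-- Corollary 2: a connected locally isometric graph of order at least `8` with
maximum degree `6` that is not fully cycle extendable has a vertex of degree `2`. -/
theorem locallyIsometric_maxDegree_six_not_fce_degree_two
    {V : Type*} [Fintype V] [DecidableEq V] (G : SimpleGraph V) [DecidableRel G.Adj]
    (hconn : G.Connected) (hli : LocallyIsometric G)
    (hn : 8 ≤ Fintype.card V) (hmax : G.maxDegree = 6)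
    (hnfce : ¬FullyCycleExtendable G) :
    ∃ v : V, G.degree v = 2 := by
  by_contra! hdeg
  have hdeg3 (v : V) : 3 ≤ G.degree v :=
    (hli.two_le_degree hconn (by omega) v).lt_of_ne (hdeg v).symm
  refine hnfce ⟨fun v ↦ ?_, fun a c hc hham ↦ ?_⟩
  · obtain ⟨u, hu, -, -⟩ := exists_adj_ne_ne_of_three_le_degree (hdeg3 v) v v
    obtain ⟨w, hw, hwu, -⟩ := exists_adj_ne_ne_of_three_le_degree (hdeg3 v) u v
    by_cases huw : G.Adj u w
    · exact ⟨u, w, hu, huw, hw.symm⟩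
    · obtain ⟨z, hz, huz, -⟩ := hli.exists_common_adj hu hw hwu.symm huw
      exact ⟨u, z, hu, huz, hz.symm⟩
  by_contra! hext
  obtain ⟨y, hy⟩ : ∃ y, y ∉ c.support := by
    by_contra! hall
    refine hham (Walk.isHamiltonianCycle_iff_isCycle_and_support_count_tail_eq_one.2
      ⟨hc, fun v ↦ List.count_eq_one_of_mem hc.support_nodup ?_⟩)
    rcases c.mem_support_iff.1 (hall v) with rfl | hv
    · exact c.end_mem_tail_support hc.not_nil
    · exact hv
  obtain ⟨p, hp, x, hx, hpx⟩ := hconn.exists_adj_of_mem_notMem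
    (S := {v | v ∈ c.support}) c.start_mem_support hy
  obtain ⟨n, g, r, hg⟩ := IsRing_s14.exists_isRing hc
  have hinj (f : ℤ → ℤ) (hf : ∀ i j, n ∣ i - j → n ∣ f i - f j) :
      Function.FactorsThrough (g ∘ f) g := fun i j e ↦
    (r.eq_iff _ _).2 (hf i j ((r.eq_iff _ _).1 e))
  have h := r.nonExtSystem (x := x)
    (fun i ↦ (hinj (· + 1) (by simp)).extend_apply id i)
    (fun i ↦ (hinj (· - 1) (by simp)).extend_apply id i) (hg ▸ hx)
    (fun y hy ↦ by rw [hg] at hy ⊢; exact hext y hy)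
    (fun v l h hl ↦ hmax ▸ length_le_maxDegree h hl)
    (fun v u w hu hw h1 h2 ↦ hli.exists_common_adj hu hw h1 h2)
    (fun v p a ↦ exists_adj_ne_ne_of_three_le_degree (hdeg3 v) p a)
    (fun p ↦ hconn.exists_adj_adj_not_adj p (by
      have := G.degree_le_maxDegree p
      omega))
  exact Set.eq_empty_iff_forall_notMem.1 h.attached_eq_empty p ⟨hg ▸ hp, hpx.symm⟩
end

section
/- Every locally isometric graph of order n = 7 with maximum degree Δ(G) = 6 is weakly pancyclic. -/
open SimpleGraph

/-- The set of lengths of cycles of `G`. -/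
def cycleLengths {V : Type*} (G : SimpleGraph V) : Set ℕ :=
  {n | ∃ (a : V) (c : G.Walk a a), c.IsCycle ∧ c.length = n}

/-- `G` is weakly pancyclic: it has a cycle of every length `n` between its girth
and its circumference (vacuously true when `G` has no cycles). -/
def WeaklyPancyclic {V : Type*} (G : SimpleGraph V) : Prop :=
  ∀ n : ℕ, (∃ m ∈ cycleLengths G, m ≤ n) → (∃ m ∈ cycleLengths G, n ≤ m) →
    n ∈ cycleLengths G

namespace SimpleGraph

variable {V : Type*} {G : SimpleGraph V}

/-- A nontrivial path avoiding a universal vertex `v` closes up to a cycle through `v`. -/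
lemma IsUniversal.add_two_mem_cycleLengths {v x y : V} (hv : G.IsUniversal v) (p : G.Walk x y)
    (hp : p.IsPath) (hvp : v ∉ p.support) (hlen : 1 ≤ p.length) :
    p.length + 2 ∈ cycleLengths G := by
  have hx : v ≠ x := fun h => hvp (h ▸ p.start_mem_support)
  have hy : v ≠ y := fun h => hvp (h ▸ p.end_mem_support)
  have hxy : x ≠ y := by
    rintro rfl
    have := (Walk.isPath_iff_nil.mp hp).length_eq_zero
    omega
  refine ⟨v, .cons (hv hx) (p.concat (hv hy).symm), ?_, by simp⟩
  rw [Walk.cons_isCycle_iff]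
  refine ⟨hp.concat hvp _, ?_⟩
  rw [Walk.edges_concat, List.concat_eq_append, List.mem_append, List.mem_singleton, not_or]
  refine ⟨fun h => hvp (p.fst_mem_support_of_mem_edges h), ?_⟩
  simp [hy, hxy]

/-- A graph with a universal vertex is weakly pancyclic. -/
theorem IsUniversal.weaklyPancyclic {v : V} (hv : G.IsUniversal v) : WeaklyPancyclic G := by
  classical
  rintro n ⟨_, ⟨_, c, hc, rfl⟩, hle⟩ ⟨_, ⟨a, d, hd, rfl⟩, hge⟩
  have hn : 3 ≤ n := hc.three_le_length.trans hle
  obtain ⟨x, y, p, hp, hvp, hlen⟩ :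
      ∃ (x y : V) (p : G.Walk x y), p.IsPath ∧ v ∉ p.support ∧ p.length = n - 2 := by
    by_cases hvd : v ∈ d.support
    · have hr := hd.rotate hvd
      have hrl := Walk.length_rotate d v hvd
      generalize d.rotate v hvd = e at hr hrl
      cases e with
      | nil => simp at hr
      | cons h p =>
        rw [Walk.length_cons] at hrl
        have hp := ((Walk.cons_isCycle_iff p h).mp hr).1
        refine ⟨_, _, p.take (n - 2), hp.take _, fun hmem => ?_, ?_⟩
        · obtain ⟨i, hi, hile⟩ := Walk.mem_support_iff_exists_getVert.mp hmem
          rw [Walk.take_length] at hile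
          rw [Walk.take_getVert] at hi
          have := hp.getVert_injOn (x₁ := (n - 2) ⊓ i) (x₂ := p.length)
            (by simp; omega) (by simp) (by rw [hi, Walk.getVert_length])
          omega
        · rw [Walk.take_length]
          omega
    · cases d with
      | nil => simp at hd
      | cons h p =>
        rw [Walk.length_cons] at hge
        have hp := ((Walk.cons_isCycle_iff p h).mp hd).1
        refine ⟨_, _, p.take (n - 2), hp.take _, fun hmem => hvd ?_, ?_⟩
        · exact List.mem_cons_of_mem _ ((p.isSubwalk_take (n - 2)).support_subset hmem)
        · rw [Walk.take_length]
          omega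
  have := hv.add_two_mem_cycleLengths p hp hvp (by omega)
  rwa [hlen, Nat.sub_add_cancel (by omega)] at this

end SimpleGraph

/-- Lemma 6: every locally isometric graph of order `7` with maximum degree `6` is
weakly pancyclic. -/
theorem locallyIsometric_order_seven_maxDegree_six_weaklyPancyclic
    {V : Type*} [Fintype V] (G : SimpleGraph V) [DecidableRel G.Adj]
    (hli : LocallyIsometric G) (hn : Fintype.card V = 7)
    (hmax : G.maxDegree = 6) :
    WeaklyPancyclic G := by
  have : Nonempty V := Fintype.card_pos_iff.mp (by omega)
  obtain ⟨v, hv⟩ := G.exists_maximal_degree_vertex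
  have huniv : G.IsUniversal v := by
    classical
    rw [← degree_eq_card_sub_one, ← hv, hmax, hn]
  exact huniv.weaklyPancyclic
end

section
/- Let G be a connected locally isometric graph of order at least 4 that contains a vertex u of degree 2. Then the vertex-deleted subgraph G - u is locally isometric and c(G) ≤ c(G - u) + 1, where c denotes the circumference (length of a longest cycle). -/
open SimpleGraph

/-- The circumference of `G`: the length of a longest cycle (`0` if `G` is
acyclic). -/
noncomputable def circumference {V : Type*} (G : SimpleGraph V) : ℕ :=
  sSup (cycleLengths G)

/-- Being locally isometric, in elementary terms. -/
lemma locallyIsometric_iff {V : Type*} {G : SimpleGraph V} :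
    LocallyIsometric G ↔ ∀ v a b, G.Adj v a → G.Adj v b →
      a = b ∨ G.Adj a b ∨ ∃ z, G.Adj v z ∧ G.Adj a z ∧ G.Adj b z := by
  have key (v : V) (a b : G.neighborSet v) : (G.induce (G.neighborSet v)).edist a b ≤ 2 ↔
      a.1 = b.1 ∨ G.Adj a b ∨ ∃ z, G.Adj v z ∧ G.Adj a z ∧ G.Adj b z := by
    rw [← not_lt, two_lt_edist_iff, ← Set.not_nonempty_iff_eq_empty, ne_eq, Subtype.ext_iff]
    have : ((G.induce (G.neighborSet v)).commonNeighbors a b).Nonempty ↔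
        ∃ z, G.Adj v z ∧ G.Adj a z ∧ G.Adj b z := by
      simp [Set.Nonempty, mem_commonNeighbors, and_left_comm]
    rw [this, induce_adj, not_and_or, not_and_or, not_not, not_not, not_not]
  constructor
  · intro h v a b ha hb
    exact (key v ⟨a, ha⟩ ⟨b, hb⟩).1 (ediam_le_iff.1 (h v) _ _)
  · intro h v
    exact ediam_le_iff.2 fun a b => (key v a b).2 (h v a b a.2 b.2)

lemma length_walk_induce {V : Type*} {G : SimpleGraph V} {s : Set V} {a b : V} (p : G.Walk a b)
    (hp : ∀ x ∈ p.support, x ∈ s) : (p.induce s hp).length = p.length := by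
  conv_rhs => rw [← p.map_induce hp]
  exact (Walk.length_map _ _).symm

lemma bddAbove_cycleLengths {V : Type*} [Fintype V] (G : SimpleGraph V) :
    BddAbove (cycleLengths G) := by
  refine ⟨Fintype.card V, ?_⟩
  rintro n ⟨a, c, hc, rfl⟩
  simpa using hc.support_nodup.length_le_card

lemma le_circumference {V : Type*} [Finite V] {G : SimpleGraph V} {n : ℕ}
    (h : n ∈ cycleLengths G) : n ≤ circumference G := by
  have := Fintype.ofFinite V
  exact le_csSup (bddAbove_cycleLengths G) h

/-- Closing a path of length at least `2` by an edge joining its ends gives a cycle. -/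
lemma SimpleGraph.Walk.IsPath.length_add_one_mem_cycleLengths {V : Type*} {G : SimpleGraph V} {a b : V}
    {p : G.Walk a b} (hp : p.IsPath) (hl : 2 ≤ p.length) (hab : G.Adj b a) :
    p.length + 1 ∈ cycleLengths G := by
  refine ⟨b, .cons hab p, (Walk.cons_isCycle_iff p hab).2 ⟨hp, fun he => ?_⟩, by simp⟩
  have := hp.length_eq_one_of_mem_edges (Sym2.eq_swap ▸ he)
  omega

lemma three_mem_cycleLengths {V : Type*} {G : SimpleGraph V} {a b c : V}
    (hab : G.Adj a b) (hac : G.Adj a c) (hbc : G.Adj b c) : 3 ∈ cycleLengths G := by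
  classical
  exact is3Clique_iff_exists_cycle_length_three.1 ⟨_, is3Clique_triple_iff.2 ⟨hab, hac, hbc⟩⟩

/-- Given an edge, a further neighbour of one of its ends puts a triangle in a locally isometric
graph. -/
lemma LocallyIsometric.three_mem_cycleLengths_of_adj {V : Type*} {G : SimpleGraph V}
    (h : LocallyIsometric G) {a b x : V} (hab : G.Adj a b) (hax : G.Adj a x) (hbx : b ≠ x) :
    3 ∈ cycleLengths G := by
  obtain h | h | ⟨z, haz, hbz, -⟩ := locallyIsometric_iff.1 h a b x hab hax
  · exact absurd h hbx
  · exact three_mem_cycleLengths hab hax h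
  · exact three_mem_cycleLengths hab haz hbz

/-- A proper set of vertices of a connected graph that is nonempty has an edge leaving it. -/
lemma SimpleGraph.Preconnected.exists_adj_notMem {V : Type*} {G : SimpleGraph V}
    (h : G.Preconnected) {s : Set V} {u x : V} (hu : u ∈ s) (hx : x ∉ s) :
    ∃ a ∈ s, ∃ y ∉ s, G.Adj a y := by
  obtain ⟨p⟩ := h u x
  obtain ⟨d, -, h₁, h₂⟩ := p.exists_boundary_dart s hu hx
  exact ⟨d.fst, h₁, d.snd, h₂, d.adj⟩

lemma LocallyIsometric.delete_degree_two_vertex {V : Type*} {G : SimpleGraph V}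
    (hli : LocallyIsometric G) {u : V}
    (hu : ∀ a b c, G.Adj u a → G.Adj u b → G.Adj u c → a = b ∨ a = c ∨ b = c) :
    LocallyIsometric (G.induce {w : V | w ≠ u}) := by
  refine locallyIsometric_iff.2 ?_
  rintro ⟨v, hv⟩ ⟨a, ha⟩ ⟨b, hb⟩ hva hvb
  simp only [comap_adj, Function.Embedding.subtype_apply, Subtype.exists, Subtype.mk.injEq,
    Set.mem_ofPred_eq] at *
  obtain h | h | ⟨z, hvz, haz, hbz⟩ := locallyIsometric_iff.1 hli v a b hva hvb
  · exact .inl h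
  · exact .inr (.inl h)
  · by_cases hz : z = u
    · subst hz
      obtain h | h | h := hu v a b hvz.symm haz.symm hbz.symm
      · exact absurd h hva.ne
      · exact absurd h hvb.ne
      · exact .inl h
    · exact .inr (.inr ⟨z, hz, hvz, haz, hbz⟩)

/-- Bypassing `u` on a cycle by an edge joining its neighbours. -/
lemma cycle_length_le_circumference_delete_add_one {V : Type*} [Finite V] {G : SimpleGraph V}
    {u : V} (hadj : ∀ a b, G.Adj u a → G.Adj u b → a ≠ b → G.Adj a b)
    (h3 : 3 ∈ cycleLengths (G.induce {w : V | w ≠ u})) {x : V} {c : G.Walk x x} (hc : c.IsCycle) :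
    c.length ≤ circumference (G.induce {w : V | w ≠ u}) + 1 := by
  classical
  by_cases hux : u ∈ c.support
  · wlog hx : x = u generalizing x
    · simpa using this (hc.rotate hux) (by simp) rfl
    subst hx
    by_cases hl : c.length ≤ 3
    · exact hl.trans ((le_circumference h3).trans (Nat.le_succ _))
    have hne := hc.snd_ne_penultimate
    cases c with
    | nil => simp at hl
    | @cons _ v _ h p =>
      obtain ⟨hp, -⟩ := (Walk.cons_isCycle_iff p h).1 hc
      have hpn : ¬ p.Nil := Walk.not_nil_of_isCycle_cons hc
      have hpw := p.adj_penultimate hpn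
      rw [Walk.length_cons] at hl ⊢
      have hvw : G.Adj p.penultimate v := by
        refine hadj _ _ hpw.symm h fun e => hne ?_
        rw [Walk.penultimate_cons_of_not_nil _ _ hpn, e]
        simp
      have hsupp : ∀ y ∈ p.dropLast.support, y ∈ {w : V | w ≠ x} := by
        rintro y hy rfl
        rw [← Walk.concat_dropLast hpw, Walk.concat_isPath_iff] at hp
        exact hp.2 hy
      have hlen := (length_walk_induce _ hsupp).trans p.length_dropLast
      have hpath : (p.dropLast.induce _ hsupp).IsPath :=
        Walk.IsPath.of_map (f := (Embedding.induce _).toHom) (by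
          rw [Walk.map_induce]; exact hp.dropLast)
      have := le_circumference
        (hpath.length_add_one_mem_cycleLengths (by omega) (induce_adj.2 hvw))
      omega
  · have hsupp : ∀ y ∈ c.support, y ∈ {w : V | w ≠ u} := by
      rintro y hy rfl
      exact hux hy
    refine (le_circumference ⟨_, c.induce _ hsupp, ?_, length_walk_induce _ _⟩).trans (Nat.le_succ _)
    exact Walk.IsCycle.of_map (f := (Embedding.induce _).toHom) (by rwa [Walk.map_induce])

/-- Lemma 7: if `G` is a connected locally isometric graph of order at least `4`
containing a vertex `u` of degree `2`, then `G - u` is locally isometric and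
`c(G) ≤ c(G - u) + 1`. -/
theorem locallyIsometric_delete_degree_two_vertex
    {V : Type*} [Fintype V] (G : SimpleGraph V) [DecidableRel G.Adj]
    (hconn : G.Connected) (hli : LocallyIsometric G)
    (hn : 4 ≤ Fintype.card V) (u : V) (hu : G.degree u = 2) :
    LocallyIsometric (G.induce {w : V | w ≠ u}) ∧
      circumference G ≤ circumference (G.induce {w : V | w ≠ u}) + 1 := by
  classical
  obtain ⟨v, w, hvw, hN⟩ := Finset.card_eq_two.1 hu
  have hadj (x : V) : G.Adj u x ↔ x = v ∨ x = w := by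
    rw [← mem_neighborFinset, hN]; simp
  have hv : G.Adj u v := (hadj v).2 (.inl rfl)
  have hw : G.Adj u w := (hadj w).2 (.inr rfl)
  have hpair (a b : V) (ha : G.Adj u a) (hb : G.Adj u b) (hab : a ≠ b) : G.Adj a b := by
    obtain h | h | ⟨z, hz, haz, hbz⟩ := locallyIsometric_iff.1 hli u a b ha hb
    · exact absurd h hab
    · exact h
    · grind [haz.ne, hbz.ne]
  have hdel := hli.delete_degree_two_vertex (u := u) (by simp only [hadj]; grind)
  refine ⟨hdel, ?_⟩
  have h3 : 3 ∈ cycleLengths (G.induce {w : V | w ≠ u}) := by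
    obtain ⟨x, hx⟩ : ∃ x, x ∉ ({u, v, w} : Finset V) := by
      by_contra! h
      have := (Finset.card_le_card fun x _ => h x : (Finset.univ : Finset V).card ≤ _).trans
        Finset.card_le_three
      rw [Finset.card_univ] at this
      omega
    obtain ⟨a, ha, y, hy, hay⟩ := hconn.preconnected.exists_adj_notMem
      (s := (({u, v, w} : Finset V) : Set V)) (u := u) (by simp) (by simpa using hx)
    simp only [Finset.coe_insert, Finset.coe_singleton, Set.mem_insert_iff,
      Set.mem_singleton_iff, not_or] at ha hy
    obtain ⟨hyu, hyv, hyw⟩ := hy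
    have hvw' := hpair v w hv hw hvw
    obtain rfl | rfl | rfl := ha
    · grind
    · exact hdel.three_mem_cycleLengths_of_adj (a := ⟨a, hv.ne'⟩) (b := ⟨w, hw.ne'⟩) (x := ⟨y, hyu⟩)
        (induce_adj.2 hvw') (induce_adj.2 hay) fun e => hyw (congrArg Subtype.val e).symm
    · exact hdel.three_mem_cycleLengths_of_adj (a := ⟨a, hw.ne'⟩) (b := ⟨v, hv.ne'⟩) (x := ⟨y, hyu⟩)
        (induce_adj.2 hvw'.symm) (induce_adj.2 hay) fun e => hyv (congrArg Subtype.val e).symm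
  refine csSup_le' ?_
  rintro n ⟨a, c, hc, rfl⟩
  exact cycle_length_le_circumference_delete_add_one hpair h3 hc
end
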